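/- For every real number L there exists a positive integer k such that the following holds for every graph G: if G has tree-width at least k, then there exists a rational-valued length-function ℓ on G such that G contains an ℓ-geodesic cycle C with ℓ(C) ≥ L which is the 𝔽₂-sum of a family of cycles of G each of ℓ-length at most 1. -/

import Mathlib

open SimpleGraph

/-- A tree-decomposition of a graph `G`. -/
structure TreeDecomp {V : Type u} (G : SimpleGraph V) : Type (u + 1) where
  ι : Type u
  T : SimpleGraph ι
  conn : T.Connected
  acyc : T.IsAcyclic
  bag : ι → Set V
  covers : ∀ v : V, ∃ i, v ∈ bag i
  coversEdges : ∀ ⦃x y : V⦄, G.Adj x y → ∃ i, x ∈ bag i ∧ y ∈ bag i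
  coherent : ∀ (v : V) ⦃i j : ι⦄ (p : T.Walk i j), p.IsPath → v ∈ bag i → v ∈ bag j →
      ∀ k ∈ p.support, v ∈ bag k

/-- The width of a tree-decomposition: maximum bag size minus one. -/
noncomputable def TreeDecomp.width {V : Type u} {G : SimpleGraph V} (td : TreeDecomp G) : ℕ :=
  (⨆ i, (td.bag i).ncard) - 1

/-- The tree-width of a graph: the minimum width of a tree-decomposition. -/
noncomputable def treewidth {V : Type u} (G : SimpleGraph V) : ℕ :=
  sInf {w | ∃ td : TreeDecomp G, td.width = w}

/-- The `ℓ`-length of a walk: the sum of the lengths of its edges. -/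
def walkLen {V : Type u} {G : SimpleGraph V} (ℓ : Sym2 V → ℚ) {a b : V} (p : G.Walk a b) : ℚ :=
  (p.edges.map ℓ).sum

/-- A closed walk `c` is `ℓ`-geodesic: between any two of its vertices it contains a path
whose `ℓ`-length is minimum among all paths of `G` between those vertices. -/
def IsGeodesic {V : Type u} {G : SimpleGraph V} (ℓ : Sym2 V → ℚ) {v : V} (c : G.Walk v v) :
    Prop :=
  ∀ a ∈ c.support, ∀ b ∈ c.support,
    ∃ p : G.Walk a b, p.IsPath ∧ (∀ e ∈ p.edges, e ∈ c.edges) ∧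
      ∀ q : G.Walk a b, q.IsPath → walkLen ℓ p ≤ walkLen ℓ q

section Basics
variable {V : Type*} {G H : SimpleGraph V} {S T : Set V} {u v w : V}

/-- `v` can be reached from `u` by a walk of `G` inside `S`. -/
def ReachIn (G : SimpleGraph V) (S : Set V) (u v : V) : Prop :=
  ∃ p : G.Walk u v, ∀ x ∈ p.support, x ∈ S

/-- Any two vertices of `S` are joined by a walk inside `S`. -/
def ConnIn (G : SimpleGraph V) (S : Set V) : Prop :=
  ∀ u ∈ S, ∀ v ∈ S, ReachIn G S u v

theorem ReachIn.refl (h : u ∈ S) : ReachIn G S u u := ⟨.nil, by simpa⟩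

theorem ReachIn.symm (h : ReachIn G S u v) : ReachIn G S v u := by
  obtain ⟨p, hp⟩ := h
  exact ⟨p.reverse, by simpa using hp⟩

theorem ReachIn.trans (h : ReachIn G S u v) (h' : ReachIn G S v w) : ReachIn G S u w := by
  obtain ⟨p, hp⟩ := h
  obtain ⟨q, hq⟩ := h'
  refine ⟨p.append q, fun x hx => ?_⟩
  rcases (Walk.mem_support_append_iff _ _).1 hx with hx | hx
  exacts [hp x hx, hq x hx]

theorem ReachIn.mono (hGH : G ≤ H) (hST : S ⊆ T) (h : ReachIn G S u v) : ReachIn H T u v := by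
  obtain ⟨p, hp⟩ := h
  exact ⟨p.mapLe hGH, by simpa using fun x hx => hST (hp x hx)⟩

theorem ReachIn.left_mem (h : ReachIn G S u v) : u ∈ S := by
  obtain ⟨p, hp⟩ := h
  exact hp _ p.start_mem_support

theorem ReachIn.right_mem (h : ReachIn G S u v) : v ∈ S := h.symm.left_mem

theorem ReachIn.of_adj (h : G.Adj u v) (hu : u ∈ S) (hv : v ∈ S) : ReachIn G S u v :=
  ⟨h.toWalk, by simp [hu, hv]⟩

theorem ReachIn.step (h : ReachIn G S u v) (ha : G.Adj v w) (hw : w ∈ S) : ReachIn G S u w :=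
  h.trans (.of_adj ha h.right_mem hw)

theorem ReachIn.exists_isPath (h : ReachIn G S u v) :
    ∃ p : G.Walk u v, p.IsPath ∧ ∀ x ∈ p.support, x ∈ S := by
  classical
  obtain ⟨p, hp⟩ := h
  exact ⟨p.bypass, p.bypass_isPath, fun x hx => hp x (p.support_bypass_subset_support hx)⟩

/-- A set closed under steps inside `S` is closed under reachability. -/
theorem ReachIn.closed (h : ReachIn G S u v) {P : V → Prop} (hu : P u)
    (hP : ∀ x y, P x → G.Adj x y → y ∈ S → P y) : P v := by
  obtain ⟨p, hp⟩ := h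
  induction p with
  | nil => exact hu
  | cons hadj p ih =>
    refine ih (hP _ _ hu hadj (hp _ ?_)) fun x hx => hp x ?_
    · simp
    · simp [hx]

/-- A walk leaving `P` has a first step out of `P`. -/
theorem ReachIn.exists_first (h : ReachIn G S u v) {P : V → Prop} (hu : ¬ P u) (hv : P v) :
    ∃ x y, ReachIn G (S ∩ {z | ¬ P z}) u x ∧ G.Adj x y ∧ P y ∧ y ∈ S := by
  by_contra! hcon
  have : ReachIn G (S ∩ {z | ¬ P z}) u v :=
    h.closed (P := fun z => ReachIn G (S ∩ {z | ¬ P z}) u z) (.refl ⟨h.left_mem, hu⟩) (by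
      intro x y hx hxy hy
      refine hx.step hxy ⟨hy, fun hPy => hcon x y hx hxy hPy hy⟩)
  exact this.right_mem.2 hv

theorem ConnIn.mono (hGH : G ≤ H) (h : ConnIn G S) : ConnIn H S :=
  fun u hu v hv => (h u hu v hv).mono hGH subset_rfl

theorem ConnIn.of_center (h : ∀ v ∈ S, ReachIn G S u v) : ConnIn G S :=
  fun a ha b hb => (h a ha).symm.trans (h b hb)

theorem connIn_empty : ConnIn G ∅ := fun _ h => h.elim

theorem connIn_reach : ConnIn G {v | ReachIn G S u v} := by
  apply ConnIn.of_center (u := u)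
  intro v hv
  have hv' : ReachIn G S u v := hv
  refine hv'.closed (P := fun z => ReachIn G {v | ReachIn G S u v} u z)
    (.refl (.refl hv'.left_mem)) ?_
  intro x y hx hxy hy
  exact hx.step hxy (ReachIn.step hx.right_mem hxy hy)

theorem ConnIn.union (hS : ConnIn G S) (hT : ConnIn G T) {a b : V} (ha : a ∈ S) (hb : b ∈ T)
    (hab : a = b ∨ G.Adj a b) : ConnIn G (S ∪ T) := by
  have hab' : ReachIn G (S ∪ T) a b := by
    rcases hab with rfl | h
    · exact .refl (.inl ha)
    · exact .of_adj h (.inl ha) (.inr hb)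
  apply ConnIn.of_center (u := a)
  rintro v (hv | hv)
  · exact (hS a ha v hv).mono le_rfl Set.subset_union_left
  · exact hab'.trans ((hT b hb v hv).mono le_rfl Set.subset_union_right)

theorem connIn_support (p : G.Walk u v) : ConnIn G {x | x ∈ p.support} := by
  classical
  apply ConnIn.of_center (u := u)
  intro x hx
  exact ⟨p.takeUntil x hx, fun y hy => p.support_takeUntil_subset_support hx hy⟩

/-- `S` meets every walk from `A` to `B`. -/
def Separates (G : SimpleGraph V) (A B S : Set V) : Prop :=
  ∀ a ∈ A, ∀ b ∈ B, ¬ ReachIn G Sᶜ a b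

/-- A family of disjoint paths from `A` to `B`, indexed by `ι`. -/
structure Linkage (G : SimpleGraph V) (A B : Set V) (ι : Type*) where
  src : ι → V
  tgt : ι → V
  walk : ∀ i, G.Walk (src i) (tgt i)
  isPath : ∀ i, (walk i).IsPath
  src_mem : ∀ i, src i ∈ A
  tgt_mem : ∀ i, tgt i ∈ B
  disj : ∀ i j x, x ∈ (walk i).support → x ∈ (walk j).support → i = j

theorem linkage_of_walks {A B : Set V} {ι : Type*} (s t : ι → V) (hs : ∀ i, s i ∈ A)
    (ht : ∀ i, t i ∈ B) (p : ∀ i, G.Walk (s i) (t i))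
    (hd : ∀ i j x, x ∈ (p i).support → x ∈ (p j).support → i = j) :
    ∃ L : Linkage G A B ι, ∀ i, (∀ x ∈ (L.walk i).support, x ∈ (p i).support) ∧
      L.src i = s i ∧ L.tgt i = t i := by
  classical
  exact ⟨⟨s, t, fun i => (p i).bypass, fun i => (p i).bypass_isPath, hs, ht, fun i j x hi hj =>
    hd i j x ((p i).support_bypass_subset_support hi) ((p j).support_bypass_subset_support hj)⟩,
    fun i => ⟨fun x hx => (p i).support_bypass_subset_support hx, rfl, rfl⟩⟩

namespace Linkage
variable {A B : Set V} {ι κ : Type*}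

/-- Regard a linkage as a linkage of a larger graph between larger sets. -/
def mono (L : Linkage G A B ι) (h : G ≤ H) {A' B' : Set V} (hA : A ⊆ A') (hB : B ⊆ B') :
    Linkage H A' B' ι where
  src := L.src
  tgt := L.tgt
  walk i := (L.walk i).mapLe h
  isPath i := (L.isPath i).mapLe h
  src_mem i := hA (L.src_mem i)
  tgt_mem i := hB (L.tgt_mem i)
  disj i j x hi hj := L.disj i j x (by simpa using hi) (by simpa using hj)

/-- Reindex a linkage along an injection. -/
def comp (L : Linkage G A B ι) (f : κ → ι) (hf : f.Injective) : Linkage G A B κ where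
  src i := L.src (f i)
  tgt i := L.tgt (f i)
  walk i := L.walk (f i)
  isPath i := L.isPath (f i)
  src_mem i := L.src_mem (f i)
  tgt_mem i := L.tgt_mem (f i)
  disj _ _ x hi hj := hf (L.disj _ _ x hi hj)

theorem src_injective (L : Linkage G A B ι) : L.src.Injective := fun i j h =>
  L.disj i j (L.src i) (L.walk i).start_mem_support (by rw [h]; exact (L.walk j).start_mem_support)

theorem tgt_injective (L : Linkage G A B ι) : L.tgt.Injective := fun i j h =>
  L.disj i j (L.tgt i) (L.walk i).end_mem_support (by rw [h]; exact (L.walk j).end_mem_support)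

/-- Reverse all paths. -/
def reverse (L : Linkage G A B ι) : Linkage G B A ι where
  src := L.tgt
  tgt := L.src
  walk i := (L.walk i).reverse
  isPath i := (L.isPath i).reverse
  src_mem := L.tgt_mem
  tgt_mem := L.src_mem
  disj i j x hi hj := L.disj i j x (by simpa using hi) (by simpa using hj)

end Linkage

theorem Separates.symm {A B : Set V} (h : Separates G A B S) : Separates G B A S :=
  fun a ha b hb hr => h b hb a ha hr.symm

end Basics

section Menger
variable {V : Type*} {G : SimpleGraph V} {A B S : Set V} {x y u v w : V}

theorem ReachIn.deleteEdge (h : ReachIn G S u v) (hx : x ∉ S) :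
    ReachIn (G.deleteEdges {s(x, y)}) S u v := by
  refine h.closed (P := fun z => ReachIn (G.deleteEdges {s(x, y)}) S u z) (.refl h.left_mem) ?_
  intro a b ha hab hb
  refine ha.step ?_ hb
  rw [deleteEdges_adj]
  refine ⟨hab, fun he => ?_⟩
  simp only [Set.mem_singleton_iff, Sym2.eq_iff] at he
  rcases he with ⟨rfl, rfl⟩ | ⟨rfl, rfl⟩
  exacts [hx ha.right_mem, hx hb]

theorem separates_of_deleteEdge {W : Set V} (hsep : Separates G A B (insert x S))
    (hy : ∀ a ∈ A, ¬ ReachIn (G.deleteEdges {s(x, y)}) Sᶜ a y)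
    (hW : Separates (G.deleteEdges {s(x, y)}) A (insert x S) W) : Separates G A B W := by
  intro a ha b hb hab
  have hex : ∃ v ∈ insert x S, ReachIn G Wᶜ a v := by
    by_contra! hcon
    have h1 : ReachIn G (insert x S)ᶜ a b := by
      refine ReachIn.mono (S := {v | ReachIn G Wᶜ a v}) le_rfl
        (fun v hv hv' => hcon v hv' hv) ?_
      exact connIn_reach a (.refl hab.left_mem) b hab
    exact hsep a ha b hb h1
  obtain ⟨v, hv, hav⟩ := hex
  by_cases haS : a ∈ insert x S
  · exact hW a ha a haS (.refl hab.left_mem)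
  obtain ⟨p, q, h1, hpq, hq, hqW⟩ := hav.exists_first (P := fun z => z ∈ insert x S) haS hv
  have h2 : ReachIn (G.deleteEdges {s(x, y)}) (Wᶜ ∩ {z | z ∉ insert x S}) a p :=
    h1.deleteEdge (by simp)
  by_cases he : s(p, q) = s(x, y)
  · rw [Sym2.eq_iff] at he
    rcases he with ⟨rfl, rfl⟩ | ⟨rfl, rfl⟩
    · exact h2.right_mem.2 (by simp)
    · exact hy a ha (h2.mono le_rfl fun z hz hzS => hz.2 (by simp [hzS]))
  · refine hW a ha q hq ((h2.mono le_rfl Set.inter_subset_left).step ?_ hqW)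
    rw [deleteEdges_adj]
    exact ⟨hpq, he⟩

theorem ReachIn.walk_prefix (p : G.Walk u v) (hp : p.IsPath) (hw : w ∈ p.support) (hwv : w ≠ v)
    (hS : ∀ z ∈ p.support, z ∈ S → z = v) : ReachIn G Sᶜ u w := by
  classical
  refine ⟨p.takeUntil w hw, fun z hz hzS => ?_⟩
  have := hS z (p.support_takeUntil_subset_support hw hz) hzS
  subst this
  exact Walk.endpoint_notMem_support_takeUntil hp hw hwv.symm hz

theorem menger_concat [Finite V] {k : ℕ} {G' : SimpleGraph V} (hG : G' ≤ G)
    (hS : S.ncard + 1 = k) (hx : x ∉ S) (hy : y ∉ S) (hxy : G.Adj x y)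
    (hsep : Separates G' A B S)
    (P : Linkage G' A (insert x S) (Fin k)) (Q : Linkage G' (insert y S) B (Fin k)) :
    Nonempty (Linkage G A B (Fin k)) := by
  classical
  have surj : ∀ (z : V) (f : Fin k → V), z ∉ S → f.Injective → (∀ i, f i ∈ insert z S) →
      ∀ s ∈ insert z S, ∃ i, f i = s := by
    intro z f hz hf hfm s hs
    have h1 : Set.range f = insert z S := by
      apply Set.eq_of_subset_of_ncard_le (by rintro _ ⟨i, rfl⟩; exact hfm i) _ (Set.toFinite _)
      rw [← Set.image_univ, Set.ncard_image_of_injective _ hf,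
        Set.ncard_insert_of_notMem hz S.toFinite]
      simp [hS]
    rw [← h1] at hs
    exact hs
  have hPs := surj x P.tgt hx P.tgt_injective P.tgt_mem
  have hQs := surj y Q.src hy Q.src_injective Q.src_mem
  have hPend : ∀ i, ∀ z ∈ (P.walk i).support, z ∈ S → z = P.tgt i := by
    intro i z hz hzS
    obtain ⟨j, rfl⟩ := hPs z (by simp [hzS])
    rw [P.disj i j _ hz (P.walk j).end_mem_support]
  have hQend : ∀ i, ∀ z ∈ (Q.walk i).support, z ∈ S → z = Q.src i := by
    intro i z hz hzS
    obtain ⟨j, rfl⟩ := hQs z (by simp [hzS])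
    rw [Q.disj i j _ hz (Q.walk j).start_mem_support]
  have hPQ : ∀ i j z, z ∈ (P.walk i).support → z ∈ (Q.walk j).support → z ∈ S := by
    intro i j z hzP hzQ
    by_contra hzS
    have h1 : ReachIn G' Sᶜ (P.src i) z := by
      by_cases hzt : z = P.tgt i
      · subst hzt
        refine ⟨P.walk i, fun w hw hwS => ?_⟩
        exact hzS (hPend i w hw hwS ▸ hwS)
      · exact ReachIn.walk_prefix (P.walk i) (P.isPath i) hzP hzt (hPend i)
    have h2 : ReachIn G' Sᶜ (Q.tgt j) z := by
      by_cases hzt : z = Q.src j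
      · subst hzt
        refine ⟨(Q.walk j).reverse, fun w hw hwS => ?_⟩
        exact hzS (hQend j w (by simpa using hw) hwS ▸ hwS)
      · exact ReachIn.walk_prefix (Q.walk j).reverse (Q.isPath j).reverse (by simpa using hzQ) hzt
          (by simpa using hQend j)
    exact hsep _ (P.src_mem i) _ (Q.tgt_mem j) (h1.trans h2.symm)
  have hmatch : ∀ i, ∃ j, (P.tgt i ∈ S ∧ Q.src j = P.tgt i) ∨ (P.tgt i = x ∧ Q.src j = y) := by
    intro i
    rcases P.tgt_mem i with h | h
    · obtain ⟨j, hj⟩ := hQs y (by simp)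
      exact ⟨j, .inr ⟨h, hj⟩⟩
    · obtain ⟨j, hj⟩ := hQs (P.tgt i) (by simp [h])
      exact ⟨j, .inl ⟨h, hj⟩⟩
  choose f hf using hmatch
  have hfinj : Function.Injective f := by
    intro i i' h
    apply P.tgt_injective
    have h1 := hf i
    have h2 := hf i'
    rw [h] at h1
    rcases h1 with ⟨h1, h1'⟩ | ⟨h1, h1'⟩ <;> rcases h2 with ⟨h2, h2'⟩ | ⟨h2, h2'⟩
    · rw [← h1', ← h2']
    · exact absurd (by rwa [← h1', h2'] at h1) hy
    · exact absurd (by rwa [← h2', h1'] at h2) hy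
    · rw [h1, h2]
  have hw : ∀ i, ∃ p : G.Walk (P.src i) (Q.tgt (f i)), ∀ z ∈ p.support,
      z ∈ (P.walk i).support ∨ z ∈ (Q.walk (f i)).support := by
    intro i
    have h1 : ReachIn G {z | z ∈ (P.walk i).support ∨ z ∈ (Q.walk (f i)).support}
        (P.src i) (P.tgt i) :=
      ReachIn.mono hG (fun z hz => .inl hz) ⟨P.walk i, fun z hz => hz⟩
    have h2 : ReachIn G {z | z ∈ (P.walk i).support ∨ z ∈ (Q.walk (f i)).support}
        (Q.src (f i)) (Q.tgt (f i)) :=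
      ReachIn.mono hG (fun z hz => .inr hz) ⟨Q.walk (f i), fun z hz => hz⟩
    rcases hf i with ⟨-, h⟩ | ⟨h, h'⟩
    · exact h1.trans (h.subst (motive := fun t => ReachIn G
        {z | z ∈ (P.walk i).support ∨ z ∈ (Q.walk (f i)).support} t _) h2)
    · refine (h1.step ?_ h2.left_mem).trans h2
      rw [h, h']
      exact hxy
  choose p hp using hw
  have key : ∀ i j z, z ∈ (P.walk i).support → z ∈ (Q.walk (f j)).support → i = j := by
    intro i j z hi hj
    have hzS := hPQ _ _ _ hi hj
    have h1 := hPend _ _ hi hzS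
    have h2 := hQend _ _ hj hzS
    apply P.tgt_injective
    rcases hf j with ⟨-, h⟩ | ⟨-, h⟩
    · rw [← h1, h2, h]
    · exact absurd (h ▸ h2 ▸ hzS : y ∈ S) hy
  obtain ⟨L, -⟩ := linkage_of_walks (A := A) (B := B) P.src (fun i => Q.tgt (f i)) P.src_mem
    (fun i => Q.tgt_mem _) p (by
      intro i j z hi hj
      rcases hp i z hi with h1 | h1 <;> rcases hp j z hj with h2 | h2
      · exact P.disj _ _ _ h1 h2
      · exact key _ _ _ h1 h2
      · exact (key _ _ _ h2 h1).symm
      · exact hfinj (Q.disj _ _ _ h1 h2))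
  exact ⟨L⟩

/-- **Menger's theorem**: if every `A`–`B` separator has at least `k` vertices, there are `k`
disjoint `A`–`B` paths. -/
theorem menger [Finite V] {k : ℕ} (h : ∀ S, Separates G A B S → k ≤ S.ncard) :
    Nonempty (Linkage G A B (Fin k)) := by
  classical
  induction hn : G.edgeSet.ncard using Nat.strong_induction_on generalizing G A B k with
  | _ n ih =>
  by_cases hE : G.edgeSet = ∅
  · have hsep : Separates G A B (A ∩ B) := by
      intro a ha b hb hab
      have : b = a := hab.closed (P := fun z => z = a) rfl fun x y _ hxy => by
        have : s(x, y) ∈ G.edgeSet := hxy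
        simp [hE] at this
      subst this
      exact hab.left_mem ⟨ha, hb⟩
    obtain ⟨T, hT, hTc⟩ := Set.exists_subset_card_eq (h _ hsep)
    have : Nonempty (Fin k ≃ T) := by
      rw [← hTc]
      exact ⟨(Finite.equivFin T).symm.trans (Equiv.refl _) |> fun e => (finCongr (by rfl)).trans e⟩
    obtain ⟨e⟩ := this
    obtain ⟨L, -⟩ := linkage_of_walks (G := G) (A := A) (B := B) (fun i => (e i : V))
      (fun i => (e i : V)) (fun i => (hT (e i).2).1) (fun i => (hT (e i).2).2)
      (fun i => Walk.nil) (by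
        intro i j z hi hj
        simp only [Walk.support_nil, List.mem_singleton] at hi hj
        exact e.injective (Subtype.ext (hi ▸ hj)))
    exact ⟨L⟩
  obtain ⟨e, he⟩ := Set.nonempty_iff_ne_empty.2 hE
  have hlt : (G.deleteEdges {e}).edgeSet.ncard < n := by
    rw [← hn, edgeSet_deleteEdges]
    exact Set.ncard_lt_ncard ⟨Set.sdiff_subset, fun hh => (hh he).2 rfl⟩ (Set.toFinite _)
  by_cases hcase : ∀ S, Separates (G.deleteEdges {e}) A B S → k ≤ S.ncard
  · obtain ⟨L⟩ := ih _ hlt hcase rfl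
    exact ⟨L.mono (deleteEdges_le _) subset_rfl subset_rfl⟩
  push Not at hcase
  obtain ⟨S, hS, hSk⟩ := hcase
  have hSG : ¬ Separates G A B S := fun hh => absurd (h S hh) (by omega)
  have : ∃ a ∈ A, ∃ b ∈ B, ReachIn G Sᶜ a b := by
    unfold Separates at hSG
    push Not at hSG
    exact hSG
  obtain ⟨a, ha, b, hb, hab⟩ := this
  obtain ⟨x, y, hax, hxy, hy, hyS⟩ := hab.exists_first
    (P := fun z => ¬ ∃ a ∈ A, ReachIn (G.deleteEdges {e}) Sᶜ a z)
    (fun hh => hh ⟨a, ha, .refl hab.left_mem⟩) (fun ⟨a', ha', hh⟩ => hS a' ha' b hb hh)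
  have hx : ∃ a ∈ A, ReachIn (G.deleteEdges {e}) Sᶜ a x := not_not.1 hax.right_mem.2
  have hxS : x ∉ S := hax.right_mem.1
  have hexy : e = s(x, y) := by
    by_contra hne
    obtain ⟨a', ha', hr⟩ := hx
    refine hy ⟨a', ha', hr.step ?_ hyS⟩
    rw [deleteEdges_adj]
    exact ⟨hxy, fun hh => hne hh.symm⟩
  have sepx : ∀ x y, e = s(x, y) → Separates G A B (insert x S) := by
    intro x y hexy a ha b hb hr
    have := hr.deleteEdge (x := x) (y := y) (by simp)
    rw [← hexy] at this
    exact hS a ha b hb (this.mono le_rfl (by intro z hz hzS; exact hz (by simp [hzS])))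
  have hyx : e = s(y, x) := by rw [hexy, Sym2.eq_swap]
  have hcard : S.ncard + 1 = k := by
    have := h _ (sepx x y hexy)
    rw [Set.ncard_insert_of_notMem hxS S.toFinite] at this
    omega
  obtain ⟨P⟩ := ih _ hlt (G := G.deleteEdges {e}) (A := A) (B := insert x S) (k := k)
    (fun W hW => h W (separates_of_deleteEdge (x := x) (y := y) (sepx x y hexy)
      (fun a ha hr => hy ⟨a, ha, hexy ▸ hr⟩) (hexy ▸ hW))) rfl
  obtain ⟨Q⟩ := ih _ hlt (G := G.deleteEdges {e}) (A := insert y S) (B := B) (k := k)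
    (fun W hW => h W (separates_of_deleteEdge (x := y) (y := x) (sepx y x hyx).symm
      (by
        intro b hb hr
        rw [← hyx] at hr
        obtain ⟨a', ha', hr'⟩ := hx
        exact hS a' ha' b hb (hr'.trans hr.symm)) (hyx ▸ hW.symm)).symm) rfl
  exact menger_concat (deleteEdges_le _) hcard hxS hyS hxy hS P Q

/-- Menger's theorem with a separator consisting of one vertex from each path. -/
theorem menger_strong [Finite V] (G : SimpleGraph V) (A B : Set V) :
    ∃ (S : Set V) (L : Linkage G A B S), Separates G A B S ∧ ∀ s : S, (s : V) ∈ (L.walk s).support := by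
  classical
  have hex : ∃ n, ∃ S, Separates G A B S ∧ S.ncard = n :=
    ⟨_, A, fun a ha b _ hr => hr.left_mem ha, rfl⟩
  obtain ⟨S, hS, hSn⟩ := Nat.find_spec hex
  have hmin : ∀ T, Separates G A B T → S.ncard ≤ T.ncard := fun T hT => by
    rw [hSn]
    exact Nat.find_min' hex ⟨T, hT, rfl⟩
  obtain ⟨L⟩ := menger hmin
  have : ∀ i, ∃ x ∈ S, x ∈ (L.walk i).support := by
    intro i
    by_contra! hc
    exact hS _ (L.src_mem i) _ (L.tgt_mem i) ⟨L.walk i, fun x hx hxS => hc x hxS hx⟩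
  choose f hfS hf using this
  have hinj : Function.Injective f := fun i j hij => L.disj i j (f i) (hf i) (by
    rw [hij]; exact hf j)
  have hr : Set.range f = S := by
    apply Set.eq_of_subset_of_ncard_le (by rintro _ ⟨i, rfl⟩; exact hfS i) _ (Set.toFinite _)
    rw [← Set.image_univ, Set.ncard_image_of_injective _ hinj]
    simp
  have hg : ∀ s : S, ∃ i, f i = s := fun s => by
    have : (s : V) ∈ Set.range f := hr.symm.subset s.2
    exact this
  choose g hg using hg
  refine ⟨S, L.comp g (fun s t hst => Subtype.ext (by rw [← hg s, ← hg t, hst])), hS, fun s => ?_⟩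
  have := hf (g s)
  rw [hg] at this
  exact this

end Menger

section PartialDecomp
universe u

theorem isAcyclic_sum {α β : Type*} {S : SimpleGraph α} {T : SimpleGraph β} (hS : S.IsAcyclic)
    (hT : T.IsAcyclic) : (S ⊕g T).IsAcyclic := by
  rw [isAcyclic_iff_forall_adj_isBridge] at *
  rintro (a | a) (b | b) hab
  · rw [sum_adj_inl] at hab
    have := hS hab
    rw [isBridge_iff] at this ⊢
    rintro ⟨p⟩
    have hr : ReachIn ((S ⊕g T).deleteEdges {s(Sum.inl a, Sum.inl b)}) Set.univ
      (Sum.inl a) (Sum.inl b) := ⟨p, by simp⟩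
    refine this (hr.closed (P := fun z => Sum.elim (fun z => (S.deleteEdges {s(a, b)}).Reachable a z)
      (fun _ => False) z) (Reachable.refl _) ?_)
    rintro (x | x) (y | y) hx hxy -
    · refine Reachable.trans hx (Adj.reachable ?_)
      simpa [deleteEdges_adj] using hxy
    · simp [deleteEdges_adj] at hxy
    · exact hx.elim
    · exact hx.elim
  · simp at hab
  · simp at hab
  · rw [sum_adj_inr] at hab
    have := hT hab
    rw [isBridge_iff] at this ⊢
    rintro ⟨p⟩
    have hr : ReachIn ((S ⊕g T).deleteEdges {s(Sum.inr a, Sum.inr b)}) Set.univ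
      (Sum.inr a) (Sum.inr b) := ⟨p, by simp⟩
    refine this (hr.closed (P := fun z => Sum.elim (fun _ => False)
      (fun z => (T.deleteEdges {s(a, b)}).Reachable a z) z) (Reachable.refl _) ?_)
    rintro (x | x) (y | y) hx hxy -
    · exact hx.elim
    · exact hx.elim
    · simp [deleteEdges_adj] at hxy
    · refine Reachable.trans hx (Adj.reachable ?_)
      simpa [deleteEdges_adj] using hxy

theorem ReachIn.map {α β : Type*} {S : SimpleGraph α} {T : SimpleGraph β} {A : Set α} {B : Set β}
    {a b : α} (f : S →g T) (hf : ∀ x ∈ A, f x ∈ B) (h : ReachIn S A a b) :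
    ReachIn T B (f a) (f b) := by
  obtain ⟨p, hp⟩ := h
  refine ⟨p.map f, fun x hx => ?_⟩
  rw [Walk.support_map, List.mem_map] at hx
  obtain ⟨y, hy, rfl⟩ := hx
  exact hf y (hp y hy)

/-- A tree-decomposition of the subgraph of `G` induced on `S`. -/
structure PartialDecomp {V : Type u} (G : SimpleGraph V) (S : Set V) : Type (u + 1) where
  ι : Type u
  T : SimpleGraph ι
  conn : T.Connected
  acyc : T.IsAcyclic
  bag : ι → Set V
  sub : ∀ i, bag i ⊆ S
  covers : ∀ v ∈ S, ∃ i, v ∈ bag i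
  coversEdges : ∀ x ∈ S, ∀ y ∈ S, G.Adj x y → ∃ i, x ∈ bag i ∧ y ∈ bag i
  coherent : ∀ v, ConnIn T {i | v ∈ bag i}

/-- `G` restricted to `S` has a tree-decomposition with bags of size at most `w`, one of them
containing `X`. -/
def HasDecomp {V : Type u} (G : SimpleGraph V) (S X : Set V) (w : ℕ) : Prop :=
  ∃ D : PartialDecomp G S, (∀ i, (D.bag i).ncard ≤ w) ∧ ∃ i, X ⊆ D.bag i

variable {V : Type u} {G : SimpleGraph V} {S S₁ S₂ X X₁ X₂ : Set V} {w : ℕ}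

theorem hasDecomp_single (h : S.ncard ≤ w) : HasDecomp G S S w := by
  refine ⟨⟨PUnit, ⊥, ⟨fun a b => by cases a; cases b; rfl⟩, ?_, fun _ => S, fun _ => subset_rfl,
    fun v hv => ⟨⟨⟩, hv⟩, fun x hx y hy _ => ⟨⟨⟩, hx, hy⟩, ?_⟩, fun _ => h, ⟨⟩, subset_rfl⟩
  · exact isAcyclic_bot
  · rintro v ⟨⟩ hi ⟨⟩ hj
    exact .refl hi

theorem HasDecomp.mono (h : HasDecomp G S X w) (hX : X₁ ⊆ X) : HasDecomp G S X₁ w := by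
  obtain ⟨D, hD, i, hi⟩ := h
  exact ⟨D, hD, i, hX.trans hi⟩

theorem HasDecomp.glue (h₁ : HasDecomp G S₁ X₁ w) (h₂ : HasDecomp G S₂ X₂ w)
    (hS : S₁ ∩ S₂ ⊆ X₁ ∩ X₂)
    (hE : ∀ x ∈ S₁ ∪ S₂, ∀ y ∈ S₁ ∪ S₂, G.Adj x y → (x ∈ S₁ ∧ y ∈ S₁) ∨ (x ∈ S₂ ∧ y ∈ S₂)) :
    HasDecomp G (S₁ ∪ S₂) X₁ w := by
  obtain ⟨D, hD, i, hi⟩ := h₁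
  obtain ⟨E, hE', j, hj⟩ := h₂
  let T := (D.T ⊕g E.T) ⊔ edge (Sum.inl i) (Sum.inr j)
  have fl : ∀ A : Set (D.ι ⊕ E.ι), ∀ a b, ReachIn D.T {x | Sum.inl x ∈ A} a b →
      ReachIn T A (Sum.inl a) (Sum.inl b) := fun A a b h =>
    (h.map (B := A) Embedding.sumInl.toHom (fun x hx => hx)).mono
      (show D.T ⊕g E.T ≤ T from le_sup_left) subset_rfl
  have fr : ∀ A : Set (D.ι ⊕ E.ι), ∀ a b, ReachIn E.T {x | Sum.inr x ∈ A} a b →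
      ReachIn T A (Sum.inr a) (Sum.inr b) := fun A a b h =>
    (h.map (B := A) Embedding.sumInr.toHom (fun x hx => hx)).mono
      (show D.T ⊕g E.T ≤ T from le_sup_left) subset_rfl
  have hij : T.Adj (Sum.inl i) (Sum.inr j) := by simp [T, edge_adj]
  refine ⟨⟨D.ι ⊕ E.ι, T, D.conn.sum_sup_edge E.conn,
    (isAcyclic_sum D.acyc E.acyc).sup_edge_of_not_reachable (not_reachable_sum_inl_inr i j),
    Sum.elim D.bag E.bag, ?_, ?_, ?_, ?_⟩, ?_, .inl i, hi⟩
  · rintro (a | a)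
    · exact (D.sub a).trans Set.subset_union_left
    · exact (E.sub a).trans Set.subset_union_right
  · rintro v (hv | hv)
    · obtain ⟨a, ha⟩ := D.covers v hv
      exact ⟨.inl a, ha⟩
    · obtain ⟨a, ha⟩ := E.covers v hv
      exact ⟨.inr a, ha⟩
  · intro x hx y hy hxy
    rcases hE x hx y hy hxy with ⟨hx, hy⟩ | ⟨hx, hy⟩
    · obtain ⟨a, ha⟩ := D.coversEdges x hx y hy hxy
      exact ⟨.inl a, ha⟩
    · obtain ⟨a, ha⟩ := E.coversEdges x hx y hy hxy
      exact ⟨.inr a, ha⟩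
  · intro v
    have cross : ∀ a b, v ∈ D.bag a → v ∈ E.bag b →
        ReachIn T {x | v ∈ Sum.elim D.bag E.bag x} (.inl a) (.inr b) := by
      intro a b ha hb
      have hv := hS ⟨D.sub _ ha, E.sub _ hb⟩
      exact ((fl _ _ _ (D.coherent v a ha i (hi hv.1))).step hij (hj hv.2)).trans
        (fr _ _ _ (E.coherent v j (hj hv.2) b hb))
    rintro (a | a) ha (b | b) hb
    · exact fl _ _ _ (D.coherent v a ha b hb)
    · exact cross a b ha hb
    · exact (cross b a hb ha).symm
    · exact fr _ _ _ (E.coherent v a ha b hb)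
  · rintro (a | a)
    exacts [hD a, hE' a]

theorem HasDecomp.treewidth_lt [Finite V] (h : HasDecomp G Set.univ X w) (hw : 0 < w) :
    treewidth G < w := by
  obtain ⟨D, hD, -⟩ := h
  let E : TreeDecomp G := ⟨D.ι, D.T, D.conn, D.acyc, D.bag, fun v => D.covers v trivial,
    fun x y hxy => D.coversEdges x trivial y trivial hxy, by
      intro v i j p hp hi hj k hk
      obtain ⟨q, hq, hqs⟩ := (D.coherent v i hi j hj).exists_isPath
      have := D.acyc.subsingleton_path i j |>.elim ⟨p, hp⟩ ⟨q, hq⟩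
      rw [Subtype.mk.injEq] at this
      subst this
      exact hqs k hk⟩
  have h1 : E.width ≤ w - 1 := by
    have : Nonempty D.ι := D.conn.nonempty
    exact Nat.sub_le_sub_right (ciSup_le (f := fun i => (D.bag i).ncard) hD) 1
  have h2 : treewidth G ≤ E.width := Nat.sInf_le ⟨E, rfl⟩
  omega

end PartialDecomp

section LinkageGraph
variable {V : Type*} {G : SimpleGraph V} {A B : Set V} {ι : Type*}

/-- The union of the paths of a linkage. -/
def Linkage.graph (L : Linkage G A B ι) : SimpleGraph V where
  Adj a b := ∃ i, (L.walk i).toSubgraph.Adj a b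
  symm := ⟨fun _ _ ⟨i, h⟩ => ⟨i, h.symm⟩⟩
  loopless := ⟨fun _ ⟨_, h⟩ => h.ne rfl⟩

theorem Linkage.graph_le (L : Linkage G A B ι) : L.graph ≤ G :=
  fun _ _ ⟨_, h⟩ => h.adj_sub

theorem ReachIn.of_toSubgraph {H : SimpleGraph V} {u v : V} (p : G.Walk u v)
    (hH : ∀ a b, p.toSubgraph.Adj a b → H.Adj a b) : ReachIn H {x | x ∈ p.support} u v := by
  have hp : ∀ e ∈ p.edges, e ∈ H.edgeSet := by
    intro e he
    induction e with
    | _ a b => exact hH a b (Walk.adj_toSubgraph_iff_mem_edges.2 he)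
  exact ⟨p.transfer H hp, by simp⟩

theorem Linkage.reachIn_graph (L : Linkage G A B ι) (i : ι) :
    ReachIn L.graph {x | x ∈ (L.walk i).support} (L.src i) (L.tgt i) :=
  .of_toSubgraph _ fun _ _ h => ⟨i, h⟩

theorem Linkage.exists_of_graph_adj (L : Linkage G A B ι) {a b : V} (h : L.graph.Adj a b) :
    ∃ i, a ∈ (L.walk i).support ∧ b ∈ (L.walk i).support := by
  obtain ⟨i, hi⟩ := h
  exact ⟨i, Walk.mem_support_of_adj_toSubgraph hi, Walk.mem_support_of_adj_toSubgraph hi.symm⟩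

theorem Linkage.neighborSet_graph (L : Linkage G A B ι) {i : ι} {v : V}
    (hv : v ∈ (L.walk i).support) :
    L.graph.neighborSet v = (L.walk i).toSubgraph.neighborSet v := by
  ext w
  constructor
  · rintro ⟨j, hj⟩
    have : i = j := L.disj i j v hv (Walk.mem_support_of_adj_toSubgraph hj)
    subst this
    exact hj
  · exact fun h => ⟨i, h⟩

theorem Linkage.neighborSet_graph_of_notMem (L : Linkage G A B ι) {v : V}
    (hv : ∀ i, v ∉ (L.walk i).support) : L.graph.neighborSet v = ∅ := by
  ext w
  simp only [mem_neighborSet, Set.mem_empty_iff_false, iff_false]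
  rintro ⟨j, hj⟩
  exact hv j (Walk.mem_support_of_adj_toSubgraph hj)

theorem ncard_neighborSet_toSubgraph_src {u v : V} (p : G.Walk u v) (hp : p.IsPath) :
    (p.toSubgraph.neighborSet u).ncard ≤ 1 := by
  by_cases hn : p.Nil
  · have : p.toSubgraph.neighborSet u = ∅ := by
      ext w
      simp only [Subgraph.mem_neighborSet, Set.mem_empty_iff_false, iff_false]
      intro h
      rw [Walk.adj_toSubgraph_iff_mem_edges, Walk.edges_eq_nil.2 hn] at h
      simp at h
    simp [this]
  · rw [hp.neighborSet_toSubgraph_startpoint hn]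
    simp

theorem ncard_neighborSet_toSubgraph_tgt {u v : V} (p : G.Walk u v) (hp : p.IsPath) :
    (p.toSubgraph.neighborSet v).ncard ≤ 1 := by
  have := ncard_neighborSet_toSubgraph_src p.reverse hp.reverse
  rwa [Walk.toSubgraph_reverse] at this

theorem ncard_neighborSet_toSubgraph_le {u v w : V} (p : G.Walk u v) (hp : p.IsPath)
    (hw : w ∈ p.support) : (p.toSubgraph.neighborSet w).ncard ≤ 2 := by
  obtain ⟨i, rfl, hi⟩ := Walk.mem_support_iff_exists_getVert.1 hw
  by_cases h0 : i = 0
  · subst h0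
    rw [Walk.getVert_zero]
    exact (ncard_neighborSet_toSubgraph_src p hp).trans (by norm_num)
  by_cases hl : i = p.length
  · subst hl
    rw [Walk.getVert_length]
    exact (ncard_neighborSet_toSubgraph_tgt p hp).trans (by norm_num)
  exact (hp.ncard_neighborSet_toSubgraph_internal_eq_two h0 (by omega)).le

end LinkageGraph

section Mesh
universe u
variable {V : Type u} {G T : SimpleGraph V} {B X Y Z S : Set V} {h k w : ℕ}

/-- `T` is a subgraph of `G` of maximum degree three that connects the attachment set `X` of the
part `B` and avoids `B \ X`. -/
structure Premesh (G : SimpleGraph V) (B X : Set V) (T : SimpleGraph V) : Prop where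
  sub : X ⊆ B
  closed : ∀ x ∈ B \ X, ∀ y, G.Adj x y → y ∈ B
  le : T ≤ G
  avoid : ∀ x y, T.Adj x y → x ∉ B \ X
  deg : ∀ x, (T.neighborSet x).ncard ≤ 3
  deg' : ∀ x ∈ X, (T.neighborSet x).ncard ≤ 2
  conn : ∀ x ∈ X, ∀ y ∈ X, T.Reachable x y

/-- The edges of `G` inside `(B \ X) ∪ Y ∪ Z` that are not contained in `X`. -/
def meshGraph (G : SimpleGraph V) (B X Y Z : Set V) : SimpleGraph V where
  Adj a b := G.Adj a b ∧ a ∈ (B \ X) ∪ (Y ∪ Z) ∧ b ∈ (B \ X) ∪ (Y ∪ Z) ∧ (a ∉ X ∨ b ∉ X)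
  symm := ⟨fun _ _ ⟨h, ha, hb, hx⟩ => ⟨h.symm, hb, ha, hx.symm⟩⟩
  loopless := ⟨fun _ ⟨h, _⟩ => h.ne rfl⟩

/-- A premesh whose attachment set has size `h` and is `k`-linked. -/
structure IsMesh (G : SimpleGraph V) (B X : Set V) (T : SimpleGraph V) (h k : ℕ) : Prop
    extends Premesh G B X T where
  card : X.ncard = h
  linked : ∀ Y Z, Y ⊆ X → Z ⊆ X → Disjoint Y Z → Y.ncard = k → Z.ncard = k →
    Nonempty (Linkage (meshGraph G B X Y Z) Y Z (Fin k))

/-- A connecting subgraph can be pruned so that some vertex of `X` has degree at most one. -/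
theorem exists_prune [Finite V] (hX : X.Nonempty) (hT : ∀ x ∈ X, ∀ y ∈ X, T.Reachable x y) :
    ∃ T' ≤ T, (∀ x ∈ X, ∀ y ∈ X, T'.Reachable x y) ∧ ∃ x ∈ X, (T'.neighborSet x).ncard ≤ 1 := by
  classical
  obtain ⟨x₀, hx₀⟩ := hX
  obtain ⟨x, hx, hmax⟩ := X.exists_max_image (fun y => T.dist x₀ y) X.toFinite ⟨x₀, hx₀⟩
  have avoid : ∀ y, T.Reachable x₀ y → T.dist x₀ y ≤ T.dist x₀ x → y ≠ x →
      ReachIn T {x}ᶜ x₀ y := by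
    intro y hy hd hne
    obtain ⟨p, hp⟩ := hy.exists_walk_length_eq_dist
    refine ⟨p, fun z hz hzx => ?_⟩
    rw [Set.mem_singleton_iff] at hzx
    subst hzx
    have h1 := p.length_takeUntil_lt_length hz hne.symm
    have h2 := dist_le (p.takeUntil z hz)
    omega
  obtain ⟨p, hpx⟩ : ∃ p, x ≠ x₀ → T.Adj p x ∧ T.Reachable x₀ p ∧ T.dist x₀ p ≤ T.dist x₀ x := by
    by_cases hne : x = x₀
    · exact ⟨x, fun hh => absurd hne hh⟩
    obtain ⟨q, hq⟩ := (hT x₀ hx₀ x hx).exists_walk_length_eq_dist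
    have hn : ¬ q.Nil := Walk.not_nil_of_ne (Ne.symm hne)
    refine ⟨q.penultimate, fun _ => ⟨q.adj_penultimate hn, ⟨q.dropLast⟩, ?_⟩⟩
    have := dist_le q.dropLast
    have h3 : q.dropLast.length ≤ q.length := by simp
    omega
  let T' : SimpleGraph V :=
    { Adj := fun a b => T.Adj a b ∧ (a = x → b = p) ∧ (b = x → a = p)
      symm := ⟨fun a b ⟨h, h1, h2⟩ => ⟨h.symm, h2, h1⟩⟩
      loopless := ⟨fun a ⟨h, _⟩ => h.ne rfl⟩ }
  have up : ∀ y, ReachIn T {x}ᶜ x₀ y → T'.Reachable x₀ y := by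
    intro y hy
    have h0 := hy.left_mem
    have : y ∈ ({x} : Set V)ᶜ ∧ T'.Reachable x₀ y := by
      refine hy.closed (P := fun z => z ∈ ({x} : Set V)ᶜ ∧ T'.Reachable x₀ z) ⟨h0, .refl _⟩ ?_
      rintro a b ⟨ha, hr⟩ hab hb
      exact ⟨hb, hr.trans (Adj.reachable ⟨hab, fun hh => absurd hh ha, fun hh => absurd hh hb⟩)⟩
    exact this.2
  have hreach : ∀ y ∈ X, T'.Reachable x₀ y := by
    intro y hy
    by_cases hyx : y = x
    · subst hyx
      by_cases hne : y = x₀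
      · subst hne
        rfl
      · obtain ⟨h1, h2, h3⟩ := hpx hne
        exact (up p (avoid p h2 h3 h1.ne)).trans (Adj.reachable ⟨h1, fun hh => absurd hh h1.ne,
          fun _ => rfl⟩)
    · exact up y (avoid y (hT x₀ hx₀ y hy) (hmax y hy) hyx)
  refine ⟨T', fun a b hab => hab.1, fun a ha b hb => (hreach a ha).symm.trans (hreach b hb),
    x, hx, ?_⟩
  calc (T'.neighborSet x).ncard ≤ ({p} : Set V).ncard :=
        Set.ncard_le_ncard (fun b hb => hb.2.1 rfl) (Set.toFinite _)
    _ = 1 := by simp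

theorem Premesh.anti [Finite V] (hP : Premesh G B X T) {T' : SimpleGraph V} (hT : T' ≤ T)
    (hc : ∀ x ∈ X, ∀ y ∈ X, T'.Reachable x y) : Premesh G B X T' where
  sub := hP.sub
  closed := hP.closed
  le := hT.trans hP.le
  avoid x y hxy := hP.avoid x y (hT hxy)
  deg x := (Set.ncard_le_ncard (fun _ hy => hT hy) (Set.toFinite _)).trans (hP.deg x)
  deg' x hx := (Set.ncard_le_ncard (fun _ hy => hT hy) (Set.toFinite _)).trans (hP.deg' x hx)
  conn := hc

theorem ncard_neighborSet_sup_le [Finite V] (T F : SimpleGraph V) (x : V) :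
    ((T ⊔ F).neighborSet x).ncard ≤ (T.neighborSet x).ncard + (F.neighborSet x).ncard := by
  have : (T ⊔ F).neighborSet x = T.neighborSet x ∪ F.neighborSet x := by
    ext; simp
  rw [this]
  exact Set.ncard_union_le _ _

theorem Premesh.neighborSet_eq_empty (hP : Premesh G B X T) {x : V} (hx : x ∈ B \ X) :
    T.neighborSet x = ∅ := by
  ext y
  simp only [mem_neighborSet, Set.mem_empty_iff_false, iff_false]
  exact fun hh => hP.avoid x y hh hx

theorem Premesh.attach [Finite V] (hP : Premesh G B X T) {x b : V} (hx : x ∈ X) (hb : b ∈ B \ X)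
    (hxb : G.Adj x b) (hdeg : (T.neighborSet x).ncard ≤ 1) :
    Premesh G B (insert b X) (T ⊔ edge x b) := by
  have hTb : T.neighborSet b = ∅ := hP.neighborSet_eq_empty hb
  have hne : x ≠ b := hxb.ne
  have hout : ∀ y, y ≠ x → y ≠ b → (T ⊔ edge x b).neighborSet y = T.neighborSet y := by
    intro y hyx hyb
    ext z
    simp [edge_adj, hyx, hyb, eq_comm]
  have hx2 : ((T ⊔ edge x b).neighborSet x).ncard ≤ 2 := by
    refine (ncard_neighborSet_sup_le _ _ _).trans ?_
    have : (edge x b).neighborSet x ⊆ {b} := by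
      intro z hz
      simp [edge_adj, hne] at hz
      simp [hz.1]
    have := Set.ncard_le_ncard this
    rw [Set.ncard_singleton] at this
    omega
  have hb2 : ((T ⊔ edge x b).neighborSet b).ncard ≤ 2 := by
    refine (ncard_neighborSet_sup_le _ _ _).trans ?_
    have : (edge x b).neighborSet b ⊆ {x} := by
      intro z hz
      simp [edge_adj, hne.symm] at hz
      simp [hz.1]
    have := Set.ncard_le_ncard this
    rw [Set.ncard_singleton] at this
    simp [hTb]
    omega
  have hr : ∀ y ∈ insert b X, (T ⊔ edge x b).Reachable x y := by
    rintro y (rfl | hy)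
    · exact Adj.reachable (by simp [edge_adj, hne])
    · exact (hP.conn x hx y hy).mono le_sup_left
  refine ⟨Set.insert_subset hb.1 hP.sub, fun y hy z hyz => hP.closed y ⟨hy.1, fun hh =>
    hy.2 (.inr hh)⟩ z hyz, sup_le hP.le ?_, ?_, ?_, ?_, fun y hy z hz => (hr y hy).symm.trans
    (hr z hz)⟩
  · intro y z hyz
    simp only [edge_adj] at hyz
    rcases hyz.1 with ⟨rfl, rfl⟩ | ⟨rfl, rfl⟩
    exacts [hxb, hxb.symm]
  · intro y z hyz hy
    rcases hyz with hyz | hyz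
    · exact hP.avoid y z hyz ⟨hy.1, fun hh => hy.2 (.inr hh)⟩
    · simp only [edge_adj] at hyz
      rcases hyz.1 with ⟨rfl, rfl⟩ | ⟨rfl, rfl⟩
      · exact hy.2 (.inr hx)
      · exact hy.2 (.inl rfl)
  · intro y
    by_cases hyx : y = x
    · subst hyx; omega
    by_cases hyb : y = b
    · subst hyb; omega
    rw [hout y hyx hyb]
    exact hP.deg y
  · rintro y hy
    by_cases hyx : y = x
    · subst hyx; omega
    by_cases hyb : y = b
    · subst hyb; omega
    rw [hout y hyx hyb]
    exact hP.deg' y (hy.resolve_left hyb)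

theorem Premesh.detach (hP : Premesh G B X T) {x : V} (hx : x ∈ X)
    (hnb : ∀ b ∈ B \ X, ¬ G.Adj x b) : Premesh G (B \ {x}) (X \ {x}) T := by
  have hdiff : (B \ {x}) \ (X \ {x}) ⊆ B \ X := by
    rintro y ⟨hy, hy'⟩
    exact ⟨hy.1, fun hh => hy' ⟨hh, hy.2⟩⟩
  refine ⟨Set.sdiff_subset_sdiff_left hP.sub, fun y hy z hyz => ⟨hP.closed y (hdiff hy) z hyz, ?_⟩,
    hP.le, fun y z hyz hy => hP.avoid y z hyz (hdiff hy), hP.deg, fun y hy => hP.deg' y hy.1,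
    fun y hy z hz => hP.conn y hy.1 z hz.1⟩
  rintro rfl
  exact hnb y (hdiff hy) hyz.symm

end Mesh

section MeshStep
universe u
variable {V : Type u} {G G' T : SimpleGraph V} {B C X Y Z S : Set V} {h k w : ℕ}

theorem Premesh.side [Finite V] (hP : Premesh G B X T) (hSB : S ⊆ B) (hC : C ⊆ B \ X)
    (hnb : ∀ v ∈ C, ∀ w, G.Adj v w → w ∈ C ∪ ((X \ Z) ∪ S)) (hZX : Z ⊆ X)
    (L : Linkage G (S \ X) Z ↥(S \ X)) (hsrc : ∀ s, L.src s = s)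
    (hLX : ∀ s, ∀ v ∈ (L.walk s).support, v ∈ X → v = L.tgt s)
    (hLC : ∀ s, ∀ v ∈ (L.walk s).support, v ∉ C)
    (hLS : ∀ s, ∀ v ∈ (L.walk s).support, v ∈ S → v = s)
    (hLB : ∀ s, ∀ v ∈ (L.walk s).support, v ∈ B) :
    Premesh G (C ∪ ((X \ Z) ∪ S)) ((X \ Z) ∪ S) (T ⊔ L.graph) := by
  have hdiff : ∀ v ∈ (C ∪ ((X \ Z) ∪ S)) \ ((X \ Z) ∪ S), v ∈ C := fun v hv =>
    hv.1.resolve_right hv.2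
  have deg1 : ∀ v, (∀ s, v ∉ (L.walk s).support) →
      ((T ⊔ L.graph).neighborSet v).ncard ≤ (T.neighborSet v).ncard := by
    intro v hv
    have := ncard_neighborSet_sup_le T L.graph v
    rwa [L.neighborSet_graph_of_notMem hv, Set.ncard_empty] at this
  have deg2 : ∀ s, ∀ v ∈ (L.walk s).support, v ∉ X → ((T ⊔ L.graph).neighborSet v).ncard ≤ 2 := by
    intro s v hv hvX
    have := ncard_neighborSet_sup_le T L.graph v
    rw [hP.neighborSet_eq_empty ⟨hLB s v hv, hvX⟩, Set.ncard_empty, zero_add] at this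
    refine this.trans ?_
    rw [L.neighborSet_graph hv]
    exact ncard_neighborSet_toSubgraph_le _ (L.isPath s) hv
  have deg3 : ∀ s, ((T ⊔ L.graph).neighborSet (L.tgt s)).ncard ≤ 3 := by
    intro s
    have := ncard_neighborSet_sup_le T L.graph (L.tgt s)
    rw [L.neighborSet_graph (i := s) (Walk.end_mem_support _)] at this
    have h1 := ncard_neighborSet_toSubgraph_tgt _ (L.isPath s)
    have h2 := hP.deg' _ (hZX (L.tgt_mem s))
    omega
  have hconn : ∀ v ∈ (X \ Z) ∪ S, ∃ x ∈ X, (T ⊔ L.graph).Reachable v x := by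
    intro v hv
    by_cases hvX : v ∈ X
    · exact ⟨v, hvX, .refl _⟩
    · have hvS : v ∈ S := hv.resolve_left fun hh => hvX hh.1
      obtain ⟨p, -⟩ := L.reachIn_graph ⟨v, hvS, hvX⟩
      have h1 : L.graph.Reachable (L.src ⟨v, hvS, hvX⟩) (L.tgt ⟨v, hvS, hvX⟩) := ⟨p⟩
      rw [hsrc] at h1
      exact ⟨_, hZX (L.tgt_mem _), h1.mono le_sup_right⟩
  refine ⟨Set.subset_union_right, ?_, sup_le hP.le L.graph_le, ?_, ?_, ?_, ?_⟩
  · exact fun x hx y hxy => hnb x (hdiff x hx) y hxy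
  · rintro x y (hxy | hxy) hx
    · exact hP.avoid x y hxy (hC (hdiff x hx))
    · obtain ⟨i, hi, -⟩ := L.exists_of_graph_adj hxy
      exact hLC i x hi (hdiff x hx)
  · intro v
    by_cases hv : ∃ s, v ∈ (L.walk s).support
    · obtain ⟨s, hs⟩ := hv
      by_cases hvX : v ∈ X
      · rw [hLX s v hs hvX]
        exact deg3 s
      · exact (deg2 s v hs hvX).trans (by norm_num)
    · push Not at hv
      exact (deg1 v hv).trans (hP.deg v)
  · intro v hvX₁
    by_cases hv : ∃ s, v ∈ (L.walk s).support
    · obtain ⟨s, hs⟩ := hv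
      refine deg2 s v hs fun hvX => ?_
      have hvt := hLX s v hs hvX
      rcases hvX₁ with hh | hh
      · exact hh.2 (hvt ▸ L.tgt_mem s)
      · exact s.2.2 (hLS s v hs hh ▸ hvX)
    · push Not at hv
      refine (deg1 v hv).trans ?_
      by_cases hvX : v ∈ X
      · exact hP.deg' v hvX
      · have hvS : v ∈ S := hvX₁.resolve_left fun hh => hvX hh.1
        rw [hP.neighborSet_eq_empty ⟨hSB hvS, hvX⟩]
        simp
  · intro x hx y hy
    obtain ⟨x', hx', hxx'⟩ := hconn x hx
    obtain ⟨y', hy', hyy'⟩ := hconn y hy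
    exact hxx'.trans (((hP.conn x' hx' y' hy').mono le_sup_left).trans hyy'.symm)

theorem exists_tails (hG : G' ≤ G) (hZX : Z ⊆ X) (hSB : S ⊆ B)
    (hV : ∀ a b, G'.Adj a b → b ∈ B ∧ (b ∈ X → b ∈ Y ∨ b ∈ Z)) (hXB : X ⊆ B)
    (hsep : Separates G' Y Z S) (L : Linkage G' Y Z S) (hL : ∀ s : S, (s : V) ∈ (L.walk s).support) :
    ∃ L' : Linkage G (S \ X) Z ↥(S \ X), (∀ s, L'.src s = s) ∧
      (∀ s, ∀ v ∈ (L'.walk s).support, v ∈ X → v = L'.tgt s) ∧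
      (∀ s, ∀ v ∈ (L'.walk s).support, v = s ∨ ∃ z ∈ Z, ReachIn G' Sᶜ z v) ∧
      (∀ s, ∀ v ∈ (L'.walk s).support, v ∈ S → v = s) ∧
      (∀ s, ∀ v ∈ (L'.walk s).support, v ∈ B) := by
  classical
  have hLS : ∀ s : S, ∀ v ∈ (L.walk s).support, v ∈ S → v = s := by
    intro s v hv hvS
    have := L.disj s ⟨v, hvS⟩ v hv (hL ⟨v, hvS⟩)
    rw [this]
  have hR : ∀ v, (∃ z ∈ Z, ReachIn G' Sᶜ z v) → v ∈ B ∧ (v ∈ X → v ∈ Z) := by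
    rintro v ⟨z, hz, hzv⟩
    have h1 : v ∈ B ∧ (v ∈ X → v ∈ Y ∨ v ∈ Z) :=
      hzv.closed (P := fun v => v ∈ B ∧ (v ∈ X → v ∈ Y ∨ v ∈ Z)) ⟨hXB (hZX hz), fun _ => .inr hz⟩
        fun a b _ hab _ => hV a b hab
    exact ⟨h1.1, fun hvX => (h1.2 hvX).resolve_left fun hvY => hsep v hvY z hz hzv.symm⟩
  have main : ∀ s : ↥(S \ X), ∃ z, z ∈ Z ∧ ∃ p : G.Walk s z, ∀ v ∈ p.support,
      v ∈ (L.walk ⟨s, s.2.1⟩).support ∧ (v = s ∨ ∃ z ∈ Z, ReachIn G' Sᶜ z v) ∧ (v ∈ Z → v = z) := by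
    intro s
    set P := L.walk ⟨s, s.2.1⟩ with hPdef
    have hs := hL ⟨s, s.2.1⟩
    have hsZ : (s : V) ∉ Z := fun hh => s.2.2 (hZX hh)
    have h1 : ReachIn G' {v | v ∈ P.support ∧ (v = s ∨ ∃ z ∈ Z, ReachIn G' Sᶜ z v)} s
        (L.tgt ⟨s, s.2.1⟩) := by
      refine ⟨P.dropUntil s hs, fun v hv => ⟨P.support_dropUntil_subset_support hs hv, ?_⟩⟩
      by_cases hvs : v = s
      · exact .inl hvs
      refine .inr ⟨_, L.tgt_mem ⟨s, s.2.1⟩, ?_⟩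
      refine ReachIn.walk_prefix (P.dropUntil s hs).reverse ((L.isPath _).dropUntil hs).reverse
        (by simpa using hv) hvs ?_
      intro z hz hzS
      exact hLS ⟨s, s.2.1⟩ z (P.support_dropUntil_subset_support hs (by simpa using hz)) hzS
    obtain ⟨x, z, hx, hxz, hz, hzQ⟩ := h1.exists_first (P := fun z => z ∈ Z) hsZ (L.tgt_mem _)
    obtain ⟨p, hp⟩ := hx
    refine ⟨z, hz, (p.mapLe hG).concat (hG hxz), fun v hv => ?_⟩
    rw [Walk.support_concat, List.mem_append, List.mem_singleton] at hv
    rcases hv with hv | rfl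
    · have := hp v (by simpa using hv)
      exact ⟨this.1.1, this.1.2, fun hh => absurd hh this.2⟩
    · exact ⟨hzQ.1, hzQ.2, fun _ => rfl⟩
  choose t ht p hp using main
  obtain ⟨L', hL'⟩ := linkage_of_walks (A := S \ X) (B := Z) (fun s : ↥(S \ X) => (s : V)) t
    (fun s => s.2) ht p (by
      intro i j x hi hj
      have := L.disj _ _ x (hp i x hi).1 (hp j x hj).1
      rw [Subtype.mk.injEq] at this
      exact Subtype.ext this)
  refine ⟨L', fun s => (hL' s).2.1, ?_, fun s v hv => (hp s v ((hL' s).1 v hv)).2.1,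
    fun s v hv hvS => ?_, ?_⟩
  · intro s v hv hvX
    have h1 := hp s v ((hL' s).1 v hv)
    have h2 : v ∈ Z := by
      rcases h1.2.1 with rfl | h2
      · exact absurd hvX s.2.2
      · exact (hR v h2).2 hvX
    rw [(hL' s).2.2, h1.2.2 h2]
  · exact hLS ⟨s, s.2.1⟩ v (hp s v ((hL' s).1 v hv)).1 hvS
  · intro s v hv
    rcases (hp s v ((hL' s).1 v hv)).2.1 with rfl | h2
    · exact hSB s.2.1
    · exact (hR v h2).1

/-- The inductive step at a premesh whose attachment set is not linked. -/
theorem Premesh.split [Finite V] (hP : Premesh G B X T) (hXh : X.ncard = h) (hYX : Y ⊆ X)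
    (hZX : Z ⊆ X) (hY : Y.ncard = k) (hZ : Z.ncard = k)
    (hno : ¬ Nonempty (Linkage (meshGraph G B X Y Z) Y Z (Fin k)))
    (ih : ∀ B' X' T', Premesh G B' X' T' → X'.ncard ≤ h →
      B'.ncard + (B' \ X').ncard < B.ncard + (B \ X).ncard → HasDecomp G B' X' (h + k)) :
    HasDecomp G B X (h + k) := by
  classical
  set G' := meshGraph G B X Y Z with hG'
  have hG'G : G' ≤ G := fun a b hab => hab.1
  obtain ⟨S, L, hsep, hL⟩ := menger_strong G' Y Z
  have hSk : S.ncard < k := by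
    by_contra! hk
    apply hno
    obtain ⟨S', hS', hc⟩ := Set.exists_subset_card_eq hk
    have e : Fin k ≃ S' := (finCongr hc.symm).trans (Finite.equivFin S').symm
    exact ⟨L.comp (fun i => ⟨(e i : V), hS' (e i).2⟩) (fun i j hij => by
      rw [Subtype.mk.injEq] at hij
      exact e.injective (Subtype.ext hij))⟩
  have hV : ∀ a b, G'.Adj a b → b ∈ B ∧ (b ∈ X → b ∈ Y ∨ b ∈ Z) := by
    rintro a b ⟨-, -, hb | hb, -⟩
    · exact ⟨hb.1, fun hh => absurd hh hb.2⟩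
    · exact ⟨hP.sub (hb.elim (fun hh => hYX hh) fun hh => hZX hh), fun _ => hb⟩
  have hSB : S ⊆ B := by
    intro s hs
    have h1 : ReachIn G' Set.univ (L.src ⟨s, hs⟩) s :=
      ⟨(L.walk ⟨s, hs⟩).takeUntil s (hL ⟨s, hs⟩), by simp⟩
    exact h1.closed (P := fun v => v ∈ B) (hP.sub (hYX (L.src_mem _)))
      fun a b _ hab _ => (hV a b hab).1
  obtain ⟨L₁, hL₁src, hL₁X, hL₁R, hL₁S, hL₁B⟩ :=
    exists_tails hG'G hZX hSB hV hP.sub hsep L hL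
  obtain ⟨L₂, hL₂src, hL₂X, hL₂R, hL₂S, hL₂B⟩ :=
    exists_tails hG'G hYX hSB (fun a b hab => ⟨(hV a b hab).1, fun hh => ((hV a b hab).2 hh).symm⟩)
      hP.sub hsep.symm L.reverse (fun s => by simpa [Linkage.reverse] using hL s)
  set R : Set V := {v | ∃ y ∈ Y, ReachIn G' Sᶜ y v} with hR
  have hRZ : ∀ v ∈ R, ¬ ∃ z ∈ Z, ReachIn G' Sᶜ z v := by
    rintro v ⟨y, hy, hyv⟩ ⟨z, hz, hzv⟩
    exact hsep y hy z hz (hyv.trans hzv.symm)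
  have hRS : ∀ v ∈ R, v ∉ S := by
    rintro v ⟨y, hy, hyv⟩
    exact hyv.right_mem
  have hYR : ∀ y ∈ Y, y ∉ S → y ∈ R := fun y hy hyS => ⟨y, hy, .refl hyS⟩
  have hRstep : ∀ a b, a ∈ R → G'.Adj a b → b ∉ S → b ∈ R := by
    rintro a b ⟨y, hy, hya⟩ hab hb
    exact ⟨y, hy, hya.step hab hb⟩
  have adj' : ∀ a b, a ∈ B \ X → G.Adj a b → (b ∈ X → b ∈ Y ∨ b ∈ Z) → G'.Adj a b := by
    intro a b ha hab hb
    refine ⟨hab, .inl ha, ?_, .inl ha.2⟩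
    by_cases hbX : b ∈ X
    · exact .inr (hb hbX)
    · exact .inl ⟨hP.closed a ha b hab, hbX⟩
  set C₁ : Set V := {v | v ∈ B \ X ∧ v ∈ R}
  set C₂ : Set V := {v | v ∈ B \ X ∧ v ∉ S ∧ v ∉ R}
  have hP₁ := hP.side (C := C₁) hSB (fun v hv => hv.1) (by
      intro v hv w hvw
      have hwB := hP.closed v hv.1 w hvw
      by_cases hwS : w ∈ S
      · exact .inr (.inr hwS)
      by_cases hwX : w ∈ X
      · refine .inr (.inl ⟨hwX, fun hwZ => ?_⟩)
        exact hRZ w (hRstep v w hv.2 (adj' v w hv.1 hvw fun _ => .inr hwZ) hwS) ⟨w, hwZ, .refl hwS⟩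
      · exact .inl ⟨⟨hwB, hwX⟩, hRstep v w hv.2 (adj' v w hv.1 hvw fun hh => absurd hh hwX) hwS⟩)
    hZX L₁ hL₁src hL₁X (by
      intro s v hv hvC
      rcases hL₁R s v hv with rfl | hh
      · exact hRS _ hvC.2 s.2.1
      · exact hRZ v hvC.2 hh) hL₁S hL₁B
  have hP₂ := hP.side (C := C₂) hSB (fun v hv => hv.1) (by
      intro v hv w hvw
      have hwB := hP.closed v hv.1 w hvw
      by_cases hwS : w ∈ S
      · exact .inr (.inr hwS)
      by_cases hwX : w ∈ X
      · refine .inr (.inl ⟨hwX, fun hwY => ?_⟩)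
        exact hv.2.2 (hRstep w v (hYR w hwY hwS) (adj' v w hv.1 hvw fun _ => .inl hwY).symm hv.2.1)
      · exact .inl ⟨⟨hwB, hwX⟩, hwS, fun hwR => hv.2.2 (hRstep w v hwR
          (adj' v w hv.1 hvw fun hh => absurd hh hwX).symm hv.2.1)⟩)
    hYX L₂ hL₂src hL₂X (by
      intro s v hv hvC
      rcases hL₂R s v hv with rfl | hh
      · exact hvC.2.1 s.2.1
      · exact hvC.2.2 hh) hL₂S hL₂B
  have hcard : ∀ W, W ⊆ X → W.ncard = k → (X \ W ∪ S).ncard ≤ h := by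
    intro W hW hWk
    have h1 := Set.ncard_union_le (X \ W) S
    have h2 := Set.ncard_sdiff_add_ncard_of_subset hW
    omega
  have hmeas : ∀ W C, W ⊆ X → W.ncard = k → C ⊆ B \ X →
      (C ∪ (X \ W ∪ S)).ncard + ((C ∪ (X \ W ∪ S)) \ (X \ W ∪ S)).ncard <
        B.ncard + (B \ X).ncard := by
    intro W C hW hWk hC
    refine add_lt_add_of_lt_of_le (Set.ncard_lt_ncard ⟨?_, fun hh => ?_⟩ (Set.toFinite _))
      (Set.ncard_le_ncard (fun v hv => hC (hv.1.resolve_right hv.2)) (Set.toFinite _))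
    · rintro v (hv | hv | hv)
      exacts [(hC hv).1, hP.sub hv.1, hSB hv]
    · have : ∃ w ∈ W, w ∉ S := by
        by_contra! hcon
        have := Set.ncard_le_ncard (s := W) (t := S) hcon (Set.toFinite _)
        omega
      obtain ⟨w, hw, hwS⟩ := this
      rcases hh (hP.sub (hW hw)) with hv | hv | hv
      exacts [(hC hv).2 (hW hw), hv.2 hw, hwS hv]
  have D₁ := ih _ _ _ hP₁ (hcard Z hZX hZ) (hmeas Z C₁ hZX hZ fun v hv => hv.1)
  have D₂ := ih _ _ _ hP₂ (hcard Y hYX hY) (hmeas Y C₂ hYX hY fun v hv => hv.1)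
  have D₀ : HasDecomp G (X ∪ S) (X ∪ S) (h + k) := hasDecomp_single (by
    have := Set.ncard_union_le X S
    omega)
  have hCX₁ : ∀ v ∈ C₁, v ∉ X ∧ v ∉ S := fun v hv => ⟨hv.1.2, hRS v hv.2⟩
  have hCX₂ : ∀ v ∈ C₂, v ∉ X ∧ v ∉ S := fun v hv => ⟨hv.1.2, hv.2.1⟩
  have hCC : ∀ v ∈ C₁, v ∉ C₂ := fun v hv hv' => hv'.2.2 hv.2
  have hBeq : (X ∪ S) ∪ (C₁ ∪ (X \ Z ∪ S)) ∪ (C₂ ∪ (X \ Y ∪ S)) = B := by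
    ext v
    constructor
    · rintro (((hv | hv) | hv | hv | hv) | hv | hv | hv)
      exacts [hP.sub hv, hSB hv, hv.1.1, hP.sub hv.1, hSB hv, hv.1.1, hP.sub hv.1, hSB hv]
    · intro hv
      by_cases hvX : v ∈ X
      · exact .inl (.inl (.inl hvX))
      by_cases hvS : v ∈ S
      · exact .inl (.inl (.inr hvS))
      by_cases hvR : v ∈ R
      · exact .inl (.inr (.inl ⟨⟨hv, hvX⟩, hvR⟩))
      · exact .inr (.inl ⟨⟨hv, hvX⟩, hvS, hvR⟩)
  have n₁ : ∀ v ∈ C₁, ∀ w, G.Adj v w → w ∈ C₁ ∪ (X \ Z ∪ S) := fun v hv w hvw =>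
    hP₁.closed v ⟨.inl hv, fun hh => hh.elim (fun h1 => (hCX₁ v hv).1 h1.1) (hCX₁ v hv).2⟩ w hvw
  have n₂ : ∀ v ∈ C₂, ∀ w, G.Adj v w → w ∈ C₂ ∪ (X \ Y ∪ S) := fun v hv w hvw =>
    hP₂.closed v ⟨.inl hv, fun hh => hh.elim (fun h1 => (hCX₂ v hv).1 h1.1) (hCX₂ v hv).2⟩ w hvw
  have D₃ := D₀.glue D₁ (by
      rintro v ⟨hv, hv' | hv'⟩
      · exact (hv.elim (hCX₁ v hv').1 (hCX₁ v hv').2).elim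
      · exact ⟨hv, hv'⟩) (by
      have key : ∀ x ∈ (X ∪ S) ∪ (C₁ ∪ (X \ Z ∪ S)), x ∈ X ∪ S ∨ x ∈ C₁ := by
        rintro x (hx | hx | hx | hx)
        exacts [.inl hx, .inr hx, .inl (.inl hx.1), .inl (.inr hx)]
      intro x hx y hy hxy
      rcases key x hx with hx' | hx'
      · rcases key y hy with hy' | hy'
        · exact .inl ⟨hx', hy'⟩
        · exact .inr ⟨n₁ y hy' x hxy.symm, .inl hy'⟩
      · exact .inr ⟨.inl hx', n₁ x hx' y hxy⟩)
  have D₄ := D₃.glue D₂ (by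
      rintro v ⟨hv, hv' | hv'⟩
      · rcases hv with hv | hv | hv | hv
        · exact (hv.elim (hCX₂ v hv').1 (hCX₂ v hv').2).elim
        · exact (hCC v hv hv').elim
        · exact ((hCX₂ v hv').1 hv.1).elim
        · exact ((hCX₂ v hv').2 hv).elim
      · exact ⟨hv'.elim (fun hh => .inl hh.1) .inr, hv'⟩) (by
      have key : ∀ x ∈ (X ∪ S) ∪ (C₁ ∪ (X \ Z ∪ S)) ∪ (C₂ ∪ (X \ Y ∪ S)),
          x ∈ (X ∪ S) ∪ (C₁ ∪ (X \ Z ∪ S)) ∨ x ∈ C₂ := by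
        rintro x (hx | hx | hx | hx)
        exacts [.inl hx, .inr hx, .inl (.inl (.inl hx.1)), .inl (.inl (.inr hx))]
      intro x hx y hy hxy
      rcases key x hx with hx' | hx'
      · rcases key y hy with hy' | hy'
        · exact .inl ⟨hx', hy'⟩
        · exact .inr ⟨n₂ y hy' x hxy.symm, .inl hy'⟩
      · exact .inr ⟨.inl hx', n₂ x hx' y hxy⟩)
  rw [hBeq] at D₄
  exact D₄.mono Set.subset_union_left

/-- Either there is a mesh, or the part of a premesh has a tree-decomposition of small width. -/
theorem Premesh.mesh_or_decomp [Finite V] (hh : 0 < h)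
    (hno : ∀ B X T, ¬ IsMesh G B X T h k) (hP : Premesh G B X T) (hX : X.ncard ≤ h) :
    HasDecomp G B X (h + k) := by
  induction hn : B.ncard + (B \ X).ncard using Nat.strong_induction_on generalizing B X T with
  | _ n ih =>
  subst hn
  by_cases hBX : B = X
  · subst hBX
    exact hasDecomp_single (by omega)
  obtain ⟨b₀, hb₀⟩ : (B \ X).Nonempty := by
    by_contra hcon
    rw [Set.not_nonempty_iff_eq_empty, Set.sdiff_eq_empty] at hcon
    exact hBX (hcon.antisymm hP.sub)
  have hins : ∀ b ∈ B \ X, B.ncard + (B \ insert b X).ncard < B.ncard + (B \ X).ncard := by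
    intro b hb
    have hss : B \ insert b X ⊂ B \ X :=
      ⟨fun v hv => ⟨hv.1, fun hh => hv.2 (.inr hh)⟩, fun hh => (hh hb).2 (.inl rfl)⟩
    exact Nat.add_lt_add_left (Set.ncard_lt_ncard hss (Set.toFinite _)) _
  rcases X.eq_empty_or_nonempty with rfl | hXne
  · have hP₁ : Premesh G B {b₀} ⊥ := by
      refine ⟨by simpa using hb₀.1, fun x hx => hP.closed x (by simpa using hx.1), bot_le,
        fun x y hxy => hxy.elim, ?_, ?_, ?_⟩
      · intro x; simp [neighborSet]
      · intro x; simp [neighborSet]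
      · rintro x rfl y rfl; rfl
    have hlt := hins b₀ hb₀
    rw [insert_empty_eq] at hlt
    refine (ih _ hlt hP₁ ?_ rfl).mono (Set.empty_subset _)
    rw [Set.ncard_singleton]
    exact hh
  rcases hX.lt_or_eq with hlt | heq
  · obtain ⟨T', hT', hc, x, hx, hdeg⟩ := exists_prune hXne hP.conn
    have hP' := hP.anti hT' hc
    by_cases hnb : ∃ b ∈ B \ X, G.Adj x b
    · obtain ⟨b, hb, hxb⟩ := hnb
      refine (ih _ (hins b hb) (hP'.attach hx hb hxb hdeg) ?_ rfl).mono (Set.subset_insert _ _)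
      rw [Set.ncard_insert_of_notMem hb.2 (Set.toFinite _)]
      exact hlt
    · push Not at hnb
      have hlt1 : (B \ {x}).ncard < B.ncard :=
        Set.ncard_sdiff_singleton_lt_of_mem (hP.sub hx) (Set.toFinite _)
      have hle2 : ((B \ {x}) \ (X \ {x})).ncard ≤ (B \ X).ncard :=
        Set.ncard_le_ncard (fun v hv => ⟨hv.1.1, fun hh => hv.2 ⟨hh, hv.1.2⟩⟩) (Set.toFinite _)
      have D := ih _ (add_lt_add_of_lt_of_le hlt1 hle2) (hP.detach hx hnb)
        ((Set.ncard_le_ncard Set.sdiff_subset (Set.toFinite _)).trans hX) rfl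
      have D₀ : HasDecomp G X X (h + k) := hasDecomp_single (by omega)
      have D₁ := D₀.glue D (by
          rintro v ⟨hv, hv'⟩
          exact ⟨hv, hv, hv'.2⟩) (by
          have key : ∀ v ∈ X ∪ B \ {x}, v = x ∨ v ∈ B \ {x} := by
            rintro v (hv | hv)
            · by_cases hvx : v = x
              exacts [.inl hvx, .inr ⟨hP.sub hv, hvx⟩]
            · exact .inr hv
          have key' : ∀ v ∈ X ∪ B \ {x}, G.Adj x v → v ∈ X := by
            rintro v (hv | hv) hxv
            · exact hv
            · by_contra hvX
              exact hnb v ⟨hv.1, hvX⟩ hxv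
          intro a ha b hb hab
          rcases key a ha with rfl | ha'
          · exact .inl ⟨hx, key' b hb hab⟩
          · rcases key b hb with rfl | hb'
            · exact .inl ⟨key' a ha hab.symm, hx⟩
            · exact .inr ⟨ha', hb'⟩)
      have hBeq : X ∪ B \ {x} = B := by
        ext v
        constructor
        · rintro (hv | hv)
          exacts [hP.sub hv, hv.1]
        · intro hv
          by_cases hvx : v = x
          exacts [.inl (hvx ▸ hx), .inr ⟨hv, hvx⟩]
      rwa [hBeq] at D₁
  · have hnm := hno B X T
    have : ∃ Y Z, Y ⊆ X ∧ Z ⊆ X ∧ Disjoint Y Z ∧ Y.ncard = k ∧ Z.ncard = k ∧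
        ¬ Nonempty (Linkage (meshGraph G B X Y Z) Y Z (Fin k)) := by
      by_contra! hcon
      exact hnm ⟨hP, heq, fun Y Z hY hZ hd h1 h2 => hcon Y Z hY hZ hd h1 h2⟩
    obtain ⟨Y, Z, hYX, hZX, -, hY, hZ, hno'⟩ := this
    exact hP.split heq hYX hZX hY hZ hno' fun B' X' T' hP' hX' hlt' => ih _ hlt' hP' hX' rfl

/-- A graph of large tree-width has a mesh. -/
theorem exists_mesh [Finite V] (hh : 0 < h) (htw : h + k ≤ treewidth G) :
    ∃ B X T, IsMesh G B X T h k := by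
  by_contra! hno
  have hP : Premesh G Set.univ ∅ ⊥ := ⟨Set.empty_subset _, fun _ _ _ _ => trivial, bot_le,
    fun x y hxy => hxy.elim, fun x => by simp [neighborSet], fun x hx => hx.elim, fun x hx => hx.elim⟩
  have := (hP.mesh_or_decomp hh hno (by simp)).treewidth_lt (by omega)
  omega

end MeshStep

section Splitting
variable {V : Type*} {G T : SimpleGraph V} {X W D S : Set V} {u v : V}

/-- A connected set of vertices of degree at most three can be cut into two connected sets, the
first of which contains between `k` and `3 * k` elements of `X`. -/
theorem ConnIn.exists_cut [Finite V] (hdeg : ∀ x, (T.neighborSet x).ncard ≤ 3) (hW : ConnIn T W)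
    {k : ℕ} (hk : 0 < k) (hX : k ≤ (W ∩ X).ncard) :
    ∃ U ⊆ W, ConnIn T U ∧ ConnIn T (W \ U) ∧ k ≤ (U ∩ X).ncard ∧ (U ∩ X).ncard ≤ 3 * k := by
  obtain ⟨U, ⟨hUW, hU, hUc, hkU⟩, hmin⟩ := Set.exists_min_image
    {U : Set V | U ⊆ W ∧ ConnIn T U ∧ ConnIn T (W \ U) ∧ k ≤ (U ∩ X).ncard} Set.ncard
    (Set.toFinite _) ⟨W, subset_rfl, hW, by simpa using connIn_empty, hX⟩
  refine ⟨U, hUW, hU, hUc, hkU, ?_⟩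
  have hne : (U ∩ X).Nonempty := by
    rw [← Set.ncard_pos]; omega
  obtain ⟨a, haU, -⟩ := hne
  obtain ⟨u, huU, hu⟩ : ∃ u ∈ U, ∀ v ∈ W \ U, ∃ x ∈ W \ U, T.Adj u x := by
    by_cases hWU : ∃ v, v ∈ W \ U
    · obtain ⟨v, hv⟩ := hWU
      obtain ⟨x, y, hx, hxy, hy, hyW⟩ := (hW a (hUW haU) v hv.1).exists_first
        (P := fun z => z ∉ U) (by simpa using haU) hv.2
      exact ⟨x, by simpa using hx.right_mem.2, fun _ _ => ⟨y, ⟨hyW, hy⟩, hxy⟩⟩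
    · push Not at hWU
      exact ⟨a, haU, fun v hv => absurd hv (hWU v)⟩
  let K : V → Set V := fun w => {v | ReachIn T (U \ {u}) w v}
  have hKU : ∀ w, K w ⊆ U \ {u} := fun w v hv => ReachIn.right_mem hv
  have hsmall : ∀ w, (K w ∩ X).ncard ≤ k - 1 := by
    intro w
    by_contra hlt
    have hKW : K w ⊆ W := fun v hv => hUW (hKU w hv).1
    have huK : u ∈ W \ K w := ⟨hUW huU, fun hh => (hKU w hh).2 rfl⟩
    have hconn : ConnIn T (W \ K w) := by
      refine ConnIn.of_center (u := u) fun v hv => ?_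
      by_cases hvU : v ∈ U
      · by_cases hvu : v = u
        · subst hvu; exact .refl hv
        obtain ⟨x, y, hx, hxy, rfl, -⟩ := (hU v hvU u huU).exists_first (P := fun z => z = u) hvu rfl
        have hx' : ReachIn T (U \ {y}) v x := hx
        have := connIn_reach (G := T) v (.refl hx'.left_mem) x hx'
        refine ReachIn.symm (ReachIn.step (this.mono le_rfl fun z hz => ?_) hxy huK)
        exact ⟨hUW (ReachIn.right_mem hz).1, fun hzK => hv.2 (ReachIn.trans hzK (ReachIn.symm hz))⟩
      · obtain ⟨x, hx, hux⟩ := hu v ⟨hv.1, hvU⟩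
        have hsub : W \ U ⊆ W \ K w := fun z hz => ⟨hz.1, fun hh => hz.2 (hKU w hh).1⟩
        exact (ReachIn.of_adj hux huK (hsub hx)).trans
          ((hUc x hx v ⟨hv.1, hvU⟩).mono le_rfl hsub)
    have hle := hmin (K w) ⟨hKW, connIn_reach, hconn, by omega⟩
    have hss : K w ⊂ U := ⟨fun v hv => (hKU w hv).1, fun hh => (hKU w (hh huU)).2 rfl⟩
    have := Set.ncard_lt_ncard hss U.toFinite
    omega
  classical
  have := Fintype.ofFinite V
  have hcover : U ∩ X ⊆ {u} ∪ ⋃ w ∈ (T.neighborSet u).toFinset, (K w ∩ X) := by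
    rintro v ⟨hvU, hvX⟩
    by_cases hvu : v = u
    · exact .inl hvu
    right
    obtain ⟨x, y, hx, hxy, rfl, -⟩ := (hU v hvU u huU).exists_first (P := fun z => z = u) hvu rfl
    simp only [Set.mem_iUnion]
    exact ⟨x, by simpa using hxy.symm, ReachIn.symm hx, hvX⟩
  have h1 := Set.ncard_le_ncard hcover (Set.toFinite _)
  have h2 := Set.ncard_union_le {u} (⋃ w ∈ (T.neighborSet u).toFinset, (K w ∩ X))
  have h3 := Finset.set_ncard_biUnion_le (T.neighborSet u).toFinset (fun w => K w ∩ X)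
  have h4 := Finset.sum_le_card_nsmul (T.neighborSet u).toFinset (fun w => (K w ∩ X).ncard) (k - 1)
    fun w _ => hsmall w
  have h5 := hdeg u
  rw [Set.ncard_eq_toFinset_card'] at h5
  have h6 := Nat.mul_le_mul_right (k - 1) h5
  rw [Set.ncard_singleton] at h2
  simp only [smul_eq_mul] at h4
  omega

theorem ConnIn.exists_disjoint [Finite V] (hdeg : ∀ x, (T.neighborSet x).ncard ≤ 3)
    {k : ℕ} (hk : 0 < k) (m : ℕ) (hW : ConnIn T W) (hX : 3 * k * m ≤ (W ∩ X).ncard) :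
    ∃ C : Fin m → Set V, (∀ i, C i ⊆ W ∧ ConnIn T (C i) ∧ k ≤ (C i ∩ X).ncard) ∧
      Pairwise fun i j => Disjoint (C i) (C j) := by
  induction m generalizing W with
  | zero => exact ⟨Fin.elim0, fun i => i.elim0, fun i => i.elim0⟩
  | succ m ih =>
    obtain ⟨U, hUW, hU, hUc, hkU, hU3⟩ := hW.exists_cut (X := X) hdeg hk (by nlinarith)
    have hsplit : (W ∩ X).ncard ≤ (U ∩ X).ncard + ((W \ U) ∩ X).ncard := by
      refine (Set.ncard_le_ncard ?_ (Set.toFinite _)).trans (Set.ncard_union_le _ _)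
      rintro v ⟨hv, hvX⟩
      by_cases hvU : v ∈ U
      exacts [.inl ⟨hvU, hvX⟩, .inr ⟨⟨hv, hvU⟩, hvX⟩]
    obtain ⟨C, hC, hd⟩ := ih hUc (by rw [Nat.mul_succ] at hX; omega)
    refine ⟨Fin.cons U C, fun i => ?_, fun i j hij => ?_⟩
    · refine Fin.cases ⟨hUW, hU, hkU⟩ (fun i => ?_) i
      exact ⟨(hC i).1.trans Set.sdiff_subset, (hC i).2⟩
    · have key : ∀ i, Disjoint U (C i) := fun i =>
        Set.disjoint_left.2 fun v hv hv' => ((hC i).1 hv').2 hv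
      induction i using Fin.cases with
      | zero =>
        induction j using Fin.cases with
        | zero => exact absurd rfl hij
        | succ j => exact key j
      | succ i =>
        induction j using Fin.cases with
        | zero => exact (key i).symm
        | succ j => exact hd (fun h => hij (congrArg Fin.succ h))

/-- The edges of `G` with both ends in `D`. -/
def inGraph (G : SimpleGraph V) (D : Set V) : SimpleGraph V where
  Adj a b := G.Adj a b ∧ a ∈ D ∧ b ∈ D
  symm := ⟨fun _ _ ⟨h, ha, hb⟩ => ⟨h.symm, hb, ha⟩⟩
  loopless := ⟨fun _ ⟨h, _⟩ => h.ne rfl⟩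

theorem inGraph_le : inGraph G D ≤ G := fun _ _ h => h.1

theorem ReachIn.inGraph (h : ReachIn G S u v) (hS : S ⊆ D) : ReachIn (inGraph G D) S u v :=
  h.closed (P := fun z => ReachIn (_root_.inGraph G D) S u z) (.refl h.left_mem)
    fun _ _ hx hxy hy => hx.step ⟨hxy, hS hx.right_mem, hS hy⟩ hy

/-- The vertices of `D` with a neighbour in `C`. -/
def attach (G : SimpleGraph V) (D C : Set V) : Set V := {v ∈ D | ∃ c ∈ C, G.Adj v c}

end Splitting

theorem IsMesh.exists_linkage {V : Type*} [Finite V] {G T : SimpleGraph V} {B X C C' : Set V}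
    {h n : ℕ} (hM : IsMesh G B X T h n) (hC : n ≤ (C ∩ X).ncard) (hC' : n ≤ (C' ∩ X).ncard)
    (hd : Disjoint C C') :
    Nonempty (Linkage (inGraph G (B \ X)) (attach G (B \ X) C) (attach G (B \ X) C') (Fin n)) := by
  obtain ⟨Y, hY, hYn⟩ := Set.exists_subset_card_eq hC
  obtain ⟨Z, hZ, hZn⟩ := Set.exists_subset_card_eq hC'
  have hYZ : Disjoint Y Z := hd.mono (fun _ h => (hY h).1) (fun _ h => (hZ h).1)
  obtain ⟨L⟩ := hM.linked Y Z (fun _ h => (hY h).2) (fun _ h => (hZ h).2) hYZ hYn hZn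
  have key : ∀ i, ∃ s ∈ attach G (B \ X) C, ∃ t ∈ attach G (B \ X) C',
      ReachIn (inGraph G (B \ X)) {x | x ∈ (L.walk i).support} s t := by
    intro i
    have hr : ReachIn (meshGraph G B X Y Z) {x | x ∈ (L.walk i).support} (L.src i) (L.tgt i) :=
      ⟨L.walk i, fun _ h => h⟩
    obtain ⟨x, y, hx, hxy, hy, -⟩ := hr.exists_first (P := (· ∈ Z))
      (fun h => Set.disjoint_left.1 hYZ (L.src_mem i) h) (L.tgt_mem i)
    have hxX : x ∉ X := by
      rcases hxy.2.2.2 with h | h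
      · exact h
      · exact absurd (hZ hy).2 h
    obtain ⟨x', y', hx', hxy', hy', -⟩ := hx.symm.exists_first (P := (· ∈ Y))
      (fun h => hxX (hY h).2) (L.src_mem i)
    have hB : ∀ {a b}, (meshGraph G B X Y Z).Adj a b → a ∉ Y → a ∉ Z → a ∈ B \ X := by
      rintro a b ⟨-, h, -⟩ h1 h2
      rcases h with h | h | h
      exacts [h, absurd h h1, absurd h h2]
    have hxB : x ∈ B \ X := hB hxy (fun h => hxX (hY h).2) hx.right_mem.2
    have hr2 : ReachIn G ({x | x ∈ (L.walk i).support} ∩ (B \ X)) x x' := by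
      refine (hx'.closed (P := fun z => ReachIn G ({x | x ∈ (L.walk i).support} ∩ (B \ X)) x z)
        (.refl ⟨hx'.left_mem.1.1, hxB⟩) ?_)
      intro a b ha hab hb
      exact ha.step hab.1 ⟨hb.1.1, hB hab.symm hb.2 hb.1.2⟩
    refine ⟨x', ⟨hr2.right_mem.2, y', (hY hy').1, hxy'.1⟩, x, ⟨hxB, y, (hZ hy).1, hxy.1⟩, ?_⟩
    exact (hr2.symm.inGraph Set.inter_subset_right).mono le_rfl Set.inter_subset_left
  choose s hs t ht p hp using key
  obtain ⟨L', -⟩ := linkage_of_walks s t hs ht p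
    (fun i j x hi hj => L.disj i j x (hp i x hi) (hp j x hj))
  exact ⟨L'⟩

/-- Large tree-width yields many disjoint connected sets that are pairwise joined by many
disjoint paths avoiding all of them. -/
theorem exists_linked_sets {V : Type u} [Finite V] {G : SimpleGraph V} (m n : ℕ) (hm : 0 < m)
    (hn : 0 < n) (htw : 3 * n * m + n ≤ treewidth G) :
    ∃ (C : Fin m → Set V) (D : Set V), (∀ i, (C i).Nonempty ∧ ConnIn G (C i) ∧ Disjoint (C i) D) ∧
      (Pairwise fun i j => Disjoint (C i) (C j)) ∧
      ∀ i j, i ≠ j → Nonempty (Linkage (inGraph G D) (attach G D (C i)) (attach G D (C j))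
        (Fin n)) := by
  obtain ⟨B, X, T, hM⟩ := exists_mesh (G := G) (h := 3 * n * m) (k := n) (by positivity) htw
  have hXpos : 0 < X.ncard := by rw [hM.card]; positivity
  obtain ⟨x₀, hx₀⟩ := (Set.ncard_pos).1 hXpos
  let W : Set V := {v | ReachIn T Set.univ x₀ v}
  have hXW : X ⊆ W := fun x hx => by
    obtain ⟨p⟩ := hM.conn x₀ hx₀ x hx
    exact ⟨p, fun _ _ => trivial⟩
  obtain ⟨C, hC, hd⟩ := ConnIn.exists_disjoint (X := X) hM.deg hn m (W := W) connIn_reach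
    (by rw [Set.inter_eq_right.2 hXW, hM.card])
  refine ⟨C, B \ X, fun i => ⟨?_, (hC i).2.1.mono hM.le, ?_⟩, hd, fun i j hij =>
    hM.exists_linkage (hC i).2.2 (hC j).2.2 (hd hij)⟩
  · exact ((Set.ncard_pos).1 (hn.trans_le (hC i).2.2)).mono Set.inter_subset_left
  refine Set.disjoint_left.2 fun v hv => ?_
  have hvW : ReachIn T Set.univ x₀ v := (hC i).1 hv
  exact hvW.closed (P := (· ∉ B \ X)) (fun h => h.2 hx₀) fun a b _ hab _ => hM.avoid b a hab.symm

section Grid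
variable {V : Type*} {G H : SimpleGraph V}

/-- `B` is a model of the `(X + 1) × (Y + 1)` grid in `G`. -/
structure IsGrid (G : SimpleGraph V) (X Y : ℕ) (B : ℕ → ℕ → Set V) : Prop where
  conn : ∀ x ≤ X, ∀ y ≤ Y, ConnIn G (B x y)
  nonempty : ∀ x ≤ X, ∀ y ≤ Y, (B x y).Nonempty
  disj : ∀ x ≤ X, ∀ y ≤ Y, ∀ x' ≤ X, ∀ y' ≤ Y, ∀ v ∈ B x y, v ∈ B x' y' → x = x' ∧ y = y'
  horiz : ∀ x < X, ∀ y ≤ Y, ∃ u ∈ B x y, ∃ v ∈ B (x + 1) y, G.Adj u v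
  vert : ∀ x ≤ X, ∀ y < Y, ∃ u ∈ B x y, ∃ v ∈ B x (y + 1), G.Adj u v

theorem IsGrid.mono {X Y : ℕ} {B : ℕ → ℕ → Set V} (h : IsGrid G X Y B) (hGH : G ≤ H) :
    IsGrid H X Y B where
  conn x hx y hy := (h.conn x hx y hy).mono hGH
  nonempty := h.nonempty
  disj := h.disj
  horiz x hx y hy := by
    obtain ⟨u, hu, v, hv, huv⟩ := h.horiz x hx y hy
    exact ⟨u, hu, v, hv, hGH huv⟩
  vert x hx y hy := by
    obtain ⟨u, hu, v, hv, huv⟩ := h.vert x hx y hy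
    exact ⟨u, hu, v, hv, hGH huv⟩

theorem connIn_segment (f : ℕ → V) (s t : ℕ) (h : ∀ k, s ≤ k → k + 1 < t → G.Adj (f k) (f (k + 1))) :
    ConnIn G {v | ∃ k, s ≤ k ∧ k < t ∧ v = f k} := by
  refine ConnIn.of_center (u := f s) ?_
  rintro v ⟨k, hk, hkt, rfl⟩
  induction k, hk using Nat.le_induction with
  | base => exact .refl ⟨s, le_rfl, hkt, rfl⟩
  | succ k hk ih => exact (ih (by omega)).step (h k hk hkt) ⟨k + 1, by omega, hkt, rfl⟩

/-- Disjoint columns crossed, in the same order, by sets that join consecutive columns. -/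
structure IsLattice (G : SimpleGraph V) (X T : ℕ) (col : ℕ → ℕ → V) (len : ℕ → ℕ)
    (E : ℕ → Set V) (lo hi : ℕ → ℕ → ℕ) : Prop where
  adj : ∀ a ≤ X, ∀ k < len a, G.Adj (col a k) (col a (k + 1))
  inj : ∀ a ≤ X, ∀ k ≤ len a, ∀ b ≤ X, ∀ l ≤ len b, col a k = col b l → a = b ∧ k = l
  disj : ∀ t < T, ∀ t' < T, ∀ v ∈ E t, v ∈ E t' → t = t'
  lo_le : ∀ t < T, ∀ a ≤ X, lo t a ≤ hi t a
  hi_le : ∀ t < T, ∀ a ≤ X, hi t a ≤ len a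
  lt : ∀ t t', t < t' → t' < T → ∀ a ≤ X, hi t a < lo t' a
  mem : ∀ t < T, ∀ a ≤ X, ∀ k ≤ len a, col a k ∈ E t → lo t a ≤ k ∧ k ≤ hi t a
  rung : ∀ t < T, ∀ a < X, ∃ k ≤ len a, ∃ l ≤ len (a + 1), ReachIn G
    (E t ∩ {z | ∀ b ≤ X, ∀ k ≤ len b, z = col b k → b = a ∨ b = a + 1}) (col a k) (col (a + 1) l)

theorem IsLattice.exists_isGrid {X Y : ℕ} {col : ℕ → ℕ → V} {len : ℕ → ℕ} {E : ℕ → Set V}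
    {lo hi : ℕ → ℕ → ℕ} (h : IsLattice G X ((Y + 2) * (X + 1)) col len E lo hi) :
    ∃ B, IsGrid G X Y B := by
  let τ : ℕ → ℕ → ℕ := fun y a => y * (X + 1) + a
  have hτ : ∀ y ≤ Y + 1, ∀ a ≤ X, τ y a < (Y + 2) * (X + 1) := by
    intro y hy a ha
    have := Nat.mul_le_mul_right (X + 1) hy
    simp only [τ]
    nlinarith
  have hτinj : ∀ y y' a a', a ≤ X → a' ≤ X → τ y a = τ y' a' → y = y' ∧ a = a' := by
    intro y y' a a' ha ha' heq
    have h1 : y = y' := by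
      rcases lt_trichotomy y y' with hl | hl | hl
      · have := Nat.mul_le_mul_right (X + 1) (Nat.succ_le_of_lt hl)
        simp only [τ, Nat.succ_mul] at *
        omega
      · exact hl
      · have := Nat.mul_le_mul_right (X + 1) (Nat.succ_le_of_lt hl)
        simp only [τ, Nat.succ_mul] at *
        omega
    subst h1
    simp only [τ] at heq
    exact ⟨rfl, by omega⟩
  let c : ℕ → ℕ → ℕ := fun a y => lo (τ y 0) a
  have hc0 : ∀ a ≤ X, ∀ y ≤ Y, ∀ b ≤ X, c a y ≤ lo (τ y b) a ∧ hi (τ y b) a < c a (y + 1) := by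
    intro a ha y hy b hb
    have hlt : τ y b < τ (y + 1) 0 := by simp only [τ, Nat.succ_mul]; omega
    refine ⟨?_, h.lt _ _ hlt (hτ _ (by omega) _ (by omega)) a ha⟩
    rcases Nat.eq_zero_or_pos b with rfl | hb0
    · exact le_rfl
    · have h1 := h.lo_le (τ y 0) (hτ _ (by omega) _ (by omega)) a ha
      have h2 := h.lt (τ y 0) (τ y b) (by simp only [τ]; omega) (hτ _ (by omega) _ hb) a ha
      exact h1.trans h2.le
  have hclt : ∀ a ≤ X, ∀ y ≤ Y, c a y < c a (y + 1) := by
    intro a ha y hy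
    have := hc0 a ha y hy 0 (by omega)
    have h1 := h.lo_le (τ y 0) (hτ _ (by omega) _ (by omega)) a ha
    omega
  have hcle : ∀ a ≤ X, ∀ y ≤ Y + 1, c a y ≤ len a := by
    intro a ha y hy
    exact (h.lo_le _ (hτ _ hy _ (by omega)) a ha).trans (h.hi_le _ (hτ _ hy _ (by omega)) a ha)
  have hcmono : ∀ a ≤ X, ∀ y y', y < y' → y' ≤ Y + 1 → c a (y + 1) ≤ c a y' := by
    intro a ha y y' hyy
    induction y', hyy using Nat.le_induction with
    | base => intro; exact le_rfl
    | succ z hz ih => intro hz'; exact (ih (by omega)).trans (hclt a ha z (by omega)).le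
  let seg : ℕ → ℕ → Set V := fun a y => {v | ∃ k, c a y ≤ k ∧ k < c a (y + 1) ∧ v = col a k}
  let N : ℕ → ℕ → Set V := fun a y =>
    E (τ y a) ∩ {z | ∀ b ≤ X, ∀ k ≤ len b, z = col b k → b = a}
  have hEseg : ∀ a ≤ X, ∀ y ≤ Y, ∀ b ≤ X, ∀ k ≤ len a, col a k ∈ E (τ y b) → col a k ∈ seg a y := by
    intro a ha y hy b hb k hk hE
    have h1 := h.mem _ (hτ _ (by omega) _ hb) a ha k hk hE
    have h2 := hc0 a ha y hy b hb
    exact ⟨k, by omega, by omega, rfl⟩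
  have hrung : ∀ a y, ∃ R : Set V, a < X → y ≤ Y → ConnIn G R ∧ R ⊆ N a y ∧
      (∃ v ∈ R, v ∈ seg a y) ∧ ∃ u ∈ R, ∃ v ∈ seg (a + 1) y, G.Adj u v := by
    intro a y
    by_cases hay : a < X ∧ y ≤ Y
    swap
    · exact ⟨∅, fun h1 h2 => absurd ⟨h1, h2⟩ hay⟩
    obtain ⟨ha, hy⟩ := hay
    obtain ⟨k, hk, l, hl, hr⟩ := h.rung (τ y a) (hτ _ (by omega) _ ha.le) a ha
    obtain ⟨x', y', hx', hxy, ⟨l', hl', rfl⟩, hy'⟩ := hr.exists_first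
      (P := fun z => ∃ l ≤ len (a + 1), z = col (a + 1) l)
      (by rintro ⟨l, hl, heq⟩; have := h.inj a ha.le k hk (a + 1) ha l hl heq; omega) ⟨l, hl, rfl⟩
    refine ⟨{z | ReachIn G (N a y) (col a k) z}, fun _ _ => ⟨connIn_reach,
      fun z hz => ReachIn.right_mem hz, ?_, ?_⟩⟩
    all_goals
      have hx2 : ReachIn G (N a y) (col a k) x' := hx'.mono le_rfl (by
        rintro z ⟨⟨hzE, hz⟩, hzn⟩
        refine ⟨hzE, fun b hb k hk hzb => ?_⟩
        rcases hz b hb k hk hzb with rfl | rfl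
        · rfl
        · exact absurd ⟨k, hk, hzb⟩ hzn)
    · exact ⟨col a k, .refl hx2.left_mem, hEseg a ha.le y hy a ha.le k hk hx2.left_mem.1⟩
    · exact ⟨x', hx2, _, hEseg (a + 1) ha y hy a ha.le l' hl' hy'.1, hxy⟩
  choose R hR using hrung
  let R' : ℕ → ℕ → Set V := fun a y => {v ∈ R a y | a < X}
  have hR'N : ∀ a ≤ X, ∀ y ≤ Y, R' a y ⊆ N a y := by
    rintro a ha y hy v ⟨hv, haX⟩
    exact (hR a y haX hy).2.1 hv
  have hR'eq : ∀ a < X, ∀ y, R' a y = R a y := fun a ha y => by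
    ext v; simp [R', ha]
  have hseg : ∀ a ≤ X, ∀ y ≤ Y, ConnIn G (seg a y) := fun a ha y hy =>
    connIn_segment (col a) _ _ fun k _ hk =>
      h.adj a ha k (by have := hcle a ha (y + 1) (by omega); omega)
  have hsegle : ∀ a ≤ X, ∀ y ≤ Y, ∀ v ∈ seg a y, ∃ k ≤ len a, c a y ≤ k ∧ k < c a (y + 1) ∧
      v = col a k := by
    rintro a ha y hy v ⟨k, h1, h2, rfl⟩
    exact ⟨k, by have := hcle a ha (y + 1) (by omega); omega, h1, h2, rfl⟩
  have hRseg : ∀ a ≤ X, ∀ y ≤ Y, ∀ a' ≤ X, ∀ y' ≤ Y, ∀ v ∈ R' a y, v ∈ seg a' y' →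
      a = a' ∧ y = y' := by
    intro a ha y hy a' ha' y' hy' v hv hv'
    have hvN := hR'N a ha y hy hv
    obtain ⟨k, hk, h1, h2, rfl⟩ := hsegle a' ha' y' hy' v hv'
    obtain rfl := hvN.2 a' ha' k hk rfl
    refine ⟨rfl, ?_⟩
    obtain ⟨k', hk', h3, h4, h5⟩ := hsegle _ ha y hy _ (hEseg a' ha y hy a' ha k hk hvN.1)
    obtain ⟨-, rfl⟩ := h.inj _ ha _ hk _ ha _ hk' h5
    by_contra hne
    rcases lt_or_gt_of_ne hne with hl | hl
    · have := hcmono a' ha y y' hl (by omega); omega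
    · have := hcmono a' ha y' y hl (by omega); omega
  refine ⟨fun a y => seg a y ∪ R' a y, ⟨?_, ?_, ?_, ?_, ?_⟩⟩
  · intro a ha y hy
    rcases ha.lt_or_eq with haX | rfl
    · obtain ⟨h1, h2, ⟨v, hv, hv'⟩, -⟩ := hR a y haX hy
      rw [hR'eq a haX]
      exact (hseg a ha y hy).union h1 hv' hv (.inl rfl)
    · have : R' a y = ∅ := by ext v; simp [R']
      rw [this, Set.union_empty]
      exact hseg a ha y hy
  · intro a ha y hy
    exact ⟨col a (c a y), .inl ⟨c a y, le_rfl, hclt a ha y hy, rfl⟩⟩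
  · rintro a ha y hy a' ha' y' hy' v (hv | hv) (hv' | hv')
    · obtain ⟨k, hk, h1, h2, rfl⟩ := hsegle a ha y hy v hv
      obtain ⟨k', hk', h3, h4, h5⟩ := hsegle a' ha' y' hy' _ hv'
      obtain ⟨rfl, rfl⟩ := h.inj _ ha _ hk _ ha' _ hk' h5
      refine ⟨rfl, ?_⟩
      by_contra hne
      rcases lt_or_gt_of_ne hne with hl | hl
      · have := hcmono a ha y y' hl (by omega); omega
      · have := hcmono a ha y' y hl (by omega); omega
    · exact (hRseg a' ha' y' hy' a ha y hy v hv' hv).imp Eq.symm Eq.symm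
    · exact hRseg a ha y hy a' ha' y' hy' v hv hv'
    · have := h.disj _ (hτ y (by omega) a ha) _ (hτ y' (by omega) a' ha') v
        (hR'N a ha y hy hv).1 (hR'N a' ha' y' hy' hv').1
      exact (hτinj y y' a a' ha ha' this).symm
  · intro a ha y hy
    obtain ⟨-, -, -, u, hu, v, hv, huv⟩ := hR a y ha hy
    exact ⟨u, .inr (by rwa [hR'eq a ha]), v, .inl hv, huv⟩
  · intro a ha y hy
    have h1 := hclt a ha y hy.le
    have h2 := hclt a ha (y + 1) hy
    have h3 := hcle a ha (y + 1) (by omega)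
    have h4 := h.adj a ha (c a (y + 1) - 1) (by omega)
    rw [Nat.sub_add_cancel (by omega)] at h4
    exact ⟨_, .inl ⟨c a (y + 1) - 1, by omega, by omega, rfl⟩, _, .inl ⟨_, le_rfl, h2, rfl⟩, h4⟩

end Grid

section Layers
variable {V : Type*} {G M H : SimpleGraph V} {A A' S D : Set V} {d : ℕ} {u v : V}

theorem ReachIn.of_getVert (p : G.Walk u v) {s t : ℕ} (hst : s ≤ t) (ht : t ≤ p.length)
    (hS : ∀ k, s ≤ k → k ≤ t → p.getVert k ∈ S) (hG : ∀ k, s ≤ k → k < t →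
      H.Adj (p.getVert k) (p.getVert (k + 1))) : ReachIn H S (p.getVert s) (p.getVert t) := by
  induction t, hst using Nat.le_induction with
  | base => exact .refl (hS s le_rfl le_rfl)
  | succ t hst ih =>
    exact (ih (by omega) (fun k h1 h2 => hS k h1 (by omega)) (fun k h1 h2 => hG k h1 (by omega))).step
      (hG t hst (by omega)) (hS _ (by omega) le_rfl)

/-- All positions of `S` on each path of `P` precede all positions of `S'`. -/
def Linkage.Precedes {ι : Type*} (P : Linkage G A A' ι) (S S' : Set V) : Prop :=
  ∀ i, ∀ k ≤ (P.walk i).length, ∀ l ≤ (P.walk i).length,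
    (P.walk i).getVert k ∈ S → (P.walk i).getVert l ∈ S' → k < l

theorem Linkage.getVert_inj {ι : Type*} (P : Linkage G A A' ι) {i j : ι} {k l : ℕ}
    (hk : k ≤ (P.walk i).length) (hl : l ≤ (P.walk j).length)
    (h : (P.walk i).getVert k = (P.walk j).getVert l) : i = j ∧ k = l := by
  have hij : i = j := P.disj i j _ ((P.walk i).getVert_mem_support k)
    (h ▸ (P.walk j).getVert_mem_support l)
  subst hij
  exact ⟨rfl, (P.isPath i).getVert_injOn hk hl h⟩

/-- A critical edge on a path of a linkage gives rise to a separator meeting every other path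
of the linkage exactly once, which splits the connected sets avoiding it into two ordered classes. -/
theorem Linkage.exists_boundary [Finite V] (P : Linkage M A A' (Fin d)) {i₀ : Fin d} {k : ℕ}
    (hk : k < (P.walk i₀).length) (hHM : H ≤ M)
    (hH : ¬ H.Adj ((P.walk i₀).getVert k) ((P.walk i₀).getVert (k + 1)))
    (hcrit : ∀ M', H ≤ M' → M' ≤ M → Nonempty (Linkage M' A A' (Fin d)) → M' = M) :
    ∃ S : Set V, S.ncard ≤ d ∧ ∀ Q Q' : Set V, ConnIn H Q → ConnIn H Q' →
      Disjoint Q S → Disjoint Q' S →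
      (∃ l ≤ k, (P.walk i₀).getVert l ∈ Q) →
      (∃ l, k < l ∧ l ≤ (P.walk i₀).length ∧ (P.walk i₀).getVert l ∈ Q') → P.Precedes Q Q' := by
  classical
  set x := (P.walk i₀).getVert k with hx
  set y := (P.walk i₀).getVert (k + 1) with hy
  have hxy : M.Adj x y := (P.walk i₀).adj_getVert_succ hk
  let M' := M.deleteEdges {s(x, y)}
  have hM'M : M' ≤ M := M.deleteEdges_le _
  have hM'adj : ∀ {a b}, M.Adj a b → s(a, b) ≠ s(x, y) → M'.Adj a b := fun h h' => by
    simp only [M', deleteEdges_adj]; exact ⟨h, h'⟩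
  have hHM' : H ≤ M' := fun a b hab => hM'adj (hHM hab) fun heq => by
    rcases Sym2.eq_iff.1 heq with ⟨rfl, rfl⟩ | ⟨rfl, rfl⟩
    exacts [hH hab, hH hab.symm]
  obtain ⟨S, hS, hSd⟩ : ∃ S, Separates M' A A' S ∧ S.ncard < d := by
    by_contra! hno
    have := hcrit M' hHM' hM'M (menger hno)
    have h2 : M'.Adj x y := this ▸ hxy
    simp [M', deleteEdges_adj] at h2
  have hpos : ∀ i k', k' ≤ (P.walk i).length → (P.walk i).getVert k' = x → i = i₀ ∧ k' = k :=
    fun i k' hk' h => P.getVert_inj hk' hk.le h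
  have hposy : ∀ i k', k' ≤ (P.walk i).length → (P.walk i).getVert k' = y → i = i₀ ∧ k' = k + 1 :=
    fun i k' hk' h => P.getVert_inj hk' hk h
  have hstep : ∀ i k', k' < (P.walk i).length → (i = i₀ → k' ≠ k) →
      M'.Adj ((P.walk i).getVert k') ((P.walk i).getVert (k' + 1)) := by
    intro i k' hk' hne
    refine hM'adj ((P.walk i).adj_getVert_succ hk') fun heq => ?_
    rcases Sym2.eq_iff.1 heq with ⟨h1, h2⟩ | ⟨h1, h2⟩
    · obtain ⟨rfl, rfl⟩ := hpos i k' hk'.le h1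
      exact hne rfl rfl
    · obtain ⟨rfl, h3⟩ := hposy i k' hk'.le h1
      obtain ⟨-, h4⟩ := hpos i (k' + 1) hk' h2
      omega
  have hmeet : ∀ i, i ≠ i₀ → ∃ k' ≤ (P.walk i).length, (P.walk i).getVert k' ∈ S := by
    intro i hi
    by_contra! hno
    have := ReachIn.of_getVert (H := M') (S := Sᶜ) (P.walk i) (Nat.zero_le _) le_rfl
      (fun k' _ hk' => hno k' hk') (fun k' _ hk' => hstep i k' hk' (fun h => absurd h hi))
    rw [Walk.getVert_zero, Walk.getVert_length] at this
    exact hS _ (P.src_mem i) _ (P.tgt_mem i) this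
  have : ∀ i : Fin d, ∃ k' ≤ (P.walk i).length, i ≠ i₀ → (P.walk i).getVert k' ∈ S := by
    intro i
    by_cases hi : i = i₀
    · exact ⟨0, Nat.zero_le _, fun h => absurd hi h⟩
    · obtain ⟨k', h1, h2⟩ := hmeet i hi
      exact ⟨k', h1, fun _ => h2⟩
  choose σ hσ hσS using this
  -- the separator consists of one vertex on each path other than the one of the critical edge
  have hSeq : S = (fun i => (P.walk i).getVert (σ i)) '' {i₀}ᶜ := by
    symm
    apply Set.eq_of_subset_of_ncard_le
    · rintro _ ⟨i, hi, rfl⟩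
      exact hσS i hi
    · rw [Set.InjOn.ncard_image]
      · have h1 := Set.ncard_add_ncard_compl ({i₀} : Set (Fin d))
        rw [Set.ncard_singleton, Nat.card_eq_fintype_card, Fintype.card_fin] at h1
        omega
      · intro i hi j hj hij
        exact (P.getVert_inj (hσ i) (hσ j) hij).1
    · exact S.toFinite
  have hSpos : ∀ i l, l ≤ (P.walk i).length → (P.walk i).getVert l ∈ S → i ≠ i₀ ∧ l = σ i := by
    intro i l hl hlS
    rw [hSeq] at hlS
    obtain ⟨j, hj, hjl⟩ := hlS
    obtain ⟨rfl, rfl⟩ := P.getVert_inj (hσ j) hl hjl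
    exact ⟨hj, rfl⟩
  let C : Set V := {v | ∃ a ∈ A, ReachIn M' Sᶜ a v}
  have hCout : ∀ v ∈ C, ∀ b ∈ A', ¬ ReachIn M' Sᶜ v b := by
    rintro v ⟨a, ha, hav⟩ b hb hvb
    exact hS a ha b hb (hav.trans hvb)
  let cut : Fin d → ℕ := fun i => if i = i₀ then k else σ i
  have hlow : ∀ i l, l ≤ (P.walk i).length → (P.walk i).getVert l ∉ S → l ≤ cut i →
      (P.walk i).getVert l ∈ C := by
    intro i l hl hlS hcut
    refine ⟨P.src i, P.src_mem i, ?_⟩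
    have := ReachIn.of_getVert (H := M') (S := Sᶜ) (P.walk i) (Nat.zero_le l) hl ?_ ?_
    · rwa [Walk.getVert_zero] at this
    · intro k' _ hk' hk'S
      obtain ⟨h1, rfl⟩ := hSpos i k' (by omega) hk'S
      simp only [cut, if_neg h1] at hcut
      obtain rfl : l = σ i := by omega
      exact hlS hk'S
    · intro k' _ hk'
      refine hstep i k' (by omega) fun h => ?_
      simp only [cut, if_pos h] at hcut
      omega
  have hhigh : ∀ i l, l ≤ (P.walk i).length → (P.walk i).getVert l ∉ S → cut i < l →
      (P.walk i).getVert l ∉ C := by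
    intro i l hl hlS hcut hC
    refine hCout _ hC _ (P.tgt_mem i) ?_
    have := ReachIn.of_getVert (H := M') (S := Sᶜ) (P.walk i) hl le_rfl ?_ ?_
    · rwa [Walk.getVert_length] at this
    · intro k' hk' hk'2 hk'S
      obtain ⟨h1, rfl⟩ := hSpos i k' (by omega) hk'S
      simp only [cut, if_neg h1] at hcut
      omega
    · intro k' hk' hk'2
      refine hstep i k' (by omega) fun h => ?_
      simp only [cut, if_pos h] at hcut
      omega
  have hall : ∀ Q : Set V, ConnIn H Q → Disjoint Q S → ∀ a ∈ Q, ∀ b ∈ Q, a ∈ C → b ∈ C := by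
    rintro Q hQ hQS a ha b hb ⟨c, hc, hca⟩
    exact ⟨c, hc, hca.trans ((hQ a ha b hb).mono hHM' (Set.disjoint_left.1 hQS))⟩
  refine ⟨S, hSd.le, ?_⟩
  rintro Q Q' hQ hQ' hQS hQ'S ⟨l, hl, hlQ⟩ ⟨l', hl', hl'len, hl'Q⟩ i a ha b hb haQ hbQ
  have hcut0 : cut i₀ = k := if_pos rfl
  have h1 := hall Q hQ hQS _ hlQ _ haQ (hlow i₀ l (by omega) (Set.disjoint_left.1 hQS hlQ) (by omega))
  have h2 : (P.walk i).getVert b ∉ C := fun hh => hhigh i₀ l' hl'len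
    (Set.disjoint_left.1 hQ'S hl'Q) (by omega) (hall Q' hQ' hQ'S _ hbQ _ hl'Q hh)
  by_contra hba
  by_cases hac : a ≤ cut i
  · exact h2 (hlow i b hb (Set.disjoint_left.1 hQ'S hbQ) (by omega))
  · exact hhigh i a ha (Set.disjoint_left.1 hQS haQ) (by omega) h1

theorem exists_sorted {ι : Type*} (J : Finset ι) (hJ : J.Nonempty) (κ : ι → ℕ)
    (hκ : Set.InjOn κ J) : ∃ s : ℕ → ι, (∀ t < J.card, s t ∈ J) ∧
      ∀ t t', t < t' → t' < J.card → κ (s t) < κ (s t') := by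
  classical
  have hc : (J.image κ).card = J.card := Finset.card_image_of_injOn hκ
  let e := (J.image κ).orderEmbOfFin hc
  have : ∀ t, ∃ j ∈ J, ∀ h : t < J.card, κ j = e ⟨t, h⟩ := by
    intro t
    by_cases h : t < J.card
    · obtain ⟨j, hj, hje⟩ := Finset.mem_image.1 ((J.image κ).orderEmbOfFin_mem hc ⟨t, h⟩)
      exact ⟨j, hj, fun _ => hje⟩
    · obtain ⟨j, hj⟩ := hJ
      exact ⟨j, hj, fun h' => absurd h' h⟩
  choose s hs hse using this
  refine ⟨s, fun t _ => hs t, fun t t' htt ht' => ?_⟩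
  rw [hse t (htt.trans ht'), hse t' ht']
  exact e.strictMono htt

/-- Among many disjoint connected sets meeting a path of a critical linkage, there are `m` sets
that appear in the same order on all paths of the linkage. -/
theorem Linkage.exists_layers [Finite V] (P : Linkage M A A' (Fin d)) (hHM : H ≤ M)
    (hcrit : ∀ M', H ≤ M' → M' ≤ M → Nonempty (Linkage M' A A' (Fin d)) → M' = M) {ι : Type*}
    (Q : ι → Set V) (J : Finset ι) (hQ : ∀ j ∈ J, ConnIn H (Q j))
    (hQH : ∀ j ∈ J, ∀ a b, H.Adj a b → a ∈ Q j → b ∈ Q j)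
    (hdisj : ∀ i ∈ J, ∀ j ∈ J, ∀ v ∈ Q i, v ∈ Q j → i = j) (i₀ : Fin d)
    (hi₀ : ∀ j ∈ J, ∃ x ∈ (P.walk i₀).support, x ∈ Q j) {m : ℕ} (hm0 : 0 < m)
    (hm : m * (m * d + 1) ≤ J.card) :
    ∃ g : ℕ → ι, (∀ t < m, g t ∈ J) ∧
      ∀ t t', t < t' → t' < m → P.Precedes (Q (g t)) (Q (g t')) := by
  classical
  have hJ : J.Nonempty := by
    rw [← Finset.card_pos]
    exact lt_of_lt_of_le (by positivity) hm
  have hpos : ∀ j, ∃ k, j ∈ J → k ≤ (P.walk i₀).length ∧ (P.walk i₀).getVert k ∈ Q j := by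
    intro j
    by_cases hj : j ∈ J
    · obtain ⟨x, hx, hxQ⟩ := hi₀ j hj
      obtain ⟨k, rfl, hk⟩ := Walk.mem_support_iff_exists_getVert.1 hx
      exact ⟨k, fun _ => ⟨hk, hxQ⟩⟩
    · exact ⟨0, fun h => absurd h hj⟩
  choose κ hκ using hpos
  have hκinj : Set.InjOn κ J := fun i hi j hj hij =>
    hdisj i hi j hj _ (hκ i hi).2 (hij ▸ (hκ j hj).2)
  obtain ⟨s, hsJ, hs⟩ := exists_sorted J hJ κ hκinj
  have hsle : ∀ t t', t ≤ t' → t' < J.card → κ (s t) ≤ κ (s t') := by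
    intro t t' htt ht'
    rcases htt.lt_or_eq with h | rfl
    exacts [(hs t t' h ht').le, le_rfl]
  have hbd : ∀ t, ∃ S : Set V, t + 1 < J.card → S.ncard ≤ d ∧ ∀ j ∈ J, ∀ j' ∈ J,
      Disjoint (Q j) S → Disjoint (Q j') S → κ j ≤ κ (s t) → κ (s (t + 1)) ≤ κ j' →
      P.Precedes (Q j) (Q j') := by
    intro t
    by_cases ht : t + 1 < J.card
    swap
    · exact ⟨∅, fun h => absurd h ht⟩
    have hst := hsJ t (by omega)
    have hst' := hsJ (t + 1) ht
    have hlt := hs t (t + 1) (by omega) ht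
    have hex : ∃ k, κ (s t) < k ∧ (P.walk i₀).getVert k ∉ Q (s t) := by
      refine ⟨κ (s (t + 1)), hlt, fun hmem => ?_⟩
      have := hdisj _ hst _ hst' _ hmem (hκ _ hst').2
      rw [this] at hlt
      exact lt_irrefl _ hlt
    have hle : Nat.find hex ≤ κ (s (t + 1)) := by
      refine Nat.find_min' hex ⟨hlt, fun hmem => ?_⟩
      have := hdisj _ hst _ hst' _ hmem (hκ _ hst').2
      rw [this] at hlt
      exact lt_irrefl _ hlt
    obtain ⟨h1, h2⟩ := Nat.find_spec hex
    obtain ⟨k, hk⟩ : ∃ k, Nat.find hex = k + 1 := ⟨Nat.find hex - 1, by omega⟩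
    rw [hk] at h1 h2 hle
    have h3 : (P.walk i₀).getVert k ∈ Q (s t) := by
      rcases (Nat.lt_succ_iff.1 h1).lt_or_eq with h | h
      · by_contra hno
        have := Nat.find_min' hex ⟨h, hno⟩
        omega
      · rw [← h]; exact (hκ _ hst).2
    have h4 := (hκ _ hst').1
    obtain ⟨S, hSd, hS⟩ := P.exists_boundary (k := k) (by omega) hHM
      (fun hadj => h2 (hQH _ hst _ _ hadj h3)) hcrit
    refine ⟨S, fun _ => ⟨hSd, fun j hj j' hj' hjS hj'S hle1 hle2 => ?_⟩⟩
    exact hS _ _ (hQ j hj) (hQ j' hj') hjS hj'S ⟨κ j, by omega, (hκ j hj).2⟩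
      ⟨κ j', by omega, (hκ j' hj').1, (hκ j' hj').2⟩
  choose S hS using hbd
  set q := m * d + 1 with hq
  have hblock : ∀ b < m - 1, (b + 1) * q < J.card := by
    intro b hb
    have := Nat.mul_le_mul_right q (show b + 2 ≤ m by omega)
    nlinarith
  let U : Set V := ⋃ b ∈ Finset.range (m - 1), S ((b + 1) * q - 1)
  have hU : U.ncard < q := by
    have h1 := Finset.set_ncard_biUnion_le (Finset.range (m - 1)) fun b => S ((b + 1) * q - 1)
    have h2 := Finset.sum_le_card_nsmul (Finset.range (m - 1))
      (fun b => (S ((b + 1) * q - 1)).ncard) d (fun b hb => by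
        have hb' := hblock b (by simpa using hb)
        exact (hS _ (by rw [Nat.sub_add_cancel (by nlinarith)]; exact hb')).1)
    simp only [Finset.card_range, smul_eq_mul] at h2
    have h3 := Nat.mul_le_mul_right d (Nat.sub_le m 1)
    have h4 : U.ncard ≤ _ := h1
    omega
  have hpick : ∀ b, ∃ t, b < m → b * q ≤ t ∧ t < (b + 1) * q ∧ Disjoint (Q (s t)) U := by
    intro b
    by_cases hb : b < m
    swap
    · exact ⟨0, fun h => absurd h hb⟩
    by_contra! hno
    have hbq : (b + 1) * q ≤ J.card := (Nat.mul_le_mul_right q hb).trans hm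
    have : ∀ t ∈ Finset.Ico (b * q) ((b + 1) * q), ∃ v ∈ U, v ∈ Q (s t) := by
      intro t ht
      rw [Finset.mem_Ico] at ht
      obtain ⟨v, hv, hv'⟩ := Set.not_disjoint_iff.1 ((hno t).2 ht.1 ht.2)
      exact ⟨v, hv', hv⟩
    have hne : Nonempty V := ⟨P.src i₀⟩
    choose! f hfU hfQ using this
    have hinj : Set.InjOn f (Finset.Ico (b * q) ((b + 1) * q) : Set ℕ) := by
      intro t ht t' ht' heq
      have h1 := hfQ t (by simpa using ht)
      have h2 := hfQ t' (by simpa using ht')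
      rw [← heq] at h2
      simp only [Finset.coe_Ico, Set.mem_Ico] at ht ht'
      have h3 := hdisj _ (hsJ t (by omega)) _ (hsJ t' (by omega)) _ h1 h2
      rcases lt_trichotomy t t' with h | h | h
      · have := hs t t' h (by omega); rw [h3] at this; omega
      · exact h
      · have := hs t' t h (by omega); rw [h3] at this; omega
    have h1 := Set.ncard_le_ncard_of_injOn f (fun a ha => hfU a (by simpa using ha)) hinj U.toFinite
    rw [Set.ncard_coe_finset, Nat.card_Ico, Nat.succ_mul] at h1
    omega
  choose τ hτ using hpick
  refine ⟨fun b => s (τ b), fun b hb => hsJ _ ?_, fun b b' hbb hb' => ?_⟩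
  · have := Nat.mul_le_mul_right q (show b + 1 ≤ m from hb)
    have := (hτ b hb).2.1
    omega
  · have hbm : b < m - 1 := by omega
    obtain ⟨h1, h2, h3⟩ := hτ b (by omega)
    obtain ⟨h4, h5, h6⟩ := hτ b' hb'
    have hlast := hblock b hbm
    have h7 : (b + 1) * q ≤ b' * q := Nat.mul_le_mul_right q hbb
    have h8 := Nat.mul_le_mul_right q (show b' + 1 ≤ m from hb')
    have hSU : S ((b + 1) * q - 1) ⊆ U := by
      intro v hv
      simp only [U, Set.mem_iUnion]
      exact ⟨b, by simpa using hbm, hv⟩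
    have hsucc : (b + 1) * q - 1 + 1 = (b + 1) * q := Nat.sub_add_cancel (by nlinarith)
    refine (hS ((b + 1) * q - 1) (by rw [hsucc]; exact hlast)).2 _ (hsJ _ (by omega)) _
      (hsJ _ (by omega)) (h3.mono_right hSU) (h6.mono_right hSU) (hsle _ _ (by omega) (by omega)) ?_
    rw [hsucc]
    exact hsle _ _ (by omega) (by omega)

end Layers

section PathOrStar
variable {I : Type*} {Γ : SimpleGraph I}

theorem ncard_walk_length_le [Finite I] {r : ℕ} (hdeg : ∀ i, (Γ.neighborSet i).ncard ≤ r) (v : I)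
    (k : ℕ) : {u | ∃ p : Γ.Walk v u, p.length = k}.ncard ≤ r ^ k := by
  classical
  induction k with
  | zero =>
    have : {u | ∃ p : Γ.Walk v u, p.length = 0} ⊆ {v} := by
      rintro u ⟨p, hp⟩
      exact (Walk.eq_of_length_eq_zero hp).symm
    exact (Set.ncard_le_ncard this).trans (by simp)
  | succ k ih =>
    set W := {u | ∃ p : Γ.Walk v u, p.length = k} with hW
    have hsub : {u | ∃ p : Γ.Walk v u, p.length = k + 1} ⊆
        ⋃ w ∈ W.toFinite.toFinset, Γ.neighborSet w := by
      rintro u ⟨p, hp⟩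
      simp only [Set.mem_iUnion, Set.Finite.mem_toFinset]
      have hn : ¬ p.Nil := by rw [Walk.not_nil_iff_lt_length]; omega
      exact ⟨p.penultimate, ⟨p.dropLast, by simp [hp]⟩, p.adj_penultimate hn⟩
    have h1 := Set.ncard_le_ncard hsub (Set.toFinite _)
    have h2 := Finset.set_ncard_biUnion_le W.toFinite.toFinset fun w => Γ.neighborSet w
    have h3 := Finset.sum_le_card_nsmul W.toFinite.toFinset (fun w => (Γ.neighborSet w).ncard) r
      fun w _ => hdeg w
    rw [← Set.ncard_eq_toFinset_card _ W.toFinite, smul_eq_mul] at h3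
    calc _ ≤ W.ncard * r := (h1.trans h2).trans h3
      _ ≤ r ^ k * r := Nat.mul_le_mul_right _ ih
      _ = r ^ (k + 1) := (pow_succ _ _).symm

/-- A large connected graph contains a long path or a large star. -/
theorem exists_path_or_star [Finite I] {r : ℕ} (hr : 0 < r) (hΓ : Γ.Connected)
    (hI : r * r ^ r < Nat.card I) :
    ∃ f : ℕ → I, Set.InjOn f {a | a < r} ∧
      ((∀ a, a + 1 < r → Γ.Adj (f a) (f (a + 1))) ∨ ∃ c, ∀ a < r, Γ.Adj c (f a)) := by
  classical
  by_cases hdeg : ∀ i, (Γ.neighborSet i).ncard ≤ r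
  · obtain ⟨v⟩ := hΓ.nonempty
    by_cases hlong : ∃ u, r ≤ Γ.dist v u
    · obtain ⟨u, hu⟩ := hlong
      obtain ⟨p, hp, hpl⟩ := hΓ.exists_path_of_dist v u
      refine ⟨p.getVert, fun a ha b hb hab => ?_, .inl fun a ha => p.adj_getVert_succ (by omega)⟩
      simp only [Set.mem_ofPred_eq] at ha hb
      exact hp.getVert_injOn (show a ≤ p.length by omega) (show b ≤ p.length by omega) hab
    · push Not at hlong
      have hsub : (Set.univ : Set I) ⊆ ⋃ k ∈ Finset.range r, {u | ∃ p : Γ.Walk v u, p.length = k} := by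
        intro u _
        obtain ⟨p, hp⟩ := (hΓ v u).exists_walk_length_eq_dist
        simp only [Set.mem_iUnion]
        exact ⟨Γ.dist v u, by simpa using hlong u, p, hp⟩
      have h1 := Set.ncard_le_ncard hsub (Set.toFinite _)
      have h2 := Finset.set_ncard_biUnion_le (Finset.range r)
        fun k => {u | ∃ p : Γ.Walk v u, p.length = k}
      have h3 := Finset.sum_le_card_nsmul (Finset.range r)
        (fun k => {u | ∃ p : Γ.Walk v u, p.length = k}.ncard) (r ^ r) fun k hk =>
          (ncard_walk_length_le hdeg v k).trans
            (Nat.pow_le_pow_right hr (Finset.mem_range.1 hk).le)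
      rw [Set.ncard_univ] at h1
      simp only [Finset.card_range, smul_eq_mul] at h3
      omega
  · push Not at hdeg
    obtain ⟨c, hc⟩ := hdeg
    have : Nonempty I := ⟨c⟩
    have hfin : Fintype (Γ.neighborSet c) := Fintype.ofFinite _
    obtain ⟨e⟩ := Function.Embedding.nonempty_of_card_le (α := Fin r) (β := Γ.neighborSet c) (by
      rw [Fintype.card_fin, ← Nat.card_eq_fintype_card]; exact hc.le)
    refine ⟨fun a => if h : a < r then e ⟨a, h⟩ else c, fun a ha b hb hab => ?_,
      .inr ⟨c, fun a ha => ?_⟩⟩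
    · simp only [Set.mem_ofPred_eq] at ha hb
      simp only [dif_pos ha, dif_pos hb] at hab
      simpa using e.injective (Subtype.ext hab)
    · simp only [dif_pos ha]
      exact (e ⟨a, ha⟩).2

end PathOrStar

section Rungs
variable {V I : Type*} {G : SimpleGraph V} {Q : Set V} {K : I → Set V}

/-- Two of the disjoint sets `K i` are adjacent if `Q` contains a walk between them that
avoids all others. -/
def touchGraph (G : SimpleGraph V) (Q : Set V) (K : I → Set V) : SimpleGraph I where
  Adj i j := i ≠ j ∧ ∃ u ∈ K i, ∃ v ∈ K j, ReachIn G (Q ∩ {z | ∀ l, z ∈ K l → l = i ∨ l = j}) u v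
  symm := ⟨fun _ _ ⟨hne, u, hu, v, hv, h⟩ => ⟨hne.symm, v, hv, u, hu,
    h.symm.mono le_rfl fun _ hz => ⟨hz.1, fun l hl => (hz.2 l hl).symm⟩⟩⟩
  loopless := ⟨fun _ h => h.1 rfl⟩

theorem touchGraph_connected [Nonempty I] (hQ : ConnIn G Q)
    (hK : ∀ i j v, v ∈ K i → v ∈ K j → i = j) (hQK : ∀ i, ∃ v ∈ Q, v ∈ K i) :
    (touchGraph G Q K).Connected := by
  rw [connected_iff]
  refine ⟨fun i j => ?_, inferInstance⟩
  obtain ⟨u, huQ, hu⟩ := hQK i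
  obtain ⟨v, hvQ, hv⟩ := hQK j
  have : ∃ l, (touchGraph G Q K).Reachable i l ∧ ∃ x ∈ K l,
      ReachIn G (Q ∩ {z | ∀ m, z ∈ K m → m = l}) x v := by
    refine (hQ u huQ v hvQ).closed (P := fun z => ∃ l, (touchGraph G Q K).Reachable i l ∧
      ∃ x ∈ K l, ReachIn G (Q ∩ {z | ∀ m, z ∈ K m → m = l}) x z)
      ⟨i, .refl _, u, hu, .refl ⟨huQ, fun m hm => hK _ _ _ hm hu⟩⟩ ?_
    rintro a b ⟨l, hl, x, hx, hxa⟩ hab hbQ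
    by_cases hb : ∃ m, m ≠ l ∧ b ∈ K m
    · obtain ⟨m, hm, hbm⟩ := hb
      refine ⟨m, hl.trans (Adj.reachable ⟨hm.symm, x, hx, b, hbm, ?_⟩), b, hbm,
        .refl ⟨hbQ, fun n hn => hK _ _ _ hn hbm⟩⟩
      exact ReachIn.step (hxa.mono le_rfl fun z hz => ⟨hz.1, fun n hn => .inl (hz.2 n hn)⟩) hab
        ⟨hbQ, fun n hn => .inr (hK _ _ _ hn hbm)⟩
    · refine ⟨l, hl, x, hx, hxa.step hab ⟨hbQ, fun m hm => ?_⟩⟩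
      by_contra hne
      exact hb ⟨m, hne, hm⟩
  obtain ⟨l, hl, x, hx, hxv⟩ := this
  rwa [hxv.right_mem.2 j hv]

/-- A connected set meeting many disjoint columns joins consecutive columns of some long sequence,
possibly with the help of a connected piece of one further column. -/
theorem exists_rungs [Finite I] {r : ℕ} (hr : 0 < r) (hI : r * r ^ r < Nat.card I)
    (hQ : ConnIn G Q) (hK : ∀ i j v, v ∈ K i → v ∈ K j → i = j) (hQK : ∀ i, ∃ v ∈ Q, v ∈ K i)
    (hull : I → Set V) (hhull : ∀ i, ConnIn G (hull i)) (hhK : ∀ i, hull i ⊆ K i)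
    (hQh : ∀ i, ∀ v ∈ Q, v ∈ K i → v ∈ hull i) :
    ∃ f : ℕ → I, Set.InjOn f {a | a < r} ∧ ∀ a, a + 1 < r →
      ∃ u ∈ K (f a), ∃ v ∈ K (f (a + 1)), ReachIn G
        ((Q ∪ ⋃ i, hull i) ∩ {z | ∀ b < r, z ∈ K (f b) → b = a ∨ b = a + 1}) u v := by
  have hne : Nonempty I := (Nat.card_pos_iff.1 (by omega)).1
  obtain ⟨f, hf, h⟩ := exists_path_or_star hr (touchGraph_connected hQ hK hQK) hI
  refine ⟨f, hf, fun a ha => ?_⟩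
  rcases h with h | ⟨c, hc⟩
  · obtain ⟨-, u, hu, v, hv, huv⟩ := h a ha
    refine ⟨u, hu, v, hv, huv.mono le_rfl fun z hz => ⟨.inl hz.1, fun b hb hzb => ?_⟩⟩
    refine (hz.2 _ hzb).imp (fun h => ?_) fun h => ?_
    exacts [hf hb (show a < r by omega) h, hf hb ha h]
  · obtain ⟨hne1, u, hu, v, hv, huv⟩ := hc a (by omega)
    obtain ⟨hne2, u', hu', v', hv', huv'⟩ := hc (a + 1) ha
    have hback : ∀ b, b < r → ∀ {x y}, ReachIn G (Q ∩ {z | ∀ l, z ∈ K l → l = c ∨ l = f b}) x y →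
        (b = a ∨ b = a + 1) → ReachIn G
          ((Q ∪ ⋃ i, hull i) ∩ {z | ∀ b < r, z ∈ K (f b) → b = a ∨ b = a + 1}) x y := by
      refine fun b hb x y h hba => h.mono le_rfl fun z hz => ⟨.inl hz.1, fun b' hb' hzb => ?_⟩
      rcases hz.2 _ hzb with h | h
      · exact absurd h.symm (hc b' hb').1
      · rwa [hf hb' hb h]
    have hmid : ReachIn G ((Q ∪ ⋃ i, hull i) ∩ {z | ∀ b < r, z ∈ K (f b) → b = a ∨ b = a + 1}) u u' :=
      (hhull c u (hQh c u huv.left_mem.1 hu) u' (hQh c u' huv'.left_mem.1 hu')).mono le_rfl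
        fun z hz => ⟨.inr (Set.mem_iUnion.2 ⟨c, hz⟩), fun b hb hzb =>
          absurd (hK _ _ _ (hhK c hz) hzb) (hc b hb).1⟩
    exact ⟨v, hv, v', hv', ((hback a (by omega) huv (.inl rfl)).symm.trans hmid).trans
      (hback (a + 1) ha huv' (.inr rfl))⟩

end Rungs

section LayersToGrid
variable {V : Type*} {G : SimpleGraph V} {A A' : Set V} {d : ℕ}

/-- Many disjoint connected sets, appearing in the same order on many disjoint paths, yield a
grid. -/
theorem Linkage.exists_isGrid [Finite V] (P : Linkage G A A' (Fin d)) (I : Finset (Fin d))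
    {X Y m : ℕ} (hI : (X + 1) * (X + 1) ^ (X + 1) < I.card) (Q : ℕ → Set V)
    (hm : d ^ (X + 1) * ((Y + 2) * (X + 1)) ≤ m) (hQ : ∀ t < m, ConnIn G (Q t))
    (hdisj : ∀ t < m, ∀ t' < m, ∀ v ∈ Q t, v ∈ Q t' → t = t')
    (hprec : ∀ t t', t < t' → t' < m → P.Precedes (Q t) (Q t'))
    (hQI : ∀ t < m, ∀ i ∈ I, ∃ x ∈ (P.walk i).support, x ∈ Q t) : ∃ B, IsGrid G X Y B := by
  classical
  have hlohi : ∀ t (i : I), ∃ lo hi : ℕ, t < m → lo ≤ hi ∧ hi ≤ (P.walk i).length ∧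
      (P.walk i).getVert lo ∈ Q t ∧ (P.walk i).getVert hi ∈ Q t ∧
      ∀ k ≤ (P.walk i).length, (P.walk i).getVert k ∈ Q t → lo ≤ k ∧ k ≤ hi := by
    intro t i
    by_cases ht : t < m
    swap
    · exact ⟨0, 0, fun h => absurd h ht⟩
    have hfin : {k | k ≤ (P.walk i).length ∧ (P.walk i).getVert k ∈ Q t}.Finite :=
      (Set.finite_Iic (P.walk i).length).subset fun k hk => hk.1
    have hne : {k | k ≤ (P.walk i).length ∧ (P.walk i).getVert k ∈ Q t}.Nonempty := by
      obtain ⟨x, hx, hxQ⟩ := hQI t ht i i.2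
      obtain ⟨k, rfl, hk⟩ := Walk.mem_support_iff_exists_getVert.1 hx
      exact ⟨k, hk, hxQ⟩
    obtain ⟨lo, ⟨h1, h2⟩, hlo⟩ := Set.exists_min_image _ id hfin hne
    obtain ⟨hi, ⟨h3, h4⟩, hhi⟩ := Set.exists_max_image _ id hfin hne
    exact ⟨lo, hi, fun _ => ⟨hlo hi ⟨h3, h4⟩, h3, h2, h4,
      fun k hk hkQ => ⟨hlo k ⟨hk, hkQ⟩, hhi k ⟨hk, hkQ⟩⟩⟩⟩
  choose lo hi hlh using hlohi
  let K : I → Set V := fun i => {v | v ∈ (P.walk i).support}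
  let hull : ℕ → I → Set V := fun t i =>
    {v | ∃ k, lo t i ≤ k ∧ k < hi t i + 1 ∧ v = (P.walk i).getVert k}
  let E : ℕ → Set V := fun t => Q t ∪ ⋃ i, hull t i
  have hEmem : ∀ t < m, ∀ i : I, ∀ k ≤ (P.walk i).length, (P.walk i).getVert k ∈ E t →
      lo t i ≤ k ∧ k ≤ hi t i := by
    rintro t ht i k hk (hkQ | hkh)
    · exact (hlh t i ht).2.2.2.2 k hk hkQ
    · obtain ⟨j, k', h1, h2, h3⟩ := Set.mem_iUnion.1 hkh
      have := (hlh t j ht).2.1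
      obtain ⟨hij, rfl⟩ := P.getVert_inj hk (show k' ≤ _ by omega) h3
      obtain rfl := Subtype.ext hij
      omega
  have hlt : ∀ t t', t < t' → t' < m → ∀ i, hi t i < lo t' i := by
    intro t t' htt ht' i
    obtain ⟨h1, h2, h3, h4, -⟩ := hlh t i (htt.trans ht')
    obtain ⟨h5, h6, h7, h8, -⟩ := hlh t' i ht'
    exact hprec t t' htt ht' i _ h2 _ (h5.trans h6) h4 h7
  have hElt : ∀ t t', t < t' → t' < m → ∀ v ∈ E t, v ∉ E t' := by
    intro t t' htt ht' v hv hv'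
    have hcol : ∀ (i : I) k, k ≤ (P.walk i).length → v ≠ (P.walk i).getVert k := by
      rintro i k hk rfl
      have h1 := hEmem t (htt.trans ht') i k hk hv
      have h2 := hEmem t' ht' i k hk hv'
      have := hlt t t' htt ht' i
      omega
    have hQm : ∀ t < m, v ∈ E t → v ∈ Q t := by
      rintro t ht (h | h)
      · exact h
      · obtain ⟨i, k, h1, h2, h3⟩ := Set.mem_iUnion.1 h
        have := (hlh t i ht).2.1
        exact absurd h3 (hcol i k (by omega))
    have := hdisj t (htt.trans ht') t' ht' v (hQm t (htt.trans ht') hv) (hQm t' ht' hv')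
    omega
  have hrung : ∀ t, ∃ f : ℕ → I, t < m → Set.InjOn f {a | a < X + 1} ∧ ∀ a, a + 1 < X + 1 →
      ∃ u ∈ K (f a), ∃ v ∈ K (f (a + 1)), ReachIn G
        (E t ∩ {z | ∀ b < X + 1, z ∈ K (f b) → b = a ∨ b = a + 1}) u v := by
    intro t
    have hIne : 0 < I.card := by omega
    obtain ⟨i, hi'⟩ := Finset.card_pos.1 hIne
    by_cases ht : t < m
    swap
    · exact ⟨fun _ => ⟨i, hi'⟩, fun h => absurd h ht⟩
    obtain ⟨f, hf⟩ := exists_rungs (K := K) (r := X + 1) (Nat.succ_pos _) (by simpa using hI) (hQ t ht)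
      (fun i j v hi hj => Subtype.ext (P.disj _ _ v hi hj))
      (fun i => by obtain ⟨x, hx, hxQ⟩ := hQI t ht i i.2; exact ⟨x, hxQ, hx⟩) (hull t)
      (fun i => connIn_segment _ _ _ fun k _ hk => (P.walk i).adj_getVert_succ (by
        have := (hlh t i ht).2.1; omega))
      (fun i v hv => by obtain ⟨k, -, -, rfl⟩ := hv; exact (P.walk i).getVert_mem_support k)
      (fun i v hvQ hv => by
        obtain ⟨k, rfl, hk⟩ := Walk.mem_support_iff_exists_getVert.1 hv
        have := (hlh t i ht).2.2.2.2 k hk hvQ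
        exact ⟨k, this.1, by omega, rfl⟩)
    exact ⟨f, fun _ => hf⟩
  choose f hf using hrung
  obtain ⟨φ, -, hφ⟩ := Finset.exists_le_card_fiber_of_mul_le_card_of_maps_to
    (s := Finset.range m) (t := (Finset.univ : Finset (Fin (X + 1) → Fin d)))
    (f := fun t a => (f t a : Fin d)) (n := (Y + 2) * (X + 1)) (fun _ _ => Finset.mem_univ _)
    ⟨fun a => (f 0 a : Fin d), Finset.mem_univ _⟩ (by simpa using hm)
  set J := {t ∈ Finset.range m | (fun a : Fin (X + 1) => (f t a : Fin d)) = φ} with hJ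
  obtain ⟨s, hsJ, hs⟩ := exists_sorted J
    (Finset.card_pos.1 (lt_of_lt_of_le (by positivity) hφ)) id Function.injective_id.injOn
  simp only [id] at hs
  have hsm : ∀ t < (Y + 2) * (X + 1), s t < m := fun t ht => by
    have := hsJ t (by omega)
    simp only [hJ, Finset.mem_filter, Finset.mem_range] at this
    exact this.1
  have hsf : ∀ t < (Y + 2) * (X + 1), ∀ a ≤ X, f (s t) a = f (s 0) a := fun t ht a ha => by
    have h1 := hsJ t (by omega)
    have h2 := hsJ 0 (lt_of_lt_of_le (by positivity) hφ)
    simp only [hJ, Finset.mem_filter, Finset.mem_range] at h1 h2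
    have h3 := congrFun (h1.2.trans h2.2.symm) ⟨a, by omega⟩
    exact Subtype.ext h3
  set F := f (s 0) with hF
  have hFinj := (hf (s 0) (hsm 0 (by positivity))).1
  rw [← hF] at hFinj
  refine IsLattice.exists_isGrid (col := fun a k => (P.walk (F a)).getVert k)
    (len := fun a => (P.walk (F a)).length) (E := fun t => E (s t))
    (lo := fun t a => lo (s t) (F a)) (hi := fun t a => hi (s t) (F a))
    ⟨?_, ?_, ?_, ?_, ?_, ?_, ?_, ?_⟩
  · exact fun a _ k hk => (P.walk (F a)).adj_getVert_succ hk
  · intro a ha k hk b hb l hl hab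
    obtain ⟨h1, h2⟩ := P.getVert_inj hk hl hab
    exact ⟨hFinj (show a < X + 1 by omega) (show b < X + 1 by omega) (Subtype.ext h1), h2⟩
  · intro t ht t' ht' v hv hv'
    rcases lt_trichotomy t t' with h | h | h
    · exact absurd hv' (hElt _ _ (hs t t' h (by omega)) (hsm t' ht') v hv)
    · exact h
    · exact absurd hv (hElt _ _ (hs t' t h (by omega)) (hsm t ht) v hv')
  · exact fun t ht a _ => (hlh _ _ (hsm t ht)).1
  · exact fun t ht a _ => (hlh _ _ (hsm t ht)).2.1
  · exact fun t t' htt ht' a _ => hlt _ _ (hs t t' htt (by omega)) (hsm t' ht') _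
  · exact fun t ht a _ k hk hkE => hEmem _ (hsm t ht) _ k hk hkE
  · intro t ht a ha
    obtain ⟨u, hu, v, hv, huv⟩ := (hf (s t) (hsm t ht)).2 a (by omega)
    rw [hsf t ht a ha.le] at hu
    rw [hsf t ht (a + 1) ha] at hv
    obtain ⟨k, rfl, hk⟩ := Walk.mem_support_iff_exists_getVert.1 hu
    obtain ⟨l, rfl, hl⟩ := Walk.mem_support_iff_exists_getVert.1 hv
    refine ⟨k, hk, l, hl, huv.mono le_rfl fun z hz => ⟨hz.1, fun b hb n hn hzb => ?_⟩⟩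
    refine hz.2 b (by omega) ?_
    rw [hsf t ht b hb, hzb]
    exact (P.walk (F b)).getVert_mem_support n

end LayersToGrid

section Dichotomy
variable {V : Type*} {G : SimpleGraph V}

theorem Linkage.inGraph {F : SimpleGraph V} {A A' D : Set V} {d n : ℕ} (P : Linkage F A A' (Fin d))
    (S : Finset (Fin d)) (hS : n ≤ S.card) (hD : ∀ i ∈ S, ∀ x ∈ (P.walk i).support, x ∈ D) :
    Nonempty (Linkage (inGraph F D) (A ∩ D) (A' ∩ D) (Fin n)) := by
  obtain ⟨e⟩ := Function.Embedding.nonempty_of_card_le (α := Fin n) (β := S) (by simpa using hS)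
  have : ∀ i : Fin n, ∃ p : (_root_.inGraph F D).Walk (P.src (e i)) (P.tgt (e i)),
      ∀ x ∈ p.support, x ∈ (P.walk (e i)).support := fun i =>
    ReachIn.inGraph (S := {x | x ∈ (P.walk (e i)).support}) ⟨P.walk (e i), fun _ h => h⟩
      (hD _ (e i).2)
  choose p hp using this
  obtain ⟨L, -⟩ := linkage_of_walks (A := A ∩ D) (B := A' ∩ D) _ _
    (fun i => ⟨P.src_mem (e i), hD _ (e i).2 _ (P.walk _).start_mem_support⟩)
    (fun i => ⟨P.tgt_mem (e i), hD _ (e i).2 _ (P.walk _).end_mem_support⟩) p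
    (fun i j x hi hj => e.injective (Subtype.ext (P.disj _ _ x (hp i x hi) (hp j x hj))))
  exact ⟨L⟩

/-- Either a graph has a grid, or one can choose one path from each of `N` given large linkages
so that the chosen paths are disjoint. -/
theorem exists_disjoint_or_isGrid (X Y N : ℕ) : ∃ n : ℕ, 0 < n ∧
    ∀ (V : Type u) [Finite V] (F : SimpleGraph V) (A A' : Fin N → Set V),
      (∀ s, Nonempty (Linkage F (A s) (A' s) (Fin n))) → (∃ B, IsGrid F X Y B) ∨
      ∃ R : Fin N → Set V, (Pairwise fun s s' => Disjoint (R s) (R s')) ∧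
        ∀ s, ∃ u ∈ A s, ∃ v ∈ A' s, ReachIn F (R s) u v := by
  classical
  induction N with
  | zero => exact ⟨1, one_pos, fun V _ F A A' _ => .inr ⟨fun _ => ∅, fun s => s.elim0, fun s => s.elim0⟩⟩
  | succ N ih =>
    obtain ⟨n', -, hn'⟩ := ih
    set c := (X + 1) * (X + 1) ^ (X + 1) + 1 with hc
    set d := 2 * (n' + c) with hd
    set m := d ^ (X + 1) * ((Y + 2) * (X + 1)) with hm
    have hdpos : 0 < d := by omega
    have hmpos : 0 < m := by positivity
    refine ⟨N * 2 ^ d * (m * (m * d + 1)) + d, by omega, fun V _ F A A' hL => ?_⟩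
    let L := fun s => (hL s).some
    set n := N * 2 ^ d * (m * (m * d + 1)) + d with hn
    let Q : Fin n → Set V := fun j => {x | x ∈ ((L 0).walk j).support}
    let H := (L 0).graph
    have hM : ∀ s : Fin N, ∃ M, Minimal (fun M : SimpleGraph V => H ≤ M ∧ M ≤ F ∧
        Nonempty (Linkage M (A s.succ) (A' s.succ) (Fin d))) M := by
      intro s
      refine Set.Finite.exists_minimal (s := {M : SimpleGraph V | H ≤ M ∧ M ≤ F ∧
        Nonempty (Linkage M (A s.succ) (A' s.succ) (Fin d))}) (Set.toFinite _) ⟨F, ?_⟩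
      exact ⟨(L 0).graph_le, le_rfl,
        ⟨(L s.succ).comp (Fin.castLE (by omega)) (Fin.castLE_injective _)⟩⟩
    choose M hM using hM
    let P := fun s => (hM s).1.2.2.some
    by_cases hgood : ∃ j, ∀ s, n' ≤ {i | Disjoint {x | x ∈ ((P s).walk i).support} (Q j)}.toFinset.card
    · obtain ⟨j, hj⟩ := hgood
      rcases hn' V (inGraph F (Q j)ᶜ) (fun s => A s.succ ∩ (Q j)ᶜ) (fun s => A' s.succ ∩ (Q j)ᶜ)
        (fun s => ((P s).mono (hM s).1.2.1 subset_rfl subset_rfl).inGraph _ (hj s) (by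
          intro i hi x hx
          simp only [Set.mem_toFinset] at hi
          exact Set.disjoint_left.1 hi (by simpa [Linkage.mono] using hx))) with ⟨B, hB⟩ | ⟨R, hR, hRr⟩
      · exact .inl ⟨B, hB.mono inGraph_le⟩
      · right
        refine ⟨Fin.cons (Q j) fun s => R s ∩ (Q j)ᶜ, ?_, ?_⟩
        · have key : ∀ s, Disjoint (Q j) (R s ∩ (Q j)ᶜ) := fun s =>
            Set.disjoint_left.2 fun v hv hv' => hv'.2 hv
          intro s s' hss
          induction s using Fin.cases with
          | zero =>
            induction s' using Fin.cases with
            | zero => exact absurd rfl hss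
            | succ s' => exact key s'
          | succ s =>
            induction s' using Fin.cases with
            | zero => exact (key s).symm
            | succ s' =>
              exact (hR fun h => hss (congrArg Fin.succ h)).mono Set.inter_subset_left
                Set.inter_subset_left
        · intro s
          induction s using Fin.cases with
          | zero =>
            exact ⟨_, (L 0).src_mem j, _, (L 0).tgt_mem j, (L 0).walk j, fun _ h => h⟩
          | succ s =>
            obtain ⟨u, hu, v, hv, huv⟩ := hRr s
            refine ⟨u, hu.1, v, hv.1, ?_⟩
            exact huv.closed (P := fun z => ReachIn F (R s ∩ (Q j)ᶜ) u z)
              (.refl ⟨huv.left_mem, hu.2⟩) fun a b ha hab hb => ha.step hab.1 ⟨hb, hab.2.2⟩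
    · left
      push Not at hgood
      choose σ hσ using hgood
      obtain ⟨⟨s, I⟩, -, hJ⟩ := Finset.exists_le_card_fiber_of_mul_le_card_of_maps_to
        (s := (Finset.univ : Finset (Fin n)))
        (t := (Finset.univ : Finset (Fin N × Finset (Fin d))))
        (f := fun j => (σ j, {i | ¬ Disjoint {x | x ∈ ((P (σ j)).walk i).support} (Q j)}.toFinset))
        (n := m * (m * d + 1)) (fun _ _ => Finset.mem_univ _)
        ⟨(σ ⟨0, by omega⟩, ∅), Finset.mem_univ _⟩ (by simp; omega)
      set J := {j ∈ (Finset.univ : Finset (Fin n)) |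
        (σ j, {i | ¬ Disjoint {x | x ∈ ((P (σ j)).walk i).support} (Q j)}.toFinset) = (s, I)} with hJdef
      have hJmem : ∀ j ∈ J, σ j = s ∧ ∀ i, i ∈ I ↔ ∃ x ∈ ((P s).walk i).support, x ∈ Q j := by
        intro j hj
        simp only [hJdef, Finset.mem_filter, Prod.mk.injEq] at hj
        obtain ⟨-, rfl, rfl⟩ := hj
        refine ⟨rfl, fun i => ?_⟩
        simp [Set.not_disjoint_iff]
      have hI : (X + 1) * (X + 1) ^ (X + 1) < I.card := by
        obtain ⟨j, hj⟩ := Finset.card_pos.1 (lt_of_lt_of_le (by positivity) hJ)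
        obtain ⟨rfl, hjI⟩ := hJmem j hj
        have h1 := hσ j
        have h2 : {i | Disjoint {x | x ∈ ((P (σ j)).walk i).support} (Q j)}.toFinset = Iᶜ := by
          ext i
          simp only [Set.mem_toFinset, Finset.mem_compl, hjI]
          simp [Set.disjoint_left]
        rw [h2, Finset.card_compl, Fintype.card_fin] at h1
        omega
      obtain ⟨i₀, hi₀⟩ := Finset.card_pos.1 (show 0 < I.card by omega)
      have hQH : ∀ j, ConnIn H (Q j) := by
        intro j
        have hp : ∀ e ∈ ((L 0).walk j).edges, e ∈ H.edgeSet := by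
          intro e he
          induction e with
          | _ a b => exact ⟨j, Walk.adj_toSubgraph_iff_mem_edges.2 he⟩
        simpa [Q] using connIn_support (((L 0).walk j).transfer H hp)
      have hQc : ∀ j, ∀ a b, H.Adj a b → a ∈ Q j → b ∈ Q j := by
        intro j a b hab ha
        obtain ⟨i, hia, hib⟩ := (L 0).exists_of_graph_adj hab
        obtain rfl := (L 0).disj _ _ _ ha hia
        exact hib
      obtain ⟨g, hgJ, hg⟩ := (P s).exists_layers (hM s).1.1
        (fun M' h1 h2 h3 => h2.antisymm ((hM s).2 ⟨h1, h2.trans (hM s).1.2.1, h3⟩ h2)) Q J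
        (fun j _ => hQH j) (fun j _ => hQc j) (fun i _ j _ v hi hj => (L 0).disj i j v hi hj) i₀
        (fun j hj => ((hJmem j hj).2 i₀).1 hi₀) hmpos hJ
      have hginj : ∀ t t', t < t' → t' < m → g t ≠ g t' := by
        intro t t' htt ht' heq
        obtain ⟨x, hx, hxQ⟩ := ((hJmem _ (hgJ t' ht')).2 i₀).1 hi₀
        obtain ⟨k, rfl, hk⟩ := Walk.mem_support_iff_exists_getVert.1 hx
        exact lt_irrefl _ (hg t t' htt ht' i₀ k hk k hk (heq ▸ hxQ) hxQ)
      obtain ⟨B, hB⟩ := (P s).exists_isGrid (X := X) (Y := Y) I hI (fun t => Q (g t)) le_rfl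
        (fun t _ => (hQH _).mono (hM s).1.1)
        (fun t ht t' ht' v hv hv' => by
          have := (L 0).disj _ _ v hv hv'
          rcases lt_trichotomy t t' with h | h | h
          exacts [absurd this (hginj t t' h ht'), h, absurd this.symm (hginj t' t h ht)])
        hg (fun t ht i hi => ((hJmem _ (hgJ t ht)).2 i).1 hi)
      exact ⟨B, hB.mono (hM s).1.2.1⟩

end Dichotomy

section GridTheorem
variable {V : Type*} {G : SimpleGraph V}

theorem ConnIn.iUnion {ι : Type*} {C : Set V} {R : ι → Set V} (hC : ConnIn G C)
    (hCne : C.Nonempty) (hR : ∀ i, ConnIn G (R i))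
    (h : ∀ i, ∃ u ∈ R i, ∃ c ∈ C, G.Adj u c) : ConnIn G (C ∪ ⋃ i, R i) := by
  obtain ⟨c₀, hc₀⟩ := hCne
  refine ConnIn.of_center (u := c₀) ?_
  rintro v (hv | hv)
  · exact (hC c₀ hc₀ v hv).mono le_rfl Set.subset_union_left
  · obtain ⟨i, hi⟩ := Set.mem_iUnion.1 hv
    obtain ⟨u, hu, c, hc, huc⟩ := h i
    have := (hC.union (hR i) hc hu (.inr huc.symm)) c₀ (.inl hc₀) v (.inr hi)
    exact this.mono le_rfl (Set.union_subset_union_right _ (Set.subset_iUnion R i))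

/-- **Grid theorem**: graphs of large tree-width contain large grids. -/
theorem exists_isGrid_of_le_treewidth (X Y : ℕ) : ∃ k : ℕ, 0 < k ∧
    ∀ (V : Type u) [Finite V] (G : SimpleGraph V), k ≤ treewidth G → ∃ B, IsGrid G X Y B := by
  classical
  set m := (X + 1) * (Y + 1) with hm
  let ι := {p : Fin m × Fin m // p.1 < p.2}
  let e : ι ≃ Fin (Fintype.card ι) := Fintype.equivFin ι
  obtain ⟨n, hn, hdich⟩ := exists_disjoint_or_isGrid.{u} X Y (Fintype.card ι)
  refine ⟨3 * n * m + n, by omega, fun V _ G htw => ?_⟩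
  obtain ⟨C, D, hC, hCd, hL⟩ := exists_linked_sets m n (by positivity) hn htw
  rcases hdich V (inGraph G D) (fun s => attach G D (C (e.symm s).1.1))
    (fun s => attach G D (C (e.symm s).1.2)) (fun s => hL _ _ (e.symm s).2.ne) with ⟨B, hB⟩ | ⟨R, hRd, hR⟩
  · exact ⟨B, hB.mono inGraph_le⟩
  have hR' : ∀ p : ι, ∃ P : Set V, ConnIn G P ∧ P ⊆ R (e p) ∩ D ∧
      (∃ u ∈ P, ∃ c ∈ C p.1.1, G.Adj u c) ∧ ∃ u ∈ P, ∃ c ∈ C p.1.2, G.Adj u c := by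
    intro p
    obtain ⟨u, hu, v, hv, huv⟩ := hR (e p)
    rw [e.symm_apply_apply] at hu hv
    have huv' : ReachIn G (R (e p) ∩ D) u v :=
      huv.closed (P := fun z => ReachIn G (R (e p) ∩ D) u z) (.refl ⟨huv.left_mem, hu.1⟩)
        fun a b ha hab hb => ha.step hab.1 ⟨hb, hab.2.2⟩
    exact ⟨{z | ReachIn G (R (e p) ∩ D) u z}, connIn_reach, fun z hz => ReachIn.right_mem hz,
      ⟨u, .refl huv'.left_mem, hu.2⟩, ⟨v, huv', hv.2⟩⟩
  choose P hPc hPsub hP1 hP2 using hR'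
  let K : Fin m → Set V := fun i => C i ∪ ⋃ p : {p : ι // p.1.1 = i}, P p
  have hKc : ∀ i, ConnIn G (K i) := fun i => (hC i).2.1.iUnion (hC i).1 (fun p => hPc p) (by
    rintro ⟨p, rfl⟩
    exact hP1 p)
  have hPC : ∀ p i, Disjoint (P p) (C i) := fun p i =>
    (hC i).2.2.symm.mono_left fun v hv => (hPsub p hv).2
  have hKd : ∀ i j, ∀ v ∈ K i, v ∈ K j → i = j := by
    rintro i j v (hv | hv) (hv' | hv')
    · by_contra hij
      exact Set.disjoint_left.1 (hCd hij) hv hv'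
    · obtain ⟨p, hp⟩ := Set.mem_iUnion.1 hv'
      exact absurd hv (Set.disjoint_left.1 (hPC p i) hp)
    · obtain ⟨p, hp⟩ := Set.mem_iUnion.1 hv
      exact absurd hv' (Set.disjoint_left.1 (hPC p j) hp)
    · obtain ⟨⟨p, rfl⟩, hp⟩ := Set.mem_iUnion.1 hv
      obtain ⟨⟨q, rfl⟩, hq⟩ := Set.mem_iUnion.1 hv'
      by_cases hpq : p = q
      · rw [hpq]
      · exact absurd (hPsub q hq).1
          (Set.disjoint_left.1 (hRd fun h => hpq (e.injective h)) (hPsub p hp).1)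
  have hKadj : ∀ i j, i < j → ∃ u ∈ K i, ∃ v ∈ K j, G.Adj u v := by
    intro i j hij
    obtain ⟨u, hu, c, hc, huc⟩ := hP2 ⟨(i, j), hij⟩
    exact ⟨u, .inr (Set.mem_iUnion.2 ⟨⟨⟨(i, j), hij⟩, rfl⟩, hu⟩), c, .inl hc, huc⟩
  have hpos : 0 < m := by positivity
  let ν : ℕ → ℕ → Fin m := fun x y => ⟨(x * (Y + 1) + y) % m, Nat.mod_lt _ hpos⟩
  have hν : ∀ x ≤ X, ∀ y ≤ Y, (ν x y : ℕ) = x * (Y + 1) + y := by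
    intro x hx y hy
    have := Nat.mul_le_mul_right (Y + 1) (show x + 1 ≤ X + 1 by omega)
    exact Nat.mod_eq_of_lt (by rw [hm]; nlinarith)
  refine ⟨fun x y => K (ν x y), fun x _ y _ => hKc _, fun x _ y _ => (hC _).1.mono
    Set.subset_union_left, ?_, ?_, ?_⟩
  · intro x hx y hy x' hx' y' hy' v hv hv'
    have := congrArg Fin.val (hKd _ _ v hv hv')
    rw [hν x hx y hy, hν x' hx' y' hy'] at this
    have hxx : x = x' := by
      rcases lt_trichotomy x x' with h | h | h
      · have := Nat.mul_le_mul_right (Y + 1) (Nat.succ_le_of_lt h)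
        rw [Nat.succ_mul] at this
        omega
      · exact h
      · have := Nat.mul_le_mul_right (Y + 1) (Nat.succ_le_of_lt h)
        rw [Nat.succ_mul] at this
        omega
    subst hxx
    exact ⟨rfl, by omega⟩
  · intro x hx y hy
    refine hKadj _ _ (Fin.lt_def.2 ?_)
    rw [hν x hx.le y hy, hν (x + 1) hx y hy, Nat.succ_mul]
    omega
  · intro x hx y hy
    refine hKadj _ _ (Fin.lt_def.2 ?_)
    rw [hν x hx y hy.le, hν x hx (y + 1) hy]
    omega

end GridTheorem

section ShortCycles
variable {V : Type*} {G : SimpleGraph V} {u v w : V} {ℓ : Sym2 V → ℚ} {M : ℚ}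

@[simp] theorem walkLen_nil : walkLen ℓ (.nil : G.Walk u u) = 0 := rfl

@[simp] theorem walkLen_cons (h : G.Adj u v) (p : G.Walk v w) :
    walkLen ℓ (.cons h p) = ℓ s(u, v) + walkLen ℓ p := by
  simp [walkLen]

@[simp] theorem walkLen_append (p : G.Walk u v) (q : G.Walk v w) :
    walkLen ℓ (p.append q) = walkLen ℓ p + walkLen ℓ q := by
  simp [walkLen]

@[simp] theorem walkLen_reverse (p : G.Walk u v) : walkLen ℓ p.reverse = walkLen ℓ p := by
  simp [walkLen, List.sum_reverse]

theorem walkLen_le_of_sublist {a b c d : V} {p : G.Walk a b} {q : G.Walk c d}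
    (hℓ : ∀ e ∈ q.edges, 0 ≤ ℓ e) (h : p.edges.Sublist q.edges) : walkLen ℓ p ≤ walkLen ℓ q :=
  (h.map ℓ).sum_le_sum (by simpa using hℓ)

theorem walkLen_mono {ℓ' : Sym2 V → ℚ} (p : G.Walk u v) (h : ∀ e ∈ p.edges, ℓ e ≤ ℓ' e) :
    walkLen ℓ p ≤ walkLen ℓ' p :=
  List.sum_le_sum h

theorem walkLen_le_length_mul (p : G.Walk u v) (h : ∀ e ∈ p.edges, ℓ e ≤ M) :
    walkLen ℓ p ≤ p.length * M := by
  have := List.sum_le_card_nsmul (p.edges.map ℓ) M (by simpa using h)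
  simpa [walkLen] using this

/-- The mod-2 vector of edge multiplicities of a walk. -/
noncomputable def edgeVec (p : G.Walk u v) : Sym2 V → ZMod 2 :=
  open Classical in fun e => (p.edges.count e : ZMod 2)

@[simp] theorem edgeVec_nil : edgeVec (.nil : G.Walk u u) = 0 := by
  funext e; simp [edgeVec]

theorem edgeVec_cons (h : G.Adj u v) (p : G.Walk v w) :
    edgeVec (.cons h p) = edgeVec h.toWalk + edgeVec p := by
  funext e
  simp [edgeVec, List.count_cons, add_comm]

@[simp] theorem edgeVec_append (p : G.Walk u v) (q : G.Walk v w) :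
    edgeVec (p.append q) = edgeVec p + edgeVec q := by
  funext e; simp [edgeVec]

@[simp] theorem edgeVec_reverse (p : G.Walk u v) : edgeVec p.reverse = edgeVec p := by
  funext e; simp [edgeVec]

theorem edgeVec_add_self (f : Sym2 V → ZMod 2) : f + f = 0 := by
  funext e; exact CharTwo.add_self_eq_zero (f e)

theorem edgeVec_apply_of_isTrail {p : G.Walk u v} (hp : p.IsTrail) (e : Sym2 V) :
    edgeVec p e = open Classical in if e ∈ p.edges then 1 else 0 := by
  classical
  simp only [edgeVec]
  rw [hp.edges_nodup.count]
  split_ifs <;> simp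

/-- The span over `𝔽₂` of the cycles of length at most `M`. -/
def shortSpan (G : SimpleGraph V) (ℓ : Sym2 V → ℚ) (M : ℚ) : AddSubmonoid (Sym2 V → ZMod 2) :=
  .closure {f | ∃ (u : V) (c : G.Walk u u), c.IsCycle ∧ walkLen ℓ c ≤ M ∧ edgeVec c = f}

theorem SimpleGraph.Walk.IsPath.eq_toWalk_of_mem_edges {p : G.Walk v u} (hp : p.IsPath)
    (h : G.Adj u v) (he : s(u, v) ∈ p.edges) : p = h.symm.toWalk := by
  cases p with
  | nil => exact absurd h (G.loopless.irrefl _)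
  | @cons _ x _ h' q =>
    rw [Walk.edges_cons, List.mem_cons] at he
    rw [Walk.cons_isPath_iff] at hp
    rcases he with he | he
    · have : u = x := by
        rcases Sym2.eq_iff.1 he with ⟨h1, -⟩ | ⟨h1, -⟩
        · exact absurd (h1 ▸ h) (G.loopless.irrefl _)
        · exact h1
      subst this
      rw [(Walk.isPath_iff_nil.1 hp.1).eq_nil]
    · exact absurd (Walk.snd_mem_support_of_mem_edges _ he) hp.2

theorem edgeVec_add_bypass_mem [DecidableEq V] (hℓ : ∀ e ∈ G.edgeSet, 0 ≤ ℓ e)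
    (p : G.Walk u v) (hp : walkLen ℓ p ≤ M) :
    edgeVec p + edgeVec p.bypass ∈ shortSpan G ℓ M := by
  induction p with
  | nil => simp [Walk.bypass, zero_mem]
  | @cons a b c h p ih =>
    rw [walkLen_cons] at hp
    have h0 := hℓ s(a, b) h
    have ih := ih (by linarith)
    have hle : walkLen ℓ p.bypass ≤ walkLen ℓ p :=
      walkLen_le_of_sublist (fun e he => hℓ e (p.edges_subset_edgeSet he))
        p.edges_bypass_sublist_edges
    rw [edgeVec_cons h p, Walk.bypass]
    split_ifs with hs
    · have hsplit : edgeVec p.bypass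
          = edgeVec (p.bypass.takeUntil a hs) + edgeVec (p.bypass.dropUntil a hs) := by
        rw [← edgeVec_append, Walk.take_spec]
      have key : edgeVec h.toWalk + edgeVec p + edgeVec (p.bypass.dropUntil a hs)
          = (edgeVec p + edgeVec p.bypass)
            + edgeVec (.cons h (p.bypass.takeUntil a hs)) := by
        rw [edgeVec_cons h (p.bypass.takeUntil a hs), hsplit]
        have := edgeVec_add_self (edgeVec (p.bypass.takeUntil a hs))
        calc _ = edgeVec h.toWalk + edgeVec p + edgeVec (p.bypass.dropUntil a hs) + 0 := by simp
          _ = _ := by rw [← this]; abel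
      rw [key]
      refine add_mem ih ?_
      have hpath := p.bypass_isPath.takeUntil hs
      by_cases he : s(a, b) ∈ (p.bypass.takeUntil a hs).edges
      · have heq := hpath.eq_toWalk_of_mem_edges h he
        have : edgeVec h.symm.toWalk = edgeVec h.toWalk := by
          rw [← edgeVec_reverse]; congr 1
        rw [edgeVec_cons h (p.bypass.takeUntil a hs), heq, this, edgeVec_add_self]
        exact zero_mem _
      · refine AddSubmonoid.subset_closure ⟨a, _, (Walk.cons_isCycle_iff _ _).2 ⟨hpath, he⟩, ?_, rfl⟩
        have : walkLen ℓ (p.bypass.takeUntil a hs) ≤ walkLen ℓ p.bypass := by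
          refine walkLen_le_of_sublist (fun e he => hℓ e (Walk.edges_subset_edgeSet _ he)) ?_
          exact (Walk.edges_takeUntil_prefix_edges _ hs).sublist
        rw [walkLen_cons]
        linarith
    · have key : edgeVec h.toWalk + edgeVec p + edgeVec (.cons h p.bypass)
          = edgeVec p + edgeVec p.bypass := by
        rw [edgeVec_cons h p.bypass]
        have := edgeVec_add_self (edgeVec h.toWalk)
        calc _ = (edgeVec h.toWalk + edgeVec h.toWalk) + (edgeVec p + edgeVec p.bypass) := by abel
          _ = _ := by rw [this, zero_add]
      rw [key]
      exact ih

/-- Short closed walks lie in the span of the short cycles. -/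
theorem edgeVec_mem_shortSpan (hℓ : ∀ e ∈ G.edgeSet, 0 ≤ ℓ e) (p : G.Walk u u)
    (hp : walkLen ℓ p ≤ M) : edgeVec p ∈ shortSpan G ℓ M := by
  classical
  have := edgeVec_add_bypass_mem hℓ p hp
  rwa [(Walk.isPath_iff_nil.1 p.bypass_isPath).eq_nil, edgeVec_nil, add_zero] at this

/-- A cycle in the span is the `𝔽₂`-sum of a finite family of short cycles. -/
theorem exists_family_of_mem_shortSpan {V : Type} {G : SimpleGraph V} {u : V} {ℓ : Sym2 V → ℚ}
    {c : G.Walk u u} (hc : c.IsCycle)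
    (h : edgeVec c ∈ shortSpan G ℓ M) :
    ∃ (ι : Type) (_ : Fintype ι) (u : ι → V) (D : ∀ i, G.Walk (u i) (u i)),
      (∀ i, (D i).IsCycle) ∧ (∀ i, walkLen ℓ (D i) ≤ M) ∧
        ∀ e : Sym2 V, e ∈ c.edges ↔ Odd {i : ι | e ∈ (D i).edges}.ncard := by
  classical
  obtain ⟨l, hl, hsum⟩ := AddSubmonoid.exists_list_of_mem_closure h
  have hl' : ∀ i : Fin l.length, ∃ (u : V) (c : G.Walk u u),
      c.IsCycle ∧ walkLen ℓ c ≤ M ∧ edgeVec c = l[i] := fun i => hl _ (List.getElem_mem _)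
  choose x D hD hlen hvec using hl'
  refine ⟨Fin l.length, inferInstance, x, D, hD, hlen, fun e => ?_⟩
  have h1 : edgeVec c e = ∑ i, edgeVec (D i) e := by
    rw [← hsum, ← Fin.sum_univ_getElem l, Finset.sum_apply]
    simp [hvec]
  rw [edgeVec_apply_of_isTrail hc.isTrail] at h1
  simp only [edgeVec_apply_of_isTrail (hD _).isTrail] at h1
  rw [Finset.sum_ite, Finset.sum_const_zero, add_zero, Finset.sum_const, nsmul_one] at h1
  rw [Set.ncard_eq_toFinset_card', ← ZMod.natCast_eq_one_iff_odd]
  simp only [Set.toFinset_ofPred]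
  rw [← h1]
  simp

end ShortCycles

section Hops
variable {V : Type*} {G : SimpleGraph V} {S T : Set V} {b b' u v w : V} {ℓ : Sym2 V → ℚ} {M ε : ℚ}
  {σ : Sym2 V → ZMod 2}

theorem SimpleGraph.Walk.IsPath.append_cons {x y : V} {p : G.Walk u x} {q : G.Walk y v}
    (hp : p.IsPath) (hq : q.IsPath) (h : G.Adj x y) (hd : ∀ z ∈ p.support, z ∉ q.support) :
    (p.append (.cons h q)).IsPath := by
  rw [Walk.isPath_def, Walk.support_append, Walk.support_cons, List.tail_cons]
  exact hp.support_nodup.append hq.support_nodup fun z hz hz' => hd z hz hz'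

/-- `σ` is the edge vector of a walk from `b` to `b'` inside `S ∪ T` that crosses once
from `S` to `T`. -/
def HopVec (G : SimpleGraph V) (S T : Set V) (b b' : V) (σ : Sym2 V → ZMod 2) : Prop :=
  ∃ (x y : V) (h : G.Adj x y) (p : G.Walk b x) (q : G.Walk y b'), p.IsPath ∧ q.IsPath ∧
    (∀ z ∈ p.support, z ∈ S) ∧ (∀ z ∈ q.support, z ∈ T) ∧
    σ = edgeVec p + edgeVec h.toWalk + edgeVec q

theorem exists_hopVec (hS : ConnIn G S) (hT : ConnIn G T) (hb : b ∈ S) (hb' : b' ∈ T)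
    (h : ∃ x ∈ S, ∃ y ∈ T, G.Adj x y) : ∃ σ, HopVec G S T b b' σ := by
  obtain ⟨x, hx, y, hy, h⟩ := h
  obtain ⟨p, hp, hpS⟩ := (hS b hb x hx).exists_isPath
  obtain ⟨q, hq, hqT⟩ := (hT y hy b' hb').exists_isPath
  exact ⟨_, x, y, h, p, q, hp, hq, hpS, hqT, rfl⟩

theorem HopVec.symm (h : HopVec G S T b b' σ) : HopVec G T S b' b σ := by
  obtain ⟨x, y, h, p, q, hp, hq, hpS, hqT, rfl⟩ := h
  refine ⟨y, x, h.symm, q.reverse, p.reverse, hq.reverse, hp.reverse, by simpa, by simpa, ?_⟩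
  have : edgeVec h.symm.toWalk = edgeVec h.toWalk := by
    rw [← edgeVec_reverse]; congr 1
  rw [edgeVec_reverse, edgeVec_reverse, this]
  abel

theorem walkLen_le_of_inside [Fintype V] {p : G.Walk u v} (hp : p.IsPath)
    (hpS : ∀ z ∈ p.support, z ∈ S) (hε0 : 0 ≤ ε)
    (hε : ∀ x ∈ S, ∀ y ∈ S, G.Adj x y → ℓ s(x, y) ≤ ε) : walkLen ℓ p ≤ Fintype.card V * ε := by
  refine (walkLen_le_length_mul p (M := ε) fun e he => ?_).trans ?_
  · induction e with | _ x y
    exact hε x (hpS x (p.fst_mem_support_of_mem_edges he)) y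
      (hpS y (p.snd_mem_support_of_mem_edges he)) (p.adj_of_mem_edges he)
  · have : (p.length : ℚ) ≤ Fintype.card V := by exact_mod_cast hp.length_lt.le
    gcongr

theorem HopVec.exists_walk [Fintype V] {c : ℚ} (h : HopVec G S T b b' σ) (hε0 : 0 ≤ ε)
    (hS : ∀ x ∈ S, ∀ y ∈ S, G.Adj x y → ℓ s(x, y) ≤ ε)
    (hT : ∀ x ∈ T, ∀ y ∈ T, G.Adj x y → ℓ s(x, y) ≤ ε)
    (hST : ∀ x ∈ S, ∀ y ∈ T, G.Adj x y → ℓ s(x, y) ≤ c) :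
    ∃ p : G.Walk b b', edgeVec p = σ ∧ walkLen ℓ p ≤ c + 2 * (Fintype.card V * ε) := by
  obtain ⟨x, y, h, p, q, hp, hq, hpS, hqT, rfl⟩ := h
  refine ⟨p.append (.cons h q), ?_, ?_⟩
  · rw [edgeVec_append, edgeVec_cons h q, add_assoc]
  · have h1 := walkLen_le_of_inside hp hpS hε0 hS
    have h2 := walkLen_le_of_inside hq hqT hε0 hT
    have h3 := hST x (hpS x p.end_mem_support) y (hqT y q.start_mem_support) h
    rw [walkLen_append, walkLen_cons]
    linarith

/-- A path through consecutive connected sets whose edge vector agrees, modulo short cycles,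
with the sum of the hops. -/
theorem exists_path_through [Fintype V] {A : ℕ → Set V} {bs : ℕ → V} {σ : ℕ → Sym2 V → ZMod 2}
    (hℓ : ∀ e ∈ G.edgeSet, 0 ≤ ℓ e) (hε0 : 0 ≤ ε) (hεM : 3 * (Fintype.card V * ε) ≤ M) {u : V}
    {r₀ : G.Walk u (bs 0)} (hr₀ : r₀.IsPath) (hr₀A : ∀ z ∈ r₀.support, z ∈ A 0) (n : ℕ)
    (hconn : ∀ s ≤ n, ConnIn G (A s))
    (hdisj : ∀ s ≤ n, ∀ t ≤ n, ∀ v ∈ A s, v ∈ A t → s = t)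
    (hε : ∀ s ≤ n, ∀ x ∈ A s, ∀ y ∈ A s, G.Adj x y → ℓ s(x, y) ≤ ε)
    (hop : ∀ s < n, HopVec G (A s) (A (s + 1)) (bs s) (bs (s + 1)) (σ s)) {e : V}
    (r : G.Walk (bs n) e) (hr : r.IsPath) (hrA : ∀ z ∈ r.support, z ∈ A n) :
    ∃ p : G.Walk u e, p.IsPath ∧ (∀ z ∈ p.support, ∃ s ≤ n, z ∈ A s) ∧
      (∀ d ∈ p.darts, ∃ s ≤ n, d.fst ∈ A s ∧ (d.snd ∈ A s ∨ s < n ∧ d.snd ∈ A (s + 1))) ∧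
      edgeVec r₀ + edgeVec p + ∑ s ∈ Finset.range n, σ s + edgeVec r ∈ shortSpan G ℓ M := by
  induction n generalizing e with
  | zero =>
    obtain ⟨p, hp, hpA⟩ := (hconn 0 le_rfl u (hr₀A u r₀.start_mem_support) e
      (hrA e r.end_mem_support)).exists_isPath
    refine ⟨p, hp, fun z hz => ⟨0, le_rfl, hpA z hz⟩, fun d hd => ⟨0, le_rfl,
      hpA _ (p.dart_fst_mem_support_of_mem_darts hd),
      .inl (hpA _ (p.dart_snd_mem_support_of_mem_darts hd))⟩, ?_⟩
    have h1 := walkLen_le_of_inside hr₀ hr₀A hε0 (hε 0 le_rfl)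
    have h2 := walkLen_le_of_inside hr hrA hε0 (hε 0 le_rfl)
    have h3 := walkLen_le_of_inside hp hpA hε0 (hε 0 le_rfl)
    have := edgeVec_mem_shortSpan (M := M) hℓ ((r₀.append r).append p.reverse) (by
      simp only [walkLen_append, walkLen_reverse]; linarith)
    convert this using 1
    simp only [edgeVec_append, edgeVec_reverse, Finset.range_zero, Finset.sum_empty]
    abel
  | succ n ih =>
    obtain ⟨x, y, h, p₁, p₂, hp₁, hp₂, hp₁A, hp₂A, hσ⟩ := hop n n.lt_succ_self
    obtain ⟨p, hp, hpA, hpd, hpv⟩ := ih (fun s hs => hconn s (by omega))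
      (fun s hs t ht => hdisj s (by omega) t (by omega)) (fun s hs => hε s (by omega))
      (fun s hs => hop s (by omega)) p₁ hp₁ hp₁A
    have hy : y ∈ A (n + 1) := hp₂A y p₂.start_mem_support
    obtain ⟨q, hq, hqA⟩ := (hconn (n + 1) le_rfl y hy e (hrA e r.end_mem_support)).exists_isPath
    refine ⟨p.append (.cons h q), hp.append_cons hq h fun z hz hz' => ?_, fun z hz => ?_,
      fun d hd => ?_, ?_⟩
    · obtain ⟨s, hs, hzs⟩ := hpA z hz
      have := hdisj s (by omega) (n + 1) le_rfl z hzs (hqA z hz')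
      omega
    · rw [Walk.support_append, Walk.support_cons, List.tail_cons, List.mem_append] at hz
      rcases hz with hz | hz
      · obtain ⟨s, hs, hzs⟩ := hpA z hz
        exact ⟨s, by omega, hzs⟩
      · exact ⟨n + 1, le_rfl, hqA z hz⟩
    · rw [Walk.darts_append, Walk.darts_cons, List.mem_append, List.mem_cons] at hd
      rcases hd with hd | rfl | hd
      · obtain ⟨s, hs, h1, h2⟩ := hpd d hd
        exact ⟨s, by omega, h1, h2.imp_right fun h2 => ⟨by omega, h2.2⟩⟩
      · exact ⟨n, by omega, hp₁A _ p₁.end_mem_support, .inr ⟨by omega, hy⟩⟩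
      · exact ⟨n + 1, le_rfl, hqA _ (q.dart_fst_mem_support_of_mem_darts hd),
          .inl (hqA _ (q.dart_snd_mem_support_of_mem_darts hd))⟩
    · have hε' := hε (n + 1) le_rfl
      have h1 := walkLen_le_of_inside hp₂ hp₂A hε0 hε'
      have h2 := walkLen_le_of_inside hr hrA hε0 hε'
      have h3 := walkLen_le_of_inside hq hqA hε0 hε'
      have hcl := edgeVec_mem_shortSpan (M := M) hℓ ((p₂.append r).append q.reverse) (by
        simp only [walkLen_append, walkLen_reverse]; linarith)
      have := add_mem hpv hcl
      convert this using 1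
      rw [Finset.sum_range_succ, hσ, edgeVec_append, edgeVec_cons h q]
      simp only [edgeVec_append, edgeVec_reverse]
      have := edgeVec_add_self (edgeVec h.toWalk)
      calc _ = (edgeVec h.toWalk + edgeVec h.toWalk) + (edgeVec r₀ + edgeVec p
            + ∑ s ∈ Finset.range n, σ s + edgeVec p₁ + (edgeVec p₂ + edgeVec r + edgeVec q)) := by
              abel
        _ = _ := by rw [this, zero_add]

/-- A cycle through a cyclic sequence of disjoint connected sets whose edge vector agrees,
modulo short cycles, with the sum of the hops. -/
theorem exists_cycle_through [Fintype V] {A : ℕ → Set V} {bs : ℕ → V}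
    {σ : ℕ → Sym2 V → ZMod 2} (hℓ : ∀ e ∈ G.edgeSet, 0 ≤ ℓ e) (hε0 : 0 ≤ ε)
    (hεM : 3 * (Fintype.card V * ε) ≤ M) {n : ℕ} (hn : 2 ≤ n)
    (hconn : ∀ s ≤ n, ConnIn G (A s))
    (hdisj : ∀ s ≤ n, ∀ t ≤ n, ∀ v ∈ A s, v ∈ A t → s = t)
    (hε : ∀ s ≤ n, ∀ x ∈ A s, ∀ y ∈ A s, G.Adj x y → ℓ s(x, y) ≤ ε)
    (hA : A (n + 1) = A 0) (hbs : bs (n + 1) = bs 0)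
    (hop : ∀ s ≤ n, HopVec G (A s) (A (s + 1)) (bs s) (bs (s + 1)) (σ s)) :
    ∃ (u v : V) (h : G.Adj v u) (p : G.Walk u v), u ∈ A 0 ∧ v ∈ A n ∧
      (Walk.cons h p).IsCycle ∧ (∀ z ∈ p.support, ∃ s ≤ n, z ∈ A s) ∧
      (∀ d ∈ p.darts, ∃ s ≤ n, d.fst ∈ A s ∧ (d.snd ∈ A s ∨ s < n ∧ d.snd ∈ A (s + 1))) ∧
      edgeVec (.cons h p) + ∑ s ∈ Finset.range (n + 1), σ s ∈ shortSpan G ℓ M := by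
  have hlast := hop n le_rfl
  rw [hA, hbs] at hlast
  obtain ⟨v, u, h, r, r₀, hr, hr₀, hrA, hr₀A, hσ⟩ := hlast
  obtain ⟨p, hp, hpA, hpd, hpv⟩ := exists_path_through hℓ hε0 hεM hr₀ hr₀A n hconn hdisj hε
    (fun s hs => hop s hs.le) r hr hrA
  have hu : u ∈ A 0 := hr₀A u r₀.start_mem_support
  have hv : v ∈ A n := hrA v r.end_mem_support
  refine ⟨u, v, h, p, hu, hv, (Walk.cons_isCycle_iff _ _).2 ⟨hp, fun he => ?_⟩, hpA, hpd, ?_⟩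
  · obtain ⟨d, hd, hde⟩ := List.mem_map.1 he
    obtain ⟨s, hs, h1, h2⟩ := hpd d hd
    have hd' : (d.fst = v ∧ d.snd = u) ∨ (d.fst = u ∧ d.snd = v) := by
      have : s(d.fst, d.snd) = s(v, u) := hde
      exact Sym2.eq_iff.1 this
    rcases hd' with ⟨h3, h4⟩ | ⟨h3, h4⟩ <;> rw [h3] at h1 <;> rw [h4] at h2
    · have := hdisj s hs n le_rfl v h1 hv
      rcases h2 with h2 | ⟨h2, -⟩
      · have := hdisj s hs 0 (by omega) u h2 hu
        omega
      · omega
    · have := hdisj s hs 0 (by omega) u h1 hu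
      rcases h2 with h2 | ⟨h2, h5⟩
      · have := hdisj s hs n le_rfl v h2 hv
        omega
      · have := hdisj (s + 1) h2 n le_rfl v h5 hv
        omega
  · convert hpv using 1
    rw [Finset.sum_range_succ, hσ, edgeVec_cons h p]
    have := edgeVec_add_self (edgeVec h.toWalk)
    calc _ = (edgeVec h.toWalk + edgeVec h.toWalk) + (edgeVec r₀ + edgeVec p
            + ∑ s ∈ Finset.range n, σ s + edgeVec r) := by abel
      _ = _ := by rw [this, zero_add]

end Hops

section Potential
variable {V : Type*} {G : SimpleGraph V} {u v : V} {g : Sym2 V → ℚ} {θ : V → ℚ} {T : ℚ}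

theorem walkLen_le_of_darts {a b : V} (p : G.Walk a b)
    (h : ∀ d ∈ p.darts, g d.edge ≤ θ d.snd - θ d.fst) : walkLen g p ≤ θ b - θ a := by
  induction p with
  | nil => simp
  | @cons a b c hadj p ih =>
    rw [Walk.darts_cons] at h
    have h1 : g s(a, b) ≤ θ b - θ a := h _ (List.mem_cons_self ..)
    have := ih fun d hd => h d (List.mem_cons_of_mem _ hd)
    rw [walkLen_cons]
    linarith

theorem le_walkLen_of_darts {a b : V} (p : G.Walk a b)
    (h : ∀ d ∈ p.darts, θ d.snd - θ d.fst ≤ g d.edge) : θ b - θ a ≤ walkLen g p := by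
  induction p with
  | nil => simp
  | @cons a b c hadj p ih =>
    rw [Walk.darts_cons] at h
    have h1 : θ b - θ a ≤ g s(a, b) := h _ (List.mem_cons_self ..)
    have := ih fun d hd => h d (List.mem_cons_of_mem _ hd)
    rw [walkLen_cons]
    linarith

theorem walkLen_nonneg (hg : ∀ e, 0 ≤ g e) {a b : V} (p : G.Walk a b) : 0 ≤ walkLen g p :=
  List.sum_nonneg (by simpa using fun e _ => hg e)

/-- Two vertices of a cycle are joined by two arcs, whose lengths are controlled by a height
function that increases by `T` around the cycle. -/
theorem exists_arcs (hg : ∀ e, 0 ≤ g e) {h : G.Adj v u} {p : G.Walk u v}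
    (hp : ∀ d ∈ p.darts, g d.edge ≤ θ d.snd - θ d.fst)
    (hclose : g s(v, u) ≤ T - (θ v - θ u)) {a b : V} (ha : a ∈ p.support) (hb : b ∈ p.support) :
    ∃ q : G.Walk a b, (∀ e ∈ q.edges, e ∈ (Walk.cons h p).edges) ∧
      walkLen g q ≤ min |θ a - θ b| (T - |θ a - θ b|) := by
  wlog hab : ∃ (p₁ : G.Walk u a) (p₂ : G.Walk a b) (p₃ : G.Walk b v),
      p = p₁.append (p₂.append p₃) generalizing a b
  · obtain ⟨q, r, hqr⟩ := Walk.mem_support_iff_exists_append.1 ha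
    have hb' := hb
    rw [hqr, Walk.mem_support_append_iff] at hb'
    rcases hb' with hb' | hb'
    · obtain ⟨q₁, q₂, rfl⟩ := Walk.mem_support_iff_exists_append.1 hb'
      obtain ⟨w, hw, hwl⟩ := this hb ha ⟨q₁, q₂, r, by rw [hqr, Walk.append_assoc]⟩
      refine ⟨w.reverse, by simpa using hw, ?_⟩
      rwa [walkLen_reverse, abs_sub_comm]
    · obtain ⟨r₁, r₂, rfl⟩ := Walk.mem_support_iff_exists_append.1 hb'
      exact absurd ⟨q, r₁, r₂, hqr⟩ hab
  obtain ⟨p₁, p₂, p₃, rfl⟩ := hab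
  simp only [Walk.darts_append, List.mem_append] at hp
  have h1 := walkLen_le_of_darts p₁ fun d hd => hp d (.inl hd)
  have h2 := walkLen_le_of_darts p₂ fun d hd => hp d (.inr (.inl hd))
  have h3 := walkLen_le_of_darts p₃ fun d hd => hp d (.inr (.inr hd))
  have h2' := (walkLen_nonneg hg p₂).trans h2
  have habs : |θ a - θ b| = θ b - θ a := by rw [abs_sub_comm, abs_of_nonneg h2']
  rw [habs]
  rcases le_total (θ b - θ a) (T - (θ b - θ a)) with hle | hle
  · rw [min_eq_left hle]
    exact ⟨p₂, fun e he => by simp [he], h2⟩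
  · rw [min_eq_right hle]
    refine ⟨p₁.reverse.append (.cons h.symm p₃.reverse), fun e he => ?_, ?_⟩
    · simp only [Walk.edges_append, Walk.edges_cons, Walk.edges_reverse, List.mem_append,
        List.mem_cons, List.mem_reverse] at he ⊢
      rcases he with he | rfl | he
      exacts [.inr (.inl he), .inl Sym2.eq_swap, .inr (.inr (.inr he))]
    · rw [walkLen_append, walkLen_cons, walkLen_reverse, walkLen_reverse, Sym2.eq_swap]
      linarith

theorem length_le_of_edges_subset {a b c d : V} {p : G.Walk a b} {q : G.Walk c d} (hp : p.IsPath)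
    (h : ∀ e ∈ p.edges, e ∈ q.edges) : p.length ≤ q.length := by
  have := (hp.isTrail.edges_nodup.subperm h).length_le
  simpa using this

open Classical in
/-- The length function obtained from `g` by adding `τ` on the edges of `c` and `δ` elsewhere. -/
noncomputable def perturb (g : Sym2 V → ℚ) (τ δ : ℚ) {w : V} (c : G.Walk w w) (e : Sym2 V) : ℚ :=
  g e + if e ∈ c.edges then τ else δ

theorem walkLen_perturb {τ δ : ℚ} {w a b : V} (c : G.Walk w w) (q : G.Walk a b) :
    walkLen (perturb g τ δ c) q =
      walkLen g q + (open Classical in walkLen (fun e => if e ∈ c.edges then τ else δ) q) := by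
  simp only [walkLen, ← List.sum_map_add]
  rfl

/-- A cycle along which potentials detect the cyclic distance is geodesic after perturbation. -/
theorem isGeodesic_perturb [Finite V] (hg : ∀ e, 0 ≤ g e) {h : G.Adj v u} {p : G.Walk u v}
    (hp : ∀ d ∈ p.darts, g d.edge ≤ θ d.snd - θ d.fst)
    (hclose : g s(v, u) ≤ T - (θ v - θ u)) (F : V → V → ℚ)
    (hF : ∀ a x y, G.Adj x y → F a y - F a x ≤ g s(x, y))
    (hlow : ∀ a ∈ p.support, ∀ b ∈ p.support,
      min |θ a - θ b| (T - |θ a - θ b|) ≤ F a b - F a a) {τ δ : ℚ} (hτ : 0 ≤ τ)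
    (hδ : (p.length + 1) * τ ≤ δ) :
    IsGeodesic (perturb g τ δ (Walk.cons h p)) (Walk.cons h p) := by
  classical
  intro a ha b hb
  have hsupp : ∀ z ∈ (Walk.cons h p).support, z ∈ p.support := fun z hz => by
    rw [Walk.support_cons, List.mem_cons] at hz
    rcases hz with rfl | hz
    exacts [p.end_mem_support, hz]
  replace ha := hsupp a ha
  replace hb := hsupp b hb
  have hδ0 : 0 ≤ δ := le_trans (by positivity) hδ
  obtain ⟨w, hw, hwl⟩ := exists_arcs (h := h) hg hp hclose ha hb
  set c := Walk.cons h p with hc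
  have hwb : ∀ e ∈ w.bypass.edges, e ∈ c.edges := fun e he =>
    hw e (w.edges_bypass_subset_edges he)
  have : Fintype V := .ofFinite V
  obtain ⟨q₀, hq₀, hmin⟩ := Set.exists_min_image
    {q : G.Path a b | ∀ e ∈ (q : G.Walk a b).edges, e ∈ c.edges}
    (fun q => walkLen (perturb g τ δ c) (q : G.Walk a b)) (Set.toFinite _)
    ⟨⟨w.bypass, w.bypass_isPath⟩, hwb⟩
  refine ⟨q₀, q₀.2, hq₀, fun q hq => ?_⟩
  by_cases hqc : ∀ e ∈ q.edges, e ∈ c.edges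
  · exact hmin ⟨q, hq⟩ hqc
  · push Not at hqc
    obtain ⟨e, he, hec⟩ := hqc
    have hF' := le_walkLen_of_darts q fun d _ => hF a _ _ d.adj
    have hl := hlow a ha b hb
    have hind : δ ≤ walkLen (fun e => if e ∈ c.edges then τ else δ) q := by
      have := List.single_le_sum (l := q.edges.map fun e => if e ∈ c.edges then τ else δ)
        (by
          intro x hx
          obtain ⟨e, -, rfl⟩ := List.mem_map.1 hx
          split_ifs <;> assumption) δ (List.mem_map.2 ⟨e, he, by simp [hec]⟩)
      exact this
    have h0 := hmin ⟨w.bypass, w.bypass_isPath⟩ hwb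
    have h1 : walkLen g w.bypass ≤ walkLen g w :=
      walkLen_le_of_sublist (fun e _ => hg e) w.edges_bypass_sublist_edges
    have h2 : walkLen (fun e => if e ∈ c.edges then τ else δ) w.bypass ≤ δ := by
      refine le_trans (walkLen_le_length_mul _ (M := τ) fun e he => by simp [hwb e he]) ?_
      have h3 : (w.bypass.length : ℚ) ≤ p.length + 1 := by
        exact_mod_cast length_le_of_edges_subset w.bypass_isPath hwb
      exact le_trans (by gcongr) hδ
    dsimp only at h0
    rw [walkLen_perturb c w.bypass] at h0
    rw [walkLen_perturb c q]
    linarith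

end Potential

section GridPotential

/-- The height of a grid position: a cyclic coordinate modulo `2 * m` around the grid. -/
def gridHeight (m x y : ℕ) : ℤ :=
  if (y = 0 ∧ 0 < x) ∨ m ≤ x then 2 * m - max 0 (min ((y : ℤ) - m) m)
  else max 0 (min ((y : ℤ) - m) m)

/-- The distance of a grid position from the boundary of the grid. -/
def gridDepth (m x y : ℕ) : ℤ := min (min x (2 * m - x)) (min y (3 * m - y))

/-- The cyclic distance modulo `2 * m`. -/
def cycDist (m : ℕ) (a b : ℤ) : ℤ := min (max (a - b) (b - a)) (2 * m - max (a - b) (b - a))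

/-- The potential of a grid position with respect to the height `s`. -/
def gridPot (m : ℕ) (s : ℤ) (x y : ℕ) : ℤ :=
  (m - gridDepth m x y) * cycDist m (gridHeight m x y) s

variable {m x y : ℕ} {s : ℤ}

theorem gridHeight_mem (m x y : ℕ) : 0 ≤ gridHeight m x y ∧ gridHeight m x y ≤ 2 * m := by
  unfold gridHeight
  split_ifs <;> omega

theorem cycDist_mem {a : ℤ} (ha : 0 ≤ a ∧ a ≤ 2 * m) (hs : 0 ≤ s ∧ s ≤ 2 * m) :
    0 ≤ cycDist m a s ∧ cycDist m a s ≤ m := by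
  unfold cycDist
  omega

theorem gridDepth_mem (hx : x ≤ 2 * m) (hy : y ≤ 3 * m) :
    0 ≤ gridDepth m x y ∧ gridDepth m x y ≤ m := by
  unfold gridDepth
  omega

theorem abs_mul_sub_mul_le {M p p' k k' : ℤ} (hp : 0 ≤ p ∧ p ≤ M)
    (hk' : 0 ≤ k' ∧ k' ≤ M) (hpp : |p' - p| ≤ 1) (hkk : |k' - k| ≤ 1) :
    |p' * k' - p * k| ≤ 2 * M := by
  have h : p' * k' - p * k = (p' - p) * k' + p * (k' - k) := by ring
  have h1 : |(p' - p) * k'| ≤ M := by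
    rw [abs_mul, abs_of_nonneg hk'.1]
    nlinarith [abs_nonneg (p' - p)]
  have h2 : |p * (k' - k)| ≤ M := by
    rw [abs_mul, abs_of_nonneg hp.1]
    nlinarith [abs_nonneg (k' - k)]
  rw [h]
  linarith [abs_add_le ((p' - p) * k') (p * (k' - k))]

theorem gridPot_horiz (hm : 1 ≤ m) (hs : 0 ≤ s ∧ s ≤ 2 * m) (hx : x < 2 * m) (hy : y ≤ 3 * m) :
    |gridPot m s (x + 1) y - gridPot m s x y| ≤ 2 * m := by
  have hd := gridDepth_mem (m := m) hx.le hy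
  have hk := cycDist_mem (gridHeight_mem m x y) hs
  have hk' := cycDist_mem (gridHeight_mem m (x + 1) y) hs
  by_cases hc : gridDepth m (x + 1) y = m ∧ gridDepth m x y = m - 1
  · unfold gridPot
    rw [hc.1, hc.2, sub_self, zero_mul, zero_sub, abs_neg, sub_sub_cancel, one_mul,
      abs_of_nonneg hk.1]
    omega
  · refine abs_mul_sub_mul_le ⟨by omega, by omega⟩ hk' ?_ ?_
    · rw [abs_le]
      unfold gridDepth
      omega
    · rw [abs_le]
      unfold gridDepth at hc
      unfold cycDist gridHeight
      split_ifs <;> omega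

theorem gridPot_vert (hm : 1 ≤ m) (hs : 0 ≤ s ∧ s ≤ 2 * m) (hx : x ≤ 2 * m) (hy : y < 3 * m) :
    |gridPot m s x (y + 1) - gridPot m s x y| ≤ 2 * m := by
  have hd := gridDepth_mem (m := m) hx hy.le
  have hk' := cycDist_mem (gridHeight_mem m x (y + 1)) hs
  refine abs_mul_sub_mul_le ⟨by omega, by omega⟩ hk' ?_ ?_
  · rw [abs_le]
    unfold gridDepth
    omega
  · have h := gridHeight_mem m x y
    have h' := gridHeight_mem m x (y + 1)
    have hstep : (gridHeight m x (y + 1) ≤ gridHeight m x y + 1 ∧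
        gridHeight m x y ≤ gridHeight m x (y + 1) + 1) ∨
        gridHeight m x y = 2 * m ∧ gridHeight m x (y + 1) = 0 := by
      simp only [gridHeight, max_def, min_def]
      split_ifs <;> first | omega | (simp only [false_and, false_or] at *; omega)
    rw [abs_le]
    unfold cycDist
    omega

/-- The first coordinate of the boundary walk of the grid, starting at the origin. -/
def ringX (m s : ℕ) : ℕ :=
  if s ≤ 3 * m then 0 else if s ≤ 5 * m then s - 3 * m else if s ≤ 8 * m then 2 * m
    else 10 * m - s

/-- The second coordinate of the boundary walk of the grid, starting at the origin. -/
def ringY (m s : ℕ) : ℕ :=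
  if s ≤ 3 * m then s else if s ≤ 5 * m then 3 * m else if s ≤ 8 * m then 8 * m - s else 0

theorem ringX_le {i : ℕ} : ringX m i ≤ 2 * m := by
  unfold ringX
  split_ifs <;> omega

theorem ringY_le {i : ℕ} : ringY m i ≤ 3 * m := by
  unfold ringY
  split_ifs <;> omega

theorem ring_injective {i j : ℕ} (hi : i < 10 * m) (hj : j < 10 * m)
    (hX : ringX m i = ringX m j) (hY : ringY m i = ringY m j) : i = j := by
  unfold ringX at hX
  unfold ringY at hY
  split_ifs at hX hY <;> omega

theorem gridDepth_ring {i : ℕ} : gridDepth m (ringX m i) (ringY m i) = 0 := by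
  unfold gridDepth ringX ringY
  split_ifs <;> omega

theorem gridPot_ring {i : ℕ} :
    gridPot m s (ringX m i) (ringY m i) =
      m * cycDist m (gridHeight m (ringX m i) (ringY m i)) s := by
  rw [gridPot, gridDepth_ring, sub_zero]

theorem gridHeight_ring {i : ℕ} (hi : i < 10 * m) : gridHeight m (ringX m i) (ringY m i) =
    if i ≤ 4 * m then max 0 (min ((i : ℤ) - m) m) else min (2 * m) (max m ((i : ℤ) - 5 * m)) := by
  unfold gridHeight ringX ringY
  split_ifs <;> omega

theorem gridHeight_ring_succ {i : ℕ} (hi : i + 1 < 10 * m) :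
    gridHeight m (ringX m i) (ringY m i) ≤ gridHeight m (ringX m (i + 1)) (ringY m (i + 1)) ∧
    gridHeight m (ringX m (i + 1)) (ringY m (i + 1)) ≤
      gridHeight m (ringX m i) (ringY m i) + 1 := by
  rw [gridHeight_ring hi, gridHeight_ring (by omega)]
  split_ifs <;> omega

end GridPotential

section Telescope
variable {R : Type*} [AddCommGroup R]

theorem sum_range_add_succ (h2 : ∀ r : R, r + r = 0) (f : ℕ → R) (n : ℕ) :
    ∑ i ∈ Finset.range n, (f i + f (i + 1)) = f 0 + f n := by
  induction n with
  | zero => simp [h2]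
  | succ n ih =>
    rw [Finset.sum_range_succ, ih]
    calc _ = f 0 + f (n + 1) + (f n + f n) := by abel
      _ = _ := by rw [h2, add_zero]

/-- In characteristic two, the cells of a grid sum to its boundary. -/
theorem sum_cells (h2 : ∀ r : R, r + r = 0) (h v : ℕ → ℕ → R) (X Y : ℕ) :
    ∑ x ∈ Finset.range X, ∑ y ∈ Finset.range Y,
      (h x y + h x (y + 1) + (v x y + v (x + 1) y)) =
    ∑ x ∈ Finset.range X, (h x 0 + h x Y) + ∑ y ∈ Finset.range Y, (v 0 y + v X y) := by
  simp only [Finset.sum_add_distrib (f := fun y => h _ y + h _ (y + 1)),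
    sum_range_add_succ h2 (h _)]
  rw [Finset.sum_add_distrib]
  congr 1
  rw [Finset.sum_comm]
  exact Finset.sum_congr rfl fun y _ => sum_range_add_succ h2 (fun x => v x y) X

/-- The edge labels along the boundary walk of the grid. -/
def ringLabel (m : ℕ) (h v : ℕ → ℕ → R) (s : ℕ) : R :=
  if s < 3 * m then v 0 s else if s < 5 * m then h (s - 3 * m) (3 * m)
    else if s < 8 * m then v (2 * m) (8 * m - 1 - s) else h (10 * m - 1 - s) 0

theorem sum_ringLabel (m : ℕ) (h v : ℕ → ℕ → R) :
    ∑ s ∈ Finset.range (10 * m), ringLabel m h v s =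
      ∑ x ∈ Finset.range (2 * m), (h x 0 + h x (3 * m)) +
        ∑ y ∈ Finset.range (3 * m), (v 0 y + v (2 * m) y) := by
  have hm : 10 * m = 3 * m + 2 * m + 3 * m + 2 * m := by ring
  rw [hm, Finset.sum_range_add, Finset.sum_range_add, Finset.sum_range_add]
  have h1 : ∀ s ∈ Finset.range (3 * m), ringLabel m h v s = v 0 s := fun s hs => by
    rw [Finset.mem_range] at hs
    rw [ringLabel, if_pos hs]
  have h2 : ∀ s ∈ Finset.range (2 * m), ringLabel m h v (3 * m + s) = h s (3 * m) :=
    fun s hs => by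
      rw [Finset.mem_range] at hs
      rw [ringLabel, if_neg (by omega), if_pos (by omega), Nat.add_sub_cancel_left]
  have h3 : ∀ s ∈ Finset.range (3 * m), ringLabel m h v (3 * m + 2 * m + s) =
      v (2 * m) (3 * m - 1 - s) := fun s hs => by
    rw [Finset.mem_range] at hs
    rw [ringLabel, if_neg (by omega), if_neg (by omega), if_pos (by omega)]
    congr 1
    omega
  have h4 : ∀ s ∈ Finset.range (2 * m), ringLabel m h v (3 * m + 2 * m + 3 * m + s) =
      h (2 * m - 1 - s) 0 := fun s hs => by
    rw [Finset.mem_range] at hs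
    rw [ringLabel, if_neg (by omega), if_neg (by omega), if_neg (by omega)]
    congr 1
    omega
  rw [Finset.sum_congr rfl h1, Finset.sum_congr rfl h2, Finset.sum_congr rfl h3,
    Finset.sum_congr rfl h4, Finset.sum_range_reflect (fun y => v (2 * m) y),
    Finset.sum_range_reflect (fun x => h x 0), Finset.sum_add_distrib, Finset.sum_add_distrib]
  abel

end Telescope

section GridMetric
variable {V : Type*} {G : SimpleGraph V} {m : ℕ} {B : ℕ → ℕ → Set V} {s : ℤ} {x y : ℕ} {u v : V}

open Classical in
/-- Transport a function of grid positions to the vertices of a grid model. -/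
noncomputable def liftGrid (m : ℕ) (B : ℕ → ℕ → Set V) (f : ℕ → ℕ → ℤ) (v : V) : ℤ :=
  if h : ∃ q : ℕ × ℕ, q.1 ≤ 2 * m ∧ q.2 ≤ 3 * m ∧ v ∈ B q.1 q.2 then
    f h.choose.1 h.choose.2 else 0

theorem IsGrid.liftGrid_eq (hB : IsGrid G (2 * m) (3 * m) B) (hx : x ≤ 2 * m) (hy : y ≤ 3 * m)
    (hv : v ∈ B x y) (f : ℕ → ℕ → ℤ) : liftGrid m B f v = f x y := by
  have h : ∃ q : ℕ × ℕ, q.1 ≤ 2 * m ∧ q.2 ≤ 3 * m ∧ v ∈ B q.1 q.2 := ⟨(x, y), hx, hy, hv⟩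
  rw [liftGrid, dif_pos h]
  obtain ⟨h1, h2, h3⟩ := h.choose_spec
  obtain ⟨h4, h5⟩ := hB.disj _ h1 _ h2 x hx y hy v h3 hv
  rw [h4, h5]

theorem liftGrid_gridHeight_mem (v : V) :
    0 ≤ liftGrid m B (gridHeight m) v ∧ liftGrid m B (gridHeight m) v ≤ 2 * m := by
  unfold liftGrid
  split_ifs
  · exact gridHeight_mem ..
  · omega

/-- The largest change of the grid potentials along an edge. -/
noncomputable def gridWeight (m : ℕ) (B : ℕ → ℕ → Set V) : Sym2 V → ℚ :=
  Sym2.lift ⟨fun u v => (((Finset.Icc (0 : ℤ) (2 * m)).sup fun s =>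
    (liftGrid m B (gridPot m s) v - liftGrid m B (gridPot m s) u).natAbs : ℕ) : ℚ), fun u v => by
      refine congrArg Nat.cast (Finset.sup_congr rfl fun s _ => ?_)
      rw [← Int.natAbs_neg, neg_sub]⟩

theorem gridWeight_nonneg (e : Sym2 V) : 0 ≤ gridWeight m B e := by
  induction e
  exact Nat.cast_nonneg _

theorem le_gridWeight (hs : 0 ≤ s ∧ s ≤ 2 * m) (u v : V) :
    (liftGrid m B (gridPot m s) v - liftGrid m B (gridPot m s) u : ℚ) ≤
      gridWeight m B s(u, v) := by
  have h1 := Finset.le_sup (f := fun s =>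
    (liftGrid m B (gridPot m s) v - liftGrid m B (gridPot m s) u).natAbs)
    (Finset.mem_Icc.2 hs)
  have h2 : liftGrid m B (gridPot m s) v - liftGrid m B (gridPot m s) u ≤
      (((Finset.Icc (0 : ℤ) (2 * m)).sup fun s =>
        (liftGrid m B (gridPot m s) v - liftGrid m B (gridPot m s) u).natAbs : ℕ) : ℤ) := by
    have := Int.le_natAbs (a := liftGrid m B (gridPot m s) v - liftGrid m B (gridPot m s) u)
    omega
  have h3 := (Int.cast_le (R := ℚ)).2 h2
  rwa [Int.cast_sub, Int.cast_natCast] at h3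

theorem gridWeight_le {c : ℕ}
    (h : ∀ s : ℤ, 0 ≤ s ∧ s ≤ 2 * m →
      |liftGrid m B (gridPot m s) v - liftGrid m B (gridPot m s) u| ≤ c) :
    gridWeight m B s(u, v) ≤ c := by
  rw [gridWeight, Sym2.lift_mk, Nat.cast_le]
  refine Finset.sup_le fun s hs => ?_
  have := abs_le.1 (h s (Finset.mem_Icc.1 hs))
  omega

theorem IsGrid.gridWeight_inside (hB : IsGrid G (2 * m) (3 * m) B) (hx : x ≤ 2 * m)
    (hy : y ≤ 3 * m) (hu : u ∈ B x y) (hv : v ∈ B x y) : gridWeight m B s(u, v) = 0 := by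
  refine le_antisymm ?_ (gridWeight_nonneg _)
  have := gridWeight_le (m := m) (B := B) (u := u) (v := v) (c := 0) fun s _ => by
    rw [hB.liftGrid_eq hx hy hu, hB.liftGrid_eq hx hy hv]
    simp
  exact_mod_cast this

theorem IsGrid.gridWeight_horiz (hB : IsGrid G (2 * m) (3 * m) B) (hm : 1 ≤ m) (hx : x < 2 * m)
    (hy : y ≤ 3 * m) (hu : u ∈ B x y) (hv : v ∈ B (x + 1) y) :
    gridWeight m B s(u, v) ≤ 2 * m := by
  have := gridWeight_le (m := m) (B := B) (u := u) (v := v) (c := 2 * m) fun s hs => by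
    rw [hB.liftGrid_eq hx.le hy hu, hB.liftGrid_eq hx hy hv]
    exact_mod_cast gridPot_horiz hm hs hx hy
  exact_mod_cast this

theorem IsGrid.gridWeight_vert (hB : IsGrid G (2 * m) (3 * m) B) (hm : 1 ≤ m) (hx : x ≤ 2 * m)
    (hy : y < 3 * m) (hu : u ∈ B x y) (hv : v ∈ B x (y + 1)) :
    gridWeight m B s(u, v) ≤ 2 * m := by
  have := gridWeight_le (m := m) (B := B) (u := u) (v := v) (c := 2 * m) fun s hs => by
    rw [hB.liftGrid_eq hx hy.le hu, hB.liftGrid_eq hx hy hv]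
    exact_mod_cast gridPot_vert hm hs hx hy
  exact_mod_cast this

/-- The branch sets along the boundary of the grid. -/
def ringSet (m : ℕ) (B : ℕ → ℕ → Set V) (i : ℕ) : Set V := B (ringX m i) (ringY m i)

theorem IsGrid.liftGrid_ring (hB : IsGrid G (2 * m) (3 * m) B) {i : ℕ} (hv : v ∈ ringSet m B i)
    (f : ℕ → ℕ → ℤ) : liftGrid m B f v = f (ringX m i) (ringY m i) :=
  hB.liftGrid_eq ringX_le ringY_le hv f

theorem IsGrid.gridPot_ring (hB : IsGrid G (2 * m) (3 * m) B) {i : ℕ} (hv : v ∈ ringSet m B i) :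
    liftGrid m B (gridPot m s) v = m * cycDist m (liftGrid m B (gridHeight m) v) s := by
  rw [hB.liftGrid_ring hv, hB.liftGrid_ring hv, _root_.gridPot_ring]

theorem IsGrid.gridWeight_ring_step (hB : IsGrid G (2 * m) (3 * m) B) (hm : 1 ≤ m) {i : ℕ}
    (hi : i + 1 < 10 * m) (hu : u ∈ ringSet m B i) (hv : v ∈ ringSet m B (i + 1)) :
    gridWeight m B s(u, v) =
      m * liftGrid m B (gridHeight m) v - m * liftGrid m B (gridHeight m) u := by
  have hu' := liftGrid_gridHeight_mem (m := m) (B := B) u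
  have hv' := liftGrid_gridHeight_mem (m := m) (B := B) v
  have hstep := gridHeight_ring_succ hi
  rw [← hB.liftGrid_ring hu (gridHeight m), ← hB.liftGrid_ring hv (gridHeight m)] at hstep
  have hle := le_gridWeight (m := m) (B := B) hu' u v
  rw [hB.gridPot_ring hu, hB.gridPot_ring hv] at hle
  have hge := gridWeight_le (m := m) (B := B) (u := u) (v := v)
    (c := m * (liftGrid m B (gridHeight m) v - liftGrid m B (gridHeight m) u).toNat)
    fun s hs => by
      rw [hB.gridPot_ring hu, hB.gridPot_ring hv, ← mul_sub, abs_mul, Nat.abs_cast,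
        Nat.cast_mul]
      refine mul_le_mul_of_nonneg_left ?_ (by positivity)
      rw [abs_le]
      unfold cycDist
      omega
  generalize liftGrid m B (gridHeight m) u = a at *
  generalize liftGrid m B (gridHeight m) v = b at *
  have h1 : cycDist m b a = b - a := by
    unfold cycDist
    omega
  have h2 : cycDist m a a = 0 := by
    unfold cycDist
    omega
  rw [h1, h2] at hle
  have h3 : (((b - a).toNat : ℕ) : ℚ) = b - a := by
    have : (((b - a).toNat : ℕ) : ℤ) = b - a := Int.toNat_of_nonneg (by omega)
    exact_mod_cast this
  rw [Nat.cast_mul, h3] at hge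
  push_cast at hle
  linarith

theorem IsGrid.gridWeight_ring_close (hB : IsGrid G (2 * m) (3 * m) B) {i j : ℕ}
    (hu : u ∈ ringSet m B i) (hv : v ∈ ringSet m B j)
    (hu0 : liftGrid m B (gridHeight m) u = 0) (hvm : liftGrid m B (gridHeight m) v = 2 * m) :
    gridWeight m B s(v, u) = 0 := by
  refine le_antisymm ?_ (gridWeight_nonneg _)
  have := gridWeight_le (m := m) (B := B) (u := v) (v := u) (c := 0) fun s hs => by
    rw [hB.gridPot_ring hu, hB.gridPot_ring hv, hu0, hvm]
    have : cycDist m 0 s = cycDist m (2 * m) s := by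
      unfold cycDist
      omega
    simp [this]
  exact_mod_cast this

end GridMetric

section Assembly

theorem walkLen_div {V : Type*} {G : SimpleGraph V} (ℓ : Sym2 V → ℚ) (M : ℚ) {a b : V}
    (p : G.Walk a b) : walkLen (fun e => ℓ e / M) p = walkLen ℓ p / M := by
  induction p with
  | nil => simp
  | cons h p ih => rw [walkLen_cons, walkLen_cons, ih, add_div]

theorem IsGeodesic.div {V : Type*} {G : SimpleGraph V} {ℓ : Sym2 V → ℚ} {v : V} {c : G.Walk v v}
    (h : IsGeodesic ℓ c) {M : ℚ} (hM : 0 < M) : IsGeodesic (fun e => ℓ e / M) c := by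
  intro a ha b hb
  obtain ⟨p, hp, hpc, hmin⟩ := h a ha b hb
  refine ⟨p, hp, hpc, fun q hq => ?_⟩
  rw [walkLen_div, walkLen_div]
  exact div_le_div_of_nonneg_right (hmin q hq) hM.le

variable {V : Type*} {G : SimpleGraph V} {m : ℕ} {B : ℕ → ℕ → Set V} [Fintype V] {δ : ℚ}

/-- The boundary labels of a grid model sum to zero modulo short cycles. -/
theorem IsGrid.sum_ringLabel_mem (hB : IsGrid G (2 * m) (3 * m) B) (hm : 1 ≤ m) (hδ0 : 0 ≤ δ)
    (hδ : (8 * Fintype.card V + 4) * δ ≤ 1) {b : ℕ → ℕ → V} {h v : ℕ → ℕ → Sym2 V → ZMod 2}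
    (hh : ∀ x < 2 * m, ∀ y ≤ 3 * m, HopVec G (B x y) (B (x + 1) y) (b x y) (b (x + 1) y) (h x y))
    (hv : ∀ x ≤ 2 * m, ∀ y < 3 * m,
      HopVec G (B x y) (B x (y + 1)) (b x y) (b x (y + 1)) (v x y)) :
    ∑ s ∈ Finset.range (10 * m), ringLabel m h v s ∈
      shortSpan G (fun e => gridWeight m B e + δ) (8 * m + 1) := by
  have hin : ∀ x ≤ 2 * m, ∀ y ≤ 3 * m, ∀ u ∈ B x y, ∀ w ∈ B x y, G.Adj u w →
      gridWeight m B s(u, w) + δ ≤ δ := fun x hx y hy u hu w hw _ => by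
    rw [hB.gridWeight_inside hx hy hu hw, zero_add]
  have hH : ∀ x < 2 * m, ∀ y ≤ 3 * m, ∃ p : G.Walk (b x y) (b (x + 1) y), edgeVec p = h x y ∧
      walkLen (fun e => gridWeight m B e + δ) p ≤ 2 * m + δ + 2 * (Fintype.card V * δ) :=
    fun x hx y hy => (hh x hx y hy).exists_walk hδ0 (hin x hx.le y hy) (hin (x + 1) hx y hy)
      fun u hu w hw _ => by
        have := hB.gridWeight_horiz hm hx hy hu hw
        linarith
  have hV : ∀ x ≤ 2 * m, ∀ y < 3 * m, ∃ p : G.Walk (b x y) (b x (y + 1)), edgeVec p = v x y ∧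
      walkLen (fun e => gridWeight m B e + δ) p ≤ 2 * m + δ + 2 * (Fintype.card V * δ) :=
    fun x hx y hy => (hv x hx y hy).exists_walk hδ0 (hin x hx y hy.le) (hin x hx (y + 1) hy)
      fun u hu w hw _ => by
        have := hB.gridWeight_vert hm hx hy hu hw
        linarith
  rw [sum_ringLabel, ← sum_cells edgeVec_add_self]
  refine sum_mem fun x hx => sum_mem fun y hy => ?_
  rw [Finset.mem_range] at hx hy
  obtain ⟨p₁, hp₁, hl₁⟩ := hH x hx y hy.le
  obtain ⟨p₂, hp₂, hl₂⟩ := hV (x + 1) hx y hy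
  obtain ⟨p₃, hp₃, hl₃⟩ := hH x hx (y + 1) hy
  obtain ⟨p₄, hp₄, hl₄⟩ := hV x hx.le y hy
  have := edgeVec_mem_shortSpan (G := G) (ℓ := fun e => gridWeight m B e + δ) (M := 8 * m + 1)
    (fun e _ => add_nonneg (gridWeight_nonneg e) hδ0)
    ((p₁.append p₂).append (p₄.append p₃).reverse) (by
      simp only [walkLen_append, walkLen_reverse]
      linarith)
  convert this using 1
  simp only [edgeVec_append, edgeVec_reverse, hp₁, hp₂, hp₃, hp₄]
  abel

/-- The boundary of a grid model carries a cycle generated by short cycles. -/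
theorem IsGrid.exists_ring_cycle (hB : IsGrid G (2 * m) (3 * m) B) (hm : 1 ≤ m) (hδ0 : 0 ≤ δ)
    (hδ : (8 * Fintype.card V + 4) * δ ≤ 1) :
    ∃ (u v : V) (h : G.Adj v u) (p : G.Walk u v), u ∈ ringSet m B 0 ∧
      v ∈ ringSet m B (10 * m - 1) ∧ (Walk.cons h p).IsCycle ∧
      (∀ z ∈ p.support, ∃ s ≤ 10 * m - 1, z ∈ ringSet m B s) ∧
      (∀ d ∈ p.darts, ∃ s ≤ 10 * m - 1, d.fst ∈ ringSet m B s ∧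
        (d.snd ∈ ringSet m B s ∨ s < 10 * m - 1 ∧ d.snd ∈ ringSet m B (s + 1))) ∧
      edgeVec (.cons h p) ∈ shortSpan G (fun e => gridWeight m B e + δ) (8 * m + 1) := by
  have hne : ∀ x y, ∃ b, x ≤ 2 * m → y ≤ 3 * m → b ∈ B x y := fun x y => by
    by_cases hxy : x ≤ 2 * m ∧ y ≤ 3 * m
    · obtain ⟨b, hb⟩ := hB.nonempty x hxy.1 y hxy.2
      exact ⟨b, fun _ _ => hb⟩
    · obtain ⟨b, -⟩ := hB.nonempty 0 (by omega) 0 (by omega)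
      exact ⟨b, fun hx hy => absurd ⟨hx, hy⟩ hxy⟩
  choose b hb using hne
  have hh : ∀ x y, ∃ σ, x < 2 * m → y ≤ 3 * m →
      HopVec G (B x y) (B (x + 1) y) (b x y) (b (x + 1) y) σ := fun x y => by
    by_cases hxy : x < 2 * m ∧ y ≤ 3 * m
    · obtain ⟨σ, hσ⟩ := exists_hopVec (hB.conn x hxy.1.le y hxy.2) (hB.conn (x + 1) hxy.1 y hxy.2)
        (hb x y hxy.1.le hxy.2) (hb (x + 1) y hxy.1 hxy.2) (hB.horiz x hxy.1 y hxy.2)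
      exact ⟨σ, fun _ _ => hσ⟩
    · exact ⟨0, fun hx hy => absurd ⟨hx, hy⟩ hxy⟩
  have hv : ∀ x y, ∃ σ, x ≤ 2 * m → y < 3 * m →
      HopVec G (B x y) (B x (y + 1)) (b x y) (b x (y + 1)) σ := fun x y => by
    by_cases hxy : x ≤ 2 * m ∧ y < 3 * m
    · obtain ⟨σ, hσ⟩ := exists_hopVec (hB.conn x hxy.1 y hxy.2.le) (hB.conn x hxy.1 (y + 1) hxy.2)
        (hb x y hxy.1 hxy.2.le) (hb x (y + 1) hxy.1 hxy.2) (hB.vert x hxy.1 y hxy.2)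
      exact ⟨σ, fun _ _ => hσ⟩
    · exact ⟨0, fun hx hy => absurd ⟨hx, hy⟩ hxy⟩
  choose h hh using hh
  choose v hv using hv
  have hhop : ∀ s ≤ 10 * m - 1, HopVec G (ringSet m B s) (ringSet m B (s + 1))
      (b (ringX m s) (ringY m s)) (b (ringX m (s + 1)) (ringY m (s + 1)))
      (ringLabel m h v s) := fun s hs => by
    unfold ringSet ringLabel
    split_ifs with h1 h2 h3
    · have e1 : ringX m s = 0 := by unfold ringX; split_ifs <;> omega
      have e2 : ringY m s = s := by unfold ringY; split_ifs <;> omega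
      have e3 : ringX m (s + 1) = 0 := by unfold ringX; split_ifs <;> omega
      have e4 : ringY m (s + 1) = s + 1 := by unfold ringY; split_ifs <;> omega
      rw [e1, e2, e3, e4]
      exact hv 0 s (by omega) h1
    · have e1 : ringX m s = s - 3 * m := by unfold ringX; split_ifs <;> omega
      have e2 : ringY m s = 3 * m := by unfold ringY; split_ifs <;> omega
      have e3 : ringX m (s + 1) = s - 3 * m + 1 := by unfold ringX; split_ifs <;> omega
      have e4 : ringY m (s + 1) = 3 * m := by unfold ringY; split_ifs <;> omega
      rw [e1, e2, e3, e4]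
      exact hh _ _ (by omega) le_rfl
    · have e1 : ringX m s = 2 * m := by unfold ringX; split_ifs <;> omega
      have e2 : ringY m s = 8 * m - 1 - s + 1 := by unfold ringY; split_ifs <;> omega
      have e3 : ringX m (s + 1) = 2 * m := by unfold ringX; split_ifs <;> omega
      have e4 : ringY m (s + 1) = 8 * m - 1 - s := by unfold ringY; split_ifs <;> omega
      rw [e1, e2, e3, e4]
      exact (hv _ _ le_rfl (by omega)).symm
    · have e1 : ringX m s = 10 * m - 1 - s + 1 := by unfold ringX; split_ifs <;> omega
      have e2 : ringY m s = 0 := by unfold ringY; split_ifs <;> omega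
      have e3 : ringX m (s + 1) = 10 * m - 1 - s := by unfold ringX; split_ifs <;> omega
      have e4 : ringY m (s + 1) = 0 := by unfold ringY; split_ifs <;> omega
      rw [e1, e2, e3, e4]
      exact (hh _ _ (by omega) (by omega)).symm
  have hX : ringX m (10 * m - 1 + 1) = ringX m 0 := by unfold ringX; split_ifs <;> omega
  have hY : ringY m (10 * m - 1 + 1) = ringY m 0 := by unfold ringY; split_ifs <;> omega
  have hcard : (0 : ℚ) ≤ Fintype.card V * δ := by positivity
  obtain ⟨u, w, hadj, p, hu, hw, hc, hps, hpd, hpv⟩ := exists_cycle_through (G := G)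
    (ℓ := fun e => gridWeight m B e + δ) (M := 8 * m + 1) (A := ringSet m B)
    (bs := fun s => b (ringX m s) (ringY m s)) (σ := ringLabel m h v)
    (fun e _ => add_nonneg (gridWeight_nonneg e) hδ0) hδ0 (by
      have : (0 : ℚ) ≤ m := by positivity
      linarith) (n := 10 * m - 1) (by omega)
    (fun s _ => hB.conn _ ringX_le _ ringY_le)
    (fun s hs t ht z hz hz' => by
      obtain ⟨h1, h2⟩ := hB.disj _ ringX_le _ ringY_le _ ringX_le _ ringY_le z hz hz'
      exact ring_injective (by omega) (by omega) h1 h2)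
    (fun s _ x hx y hy _ => by
      rw [hB.gridWeight_inside ringX_le ringY_le hx hy, zero_add])
    (by simp only [ringSet, hX, hY]) (by simp only [hX, hY]) hhop
  refine ⟨u, w, hadj, p, hu, hw, hc, hps, hpd, ?_⟩
  have hm' : 10 * m - 1 + 1 = 10 * m := by omega
  rw [hm'] at hpv
  have := add_mem hpv (hB.sum_ringLabel_mem hm hδ0 hδ
    (fun x hx y hy => hh x y hx hy) (fun x hx y hy => hv x y hx hy))
  rwa [add_assoc, edgeVec_add_self, add_zero] at this

end Assembly

section Main

theorem IsGrid.exists_geodesic_cycle {V : Type} [Fintype V] {G : SimpleGraph V} {m : ℕ}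
    {B : ℕ → ℕ → Set V} (hB : IsGrid G (2 * m) (3 * m) B) (hm : 1 ≤ m) :
    ∃ ℓ : Sym2 V → ℚ, (∀ e, 0 < ℓ e) ∧ ∃ (v : V) (c : G.Walk v v),
      c.IsCycle ∧ IsGeodesic ℓ c ∧ 2 * m ^ 2 / (8 * m + 1) ≤ walkLen ℓ c ∧
        ∃ (ι : Type) (_ : Fintype ι) (u : ι → V) (D : ∀ i, G.Walk (u i) (u i)),
          (∀ i, (D i).IsCycle) ∧ (∀ i, walkLen ℓ (D i) ≤ 1) ∧
            ∀ e : Sym2 V, e ∈ c.edges ↔ Odd {i : ι | e ∈ (D i).edges}.ncard := by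
  set δ : ℚ := 1 / (8 * Fintype.card V + 4) with hδ
  have hδ0 : 0 < δ := by positivity
  obtain ⟨u, v, h, p, hu, hv, hc, hps, hpd, hpv⟩ := hB.exists_ring_cycle hm hδ0.le
    (mul_one_div_cancel (by positivity)).le
  set τ : ℚ := δ / (p.length + 1) with hτ
  have hτ0 : 0 < τ := by positivity
  have hM : (0 : ℚ) < 8 * m + 1 := by positivity
  set t : V → ℤ := liftGrid m B (gridHeight m) with ht
  have hu0 : t u = 0 := by
    rw [ht, hB.liftGrid_ring hu, gridHeight_ring (by omega), if_pos (by omega)]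
    omega
  have hvm : t v = 2 * m := by
    rw [ht, hB.liftGrid_ring hv, gridHeight_ring (by omega), if_neg (by omega)]
    omega
  have hstep : ∀ d ∈ p.darts, gridWeight m B d.edge = m * t d.snd - m * t d.fst := by
    intro d hd
    obtain ⟨s, hs, h1, h2 | ⟨h2, h3⟩⟩ := hpd d hd
    · have h4 : t d.fst = t d.snd := by
        rw [ht, hB.liftGrid_ring h1, hB.liftGrid_ring h2]
      rw [h4, sub_self]
      exact hB.gridWeight_inside ringX_le ringY_le h1 h2
    · exact hB.gridWeight_ring_step hm (by omega) h1 h3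
  have hclose : gridWeight m B s(v, u) = 0 := hB.gridWeight_ring_close hu hv hu0 hvm
  have hgeo : IsGeodesic (perturb (gridWeight m B) τ δ (Walk.cons h p)) (Walk.cons h p) := by
    refine isGeodesic_perturb (θ := fun z => m * t z) (T := 2 * m ^ 2) gridWeight_nonneg
      (fun d hd => (hstep d hd).le) ?_ (fun a z => liftGrid m B (gridPot m (t a)) z)
      (fun a x y _ => le_gridWeight (liftGrid_gridHeight_mem a) x y) ?_ hτ0.le
      (mul_div_cancel₀ δ (by positivity)).le
    · rw [hclose, hu0, hvm]
      push_cast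
      exact le_of_eq (by ring)
    · intro a ha b hb
      obtain ⟨i, -, hi⟩ := hps a ha
      obtain ⟨j, -, hj⟩ := hps b hb
      have h1 : cycDist m (t a) (t a) = 0 := by
        unfold cycDist
        omega
      have h2 : cycDist m (t b) (t a) = min |t a - t b| (2 * m - |t a - t b|) := by
        rw [cycDist, abs_sub_comm, abs_eq_max_neg, neg_sub]
      have h3 : |(m * t a - m * t b : ℚ)| = m * (|t a - t b| : ℤ) := by
        rw [← mul_sub, abs_mul, Nat.abs_cast]
        push_cast
        rfl
      rw [hB.gridPot_ring hi, hB.gridPot_ring hj, ← ht, h1, h2, h3]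
      have hm0 : (0 : ℚ) ≤ m := by positivity
      push_cast
      rw [mul_zero, sub_zero, mul_min_of_nonneg _ _ hm0]
      exact le_of_eq (by ring_nf)
  refine ⟨fun e => perturb (gridWeight m B) τ δ (Walk.cons h p) e / (8 * m + 1), fun e => ?_, v,
    Walk.cons h p, hc, hgeo.div hM, ?_, ?_⟩
  · refine div_pos (add_pos_of_nonneg_of_pos (gridWeight_nonneg e) ?_) hM
    split_ifs <;> assumption
  · rw [walkLen_div]
    refine div_le_div_of_nonneg_right ?_ hM.le
    have h1 : walkLen (gridWeight m B) p ≤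
        walkLen (perturb (gridWeight m B) τ δ (Walk.cons h p)) (Walk.cons h p) := by
      have h2 : walkLen (gridWeight m B) p ≤ walkLen (gridWeight m B) (Walk.cons h p) := by
        rw [walkLen_cons, hclose, zero_add]
      refine h2.trans (walkLen_mono _ fun e _ => le_add_of_nonneg_right ?_)
      split_ifs <;> exact le_of_lt ‹_›
    have h2 := le_walkLen_of_darts (θ := fun z => (m * t z : ℚ)) p fun d hd => (hstep d hd).ge
    rw [hu0, hvm] at h2
    push_cast at h2
    linarith
  · obtain ⟨ι, hι, x, D, hD, hlen, hodd⟩ := exists_family_of_mem_shortSpan hc hpv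
    refine ⟨ι, hι, x, D, hD, fun i => ?_, hodd⟩
    rw [walkLen_div, div_le_one hM]
    refine (walkLen_mono _ fun e _ => ?_).trans (hlen i)
    refine add_le_add_right ?_ _
    split_ifs
    · exact div_le_self hδ0.le (by linarith [(Nat.cast_nonneg p.length : (0 : ℚ) ≤ p.length)])
    · exact le_rfl

end Main

theorem converse_of_main_theorem :
    ∀ L : ℝ, ∃ k : ℕ, 0 < k ∧
      ∀ (V : Type) [Fintype V] (G : SimpleGraph V), k ≤ treewidth G →
        ∃ ℓ : Sym2 V → ℚ, (∀ e ∈ G.edgeSet, 0 < ℓ e) ∧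
          ∃ (v : V) (c : G.Walk v v), c.IsCycle ∧ IsGeodesic ℓ c ∧
            L ≤ (walkLen ℓ c : ℝ) ∧
            ∃ (ι : Type) (_ : Fintype ι) (u : ι → V) (D : ∀ i, G.Walk (u i) (u i)),
              (∀ i, (D i).IsCycle) ∧ (∀ i, walkLen ℓ (D i) ≤ 1) ∧
              ∀ e : Sym2 V, e ∈ c.edges ↔ Odd {i : ι | e ∈ (D i).edges}.ncard := by
  intro L
  obtain ⟨n, hn⟩ := exists_nat_ge (5 * L)
  set m := n + 1 with hm
  obtain ⟨k, hk, hgrid⟩ := exists_isGrid_of_le_treewidth (2 * m) (3 * m)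
  refine ⟨k, hk, fun V _ G hG => ?_⟩
  obtain ⟨B, hB⟩ := hgrid V G hG
  obtain ⟨ℓ, hℓ, v, c, hc, hgeo, hlen, hfam⟩ := hB.exists_geodesic_cycle (by omega)
  refine ⟨ℓ, fun e _ => hℓ e, v, c, hc, hgeo, le_trans ?_ (Rat.cast_le (K := ℝ).2 hlen), hfam⟩
  have hL : 5 * L ≤ m := hn.trans (by exact_mod_cast n.le_succ)
  have hm1 : (1 : ℝ) ≤ m := by exact_mod_cast (by omega : 1 ≤ m)
  push_cast
  rw [le_div_iff₀ (by positivity)]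
  nlinarith
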